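/- Let m, n, ℓ be integers with m ≥ 3, n ≥ m, 0 ≤ ℓ ≤ m, and set Δ = 4mn − ℓ². For each integer γ ≥ 1 define the complex number S(γ) = Σ_{ℓ̃=−m+1}^{m} [ 2π·Σ_{ñ ≥ −1, 4mñ − ℓ̃² < 0} c_m^F(ñ, |ℓ̃|)·Kl(Δ/(4m), (4mñ − ℓ̃²)/(4m); γ, ψ)_{ℓℓ̃}·γ^{−1}·((ℓ̃² − 4mñ)/Δ)^{23/4}·I_{23/2}(π√(Δ(ℓ̃² − 4mñ))/(γm)) − [ℓ̃ = 0]·√(2m)·d(m)·Kl(Δ/(4m), −1; γ, ψ)_{ℓ0}·γ^{−1/2}·(4m/Δ)⁶·I_12(2π√(Δ/m)/γ) + (2π)^{−1}·d(m)·Σ_{g ≡ ℓ̃ (mod 2m), −mγ < g ≤ mγ} Kl(Δ/(4m), −1 − g²/(4m); γ, ψ)_{ℓℓ̃}·γ^{−2}·(4m/Δ)^{25/4}·∫_{−1/√m}^{1/√m} f_{γ,g,m}(x)·(1 − mx²)^{25/4}·I_{25/2}(2π√(Δ(1 − mx²))/(γ√m)) dx ]. Then the series (−1)^ℓ·e^{iπ/4}·Σ_{γ=1}^∞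 S(γ) converges and the real part of its sum is strictly positive. (This is the Rademacher-expansion form of the positivity of the immortal dyon index (−1)^{ℓ+1}c_m^F(n, ℓ).) -/

import Mathlib

open Real

noncomputable def besselI (ν x : ℝ) : ℝ :=
  ∑' k : ℕ, (x / 2) ^ (2 * (k : ℝ) + ν) / ((k.factorial : ℝ) * Real.Gamma ((k : ℝ) + ν + 1))

/-- The multiplier system `ψ(γ, δ)_{ℓ̃ℓ}` of the index-`m` theta functions, where
`α` is the inverse of `δ` modulo `γ` (taken in `[0, γ)`). -/
noncomputable def psiMult (m γ : ℕ) (δ : ℤ) (ℓt ℓ : ℤ) : ℂ :=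
  (((2 * m * γ : ℕ) : ℂ) * Complex.I) ^ (-(1 / 2 : ℂ)) *
    ∑ T ∈ Finset.range γ,
      Complex.exp (2 * (Real.pi : ℂ) * Complex.I *
        ((((((δ : ZMod γ)⁻¹).val : ℕ) : ℂ) * ((ℓt : ℂ) - 2 * m * T) ^ 2) / (4 * m * γ)
          - ((ℓ : ℂ) * ((ℓt : ℂ) - 2 * m * T)) / (2 * m * γ)
          + ((δ : ℂ) * (ℓ : ℂ) ^ 2) / (4 * m * γ)))

/-- The generalized Kloosterman sum `Kl(A, B; γ, ψ)_{ℓℓ̃}`: the sum runs over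
`δ = -j` with `0 ≤ j < γ` and `gcd(j, γ) = 1`, and `α(δ, γ)` is the inverse of `δ` mod `γ`. -/
noncomputable def Kl (m : ℕ) (A B : ℚ) (γ : ℕ) (ℓ ℓt : ℤ) : ℂ :=
  ∑ j ∈ (Finset.range γ).filter fun j => Nat.gcd j γ = 1,
    Complex.exp (2 * (Real.pi : ℂ) * Complex.I *
      (((((-(j : ℤ) : ZMod γ)⁻¹).val : ℕ) : ℂ) * (B : ℂ) / γ + ((-(j : ℤ) : ℤ) : ℂ) * (A : ℂ) / γ)) *
    psiMult m γ (-(j : ℤ)) ℓt ℓ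

/-- `d n`: the coefficient of `q^(n+1)` in `∏ (1 - q^j)^{-24}`. -/
def dcoef (n : ℤ) : ℤ :=
  if 0 ≤ n + 1 then
    ∑ v ∈ Finset.Nat.antidiagonalTuple 24 (n + 1).toNat,
      ∏ i, (Fintype.card (Nat.Partition (v i)) : ℤ)
  else 0

/-- The function `f_{γ,g,m}(x)`. -/
noncomputable def fFun (m γ : ℕ) (g : ℤ) (x : ℝ) : ℂ :=
  if g % (2 * (m : ℤ) * γ) = 0 then
    ((Real.pi ^ 2 / (Real.sinh (Real.pi * x / γ)) ^ 2 - (γ : ℝ) ^ 2 / x ^ 2 : ℝ) : ℂ)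
  else
    (Real.pi : ℂ) ^ 2 /
      (Complex.sinh ((Real.pi : ℂ) * x / γ - (Real.pi : ℂ) * Complex.I * g / (2 * m * γ))) ^ 2

/-- The inner integral `∫_{-1/√m}^{1/√m} f_{γ,g,m}(x) (1-mx²)^{25/4}
    I_{25/2}(2π√(Δ(1-mx²))/(γ√m)) dx`. -/
noncomputable def innerInt (m γ : ℕ) (g : ℤ) (Δ : ℤ) : ℂ :=
  ∫ x in (-(1 : ℝ) / Real.sqrt m)..(1 / Real.sqrt m),
    fFun m γ g x * (((1 - m * x ^ 2 : ℝ) ^ ((25 : ℝ) / 4) : ℝ) : ℂ) *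
      (besselI (25 / 2)
        (2 * Real.pi * Real.sqrt ((Δ : ℝ) * (1 - m * x ^ 2)) / (γ * Real.sqrt m)) : ℝ)

/-- The inner (finite) double sum over `ℓ̃` and `g` of the triple series,
for a given `γ ≥ 1`. -/
noncomputable def tripleTerm (m : ℕ) (ℓ : ℤ) (Δ : ℤ) (γ : ℕ) : ℂ :=
  ∑ ℓt ∈ Finset.Icc (-(m : ℤ) + 1) (m : ℤ),
    ∑ g ∈ (Finset.Ioc (-(m : ℤ) * γ) ((m : ℤ) * γ)).filter
        (fun g => g % (2 * (m : ℤ)) = ℓt % (2 * (m : ℤ))),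
      Kl m ((Δ : ℚ) / (4 * m)) (-1 - (g : ℚ) ^ 2 / (4 * m)) γ ℓ ℓt *
        ((γ : ℂ) ^ 2)⁻¹ * innerInt m γ g Δ

/-- The polar coefficient `c_m^F(ñ, ℓ̃)`, given by the `SL(2,ℤ)` continued-fraction sum. -/
noncomputable def polarCoef (m nt ℓt : ℤ) : ℤ :=
  ∑ᶠ (p : ℤ) (q : ℤ) (r : ℤ) (s : ℤ),
    if p * s - q * r = 1 ∧ 0 < r ∧ 0 < s ∧
        0 ≤ (ℓt : ℚ) / (2 * m) - (q : ℚ) / s ∧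
        (ℓt : ℚ) / (2 * m) - (q : ℚ) / s < 1 / ((r : ℚ) * s) then
      (-2 * r * s * nt - 2 * p * q * m + (p * s + q * r) * ℓt) *
        dcoef (r ^ 2 * nt + p ^ 2 * m - p * r * ℓt) *
        dcoef (s ^ 2 * nt + q ^ 2 * m - q * s * ℓt)
    else 0

/-- The `γ`-th term `S(γ)` of the Rademacher expansion of the immortal dyon index,
for charges `(m, n, ℓ)` with `Δ = 4mn − ℓ²`. -/
noncomputable def Sgamma (m : ℕ) (n ℓ : ℤ) (γ : ℕ) : ℂ :=
  ∑ ℓt ∈ Finset.Icc (-(m : ℤ) + 1) (m : ℤ),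
    ((((2 * Real.pi : ℝ)) : ℂ) *
        (∑ nt ∈ (Finset.Icc (-1 : ℤ) (m : ℤ)).filter fun nt => 4 * (m : ℤ) * nt - ℓt ^ 2 < 0,
          ((polarCoef m nt |ℓt| : ℤ) : ℂ) *
            Kl m (((4 * (m : ℤ) * n - ℓ ^ 2 : ℤ) : ℚ) / (4 * m))
              (((4 * (m : ℤ) * nt - ℓt ^ 2 : ℤ) : ℚ) / (4 * m)) γ ℓ ℓt *
            (γ : ℂ)⁻¹ *
            (((((ℓt ^ 2 - 4 * (m : ℤ) * nt : ℤ) : ℝ) /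
                  ((4 * (m : ℤ) * n - ℓ ^ 2 : ℤ) : ℝ)) ^ ((23 : ℝ) / 4) *
              besselI (23 / 2)
                (Real.pi * Real.sqrt (((4 * (m : ℤ) * n - ℓ ^ 2 : ℤ) : ℝ) *
                  ((ℓt ^ 2 - 4 * (m : ℤ) * nt : ℤ) : ℝ)) / (γ * m)) : ℝ) : ℂ))
      - (if ℓt = 0 then (1 : ℂ) else 0) *
          ((Real.sqrt (2 * m) * (dcoef m : ℝ) : ℝ) : ℂ) *
          Kl m (((4 * (m : ℤ) * n - ℓ ^ 2 : ℤ) : ℚ) / (4 * m)) (-1) γ ℓ 0 *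
          (((γ : ℝ) ^ (-(1 / 2 : ℝ)) : ℝ) : ℂ) *
          ((((4 * (m : ℝ)) / ((4 * (m : ℤ) * n - ℓ ^ 2 : ℤ) : ℝ)) ^ 6 *
            besselI 12
              (2 * Real.pi * Real.sqrt (((4 * (m : ℤ) * n - ℓ ^ 2 : ℤ) : ℝ) / m) / γ) : ℝ) : ℂ)
      + (((2 * Real.pi)⁻¹ * (dcoef m : ℝ) : ℝ) : ℂ) *
          ∑ g ∈ (Finset.Ioc (-(m : ℤ) * γ) ((m : ℤ) * γ)).filter
              fun g => g % (2 * (m : ℤ)) = ℓt % (2 * (m : ℤ)),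
            Kl m (((4 * (m : ℤ) * n - ℓ ^ 2 : ℤ) : ℚ) / (4 * m))
                (-1 - (g : ℚ) ^ 2 / (4 * m)) γ ℓ ℓt *
              ((γ : ℂ) ^ 2)⁻¹ *
              ((((4 * (m : ℝ)) / ((4 * (m : ℤ) * n - ℓ ^ 2 : ℤ) : ℝ)) ^ ((25 : ℝ) / 4) : ℝ) : ℂ) *
              innerInt m γ g (4 * (m : ℤ) * n - ℓ ^ 2))

/-- The entire function `∑ y^k / (k! Γ(k+ν+1))`, so that `I_ν(x) = (x/2)^ν F_ν(x²/4)`. -/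
noncomputable def besselF (ν y : ℝ) : ℝ :=
  ∑' k : ℕ, y ^ k / ((k.factorial : ℝ) * Real.Gamma ((k : ℝ) + ν + 1))

lemma besselI_eq {ν x : ℝ} (hν : 0 ≤ ν) (hx : 0 ≤ x) :
    besselI ν x = (x / 2) ^ ν * besselF ν (x ^ 2 / 4) := by
  unfold besselI besselF
  rw [← tsum_mul_left]
  refine tsum_congr fun k => ?_
  rw [Real.rpow_add_of_nonneg (by positivity) (by positivity) hν, Real.rpow_mul (by positivity)]
  have : ((x / 2) ^ (2 : ℝ)) ^ (k : ℝ) = (x ^ 2 / 4) ^ k := by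
    rw [Real.rpow_natCast, Real.rpow_two]; congr 1; ring
  rw [this]; ring

lemma besselF_term_nonneg {ν y : ℝ} (hν : 0 ≤ ν) (hy : 0 ≤ y) (k : ℕ) :
    0 ≤ y ^ k / ((k.factorial : ℝ) * Real.Gamma ((k : ℝ) + ν + 1)) := by
  have := Real.Gamma_pos_of_pos (show 0 < (k : ℝ) + ν + 1 by positivity)
  positivity

lemma besselF_summable {ν y : ℝ} (hν : 1 ≤ ν) (hy : 0 ≤ y) :
    Summable fun k : ℕ => y ^ k / ((k.factorial : ℝ) * Real.Gamma ((k : ℝ) + ν + 1)) := by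
  have h1 : Summable fun k : ℕ => y ^ k / (k.factorial : ℝ) * (Real.Gamma (ν + 1))⁻¹ :=
    (Real.summable_pow_div_factorial y).mul_right _
  refine Summable.of_nonneg_of_le (besselF_term_nonneg (by linarith) hy) (fun k => ?_) h1
  have hk : (0 : ℝ) ≤ k := k.cast_nonneg
  have h0 := Real.Gamma_pos_of_pos (show 0 < ν + 1 by linarith)
  have h2 : Real.Gamma (ν + 1) ≤ Real.Gamma ((k : ℝ) + ν + 1) :=
    Real.Gamma_strictMonoOn_Ici.monotoneOn (by simp only [Set.mem_Ici]; linarith)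
      (by simp only [Set.mem_Ici]; linarith) (by linarith)
  rw [← div_eq_mul_inv, div_div]
  gcongr

lemma besselF_pos {ν y : ℝ} (hν : 1 ≤ ν) (hy : 0 ≤ y) : 0 < besselF ν y := by
  refine (besselF_summable hν hy).tsum_pos (besselF_term_nonneg (by linarith) hy) 0 ?_
  have := Real.Gamma_pos_of_pos (show 0 < ((0 : ℕ) : ℝ) + ν + 1 by simp; linarith)
  rw [pow_zero]
  positivity

lemma besselF_mono {ν y z : ℝ} (hν : 1 ≤ ν) (hy : 0 ≤ y) (hyz : y ≤ z) :
    besselF ν y ≤ besselF ν z := by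
  refine Summable.tsum_le_tsum (fun k => ?_) (besselF_summable hν hy)
    (besselF_summable hν (hy.trans hyz))
  have := Real.Gamma_pos_of_pos (show 0 < (k : ℝ) + ν + 1 by positivity)
  gcongr

lemma Gamma_add_half_ge {x : ℝ} (hx : 1 / 2 < x) :
    √(x - 1 / 2) * Real.Gamma x ≤ Real.Gamma (x + 1 / 2) := by
  have h := Real.Gamma_mul_add_mul_le_rpow_Gamma_mul_rpow_Gamma
    (show 0 < x - 1 / 2 by linarith) (show 0 < x + 1 / 2 by linarith)
    (show (0 : ℝ) < 1 / 2 by norm_num) (show (0 : ℝ) < 1 / 2 by norm_num) (by norm_num)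
  have e1 : (1 / 2 : ℝ) * (x - 1 / 2) + 1 / 2 * (x + 1 / 2) = x := by ring
  have h2 : Real.Gamma (x + 1 / 2) = (x - 1 / 2) * Real.Gamma (x - 1 / 2) := by
    rw [← Real.Gamma_add_one (by linarith)]; congr 1; ring
  have hp := Real.Gamma_pos_of_pos (show 0 < x - 1 / 2 by linarith)
  rw [e1, ← Real.sqrt_eq_rpow, ← Real.sqrt_eq_rpow, h2] at h
  rw [h2]
  calc √(x - 1 / 2) * Real.Gamma x
      ≤ √(x - 1 / 2) * (√(Real.Gamma (x - 1 / 2)) * √((x - 1 / 2) * Real.Gamma (x - 1 / 2))) := by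
        gcongr
    _ = (√(x - 1 / 2) * √(x - 1 / 2)) * (√(Real.Gamma (x - 1 / 2)) * √(Real.Gamma (x - 1 / 2))) := by
        rw [Real.sqrt_mul (by linarith)]; ring
    _ = _ := by rw [Real.mul_self_sqrt (by linarith), Real.mul_self_sqrt hp.le]

lemma besselF_add_half_le {ν y : ℝ} (hν : 1 ≤ ν) (hy : 0 ≤ y) :
    besselF (ν + 1 / 2) y ≤ besselF ν y / √(ν + 1 / 2) := by
  unfold besselF
  rw [← tsum_div_const]
  refine Summable.tsum_le_tsum (fun k => ?_) (besselF_summable (by linarith) hy)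
    ((besselF_summable hν hy).div_const _)
  have hk : (0 : ℝ) ≤ k := k.cast_nonneg
  have hG := Real.Gamma_pos_of_pos (show 0 < (k : ℝ) + ν + 1 by positivity)
  have h := Gamma_add_half_ge (show 1 / 2 < (k : ℝ) + ν + 1 by linarith)
  have h2 : √(ν + 1 / 2) ≤ √((k : ℝ) + ν + 1 - 1 / 2) := Real.sqrt_le_sqrt (by linarith)
  have h3 : √(ν + 1 / 2) * Real.Gamma ((k : ℝ) + ν + 1)
      ≤ Real.Gamma ((k : ℝ) + (ν + 1 / 2) + 1) := by
    rw [show (k : ℝ) + (ν + 1 / 2) + 1 = k + ν + 1 + 1 / 2 by ring]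
    exact le_trans (by gcongr) h
  rw [div_div]
  have hs : 0 < √(ν + 1 / 2) := Real.sqrt_pos.2 (by linarith)
  gcongr y ^ k / ?_
  calc (k.factorial : ℝ) * Real.Gamma (k + ν + 1) * √(ν + 1 / 2)
      = k.factorial * (√(ν + 1 / 2) * Real.Gamma (k + ν + 1)) := by ring
    _ ≤ _ := by gcongr

lemma besselF_add_one_le {ν y : ℝ} (hν : 1 ≤ ν) (hy : 0 ≤ y) :
    besselF (ν + 1) y ≤ besselF ν y / (ν + 1) := by
  unfold besselF
  rw [← tsum_div_const]
  refine Summable.tsum_le_tsum (fun k => ?_) (besselF_summable (by linarith) hy)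
    ((besselF_summable hν hy).div_const _)
  have hk : (0 : ℝ) ≤ k := k.cast_nonneg
  have hG := Real.Gamma_pos_of_pos (show 0 < (k : ℝ) + ν + 1 by positivity)
  rw [show (k : ℝ) + (ν + 1) + 1 = (k + ν + 1) + 1 by ring, Real.Gamma_add_one (by positivity),
    div_div]
  gcongr y ^ k / ?_
  calc (k.factorial : ℝ) * Real.Gamma (k + ν + 1) * (ν + 1)
      ≤ k.factorial * Real.Gamma (k + ν + 1) * (k + ν + 1) := by gcongr; linarith
    _ = _ := by ring

/-- `∑ k a_k y^k = y F_{ν+1}(y)`. -/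
lemma besselF_hasSum_mul_index {ν y : ℝ} (hν : 1 ≤ ν) (hy : 0 ≤ y) :
    HasSum (fun k : ℕ => (k : ℝ) * (y ^ k / ((k.factorial : ℝ) * Real.Gamma ((k : ℝ) + ν + 1))))
      (y * besselF (ν + 1) y) := by
  have h := ((besselF_summable (show 1 ≤ ν + 1 by linarith) hy).hasSum).mul_left y
  rw [← hasSum_nat_add_iff' 1]
  simp only [Finset.range_one, Finset.sum_singleton, Nat.cast_zero, zero_mul, sub_zero]
  refine (congrArg (fun f : ℕ → ℝ => HasSum f (y * besselF (ν + 1) y)) ?_).mp h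
  funext k
  rw [Nat.factorial_succ]
  push_cast
  have hk : (k : ℝ) + 1 ≠ 0 := by positivity
  rw [show (k : ℝ) + 1 + ν + 1 = k + (ν + 1) + 1 by ring, pow_succ']
  field_simp

lemma besselF_add_one_ge {ν y ρ : ℝ} (hν : 1 ≤ ν) (hy : 0 ≤ y) (hρ : 0 ≤ ρ)
    (h : y * ρ ^ 2 + (ν + 1) * ρ ≤ 1) : ρ * besselF ν y ≤ besselF (ν + 1) y := by
  have hF := (besselF_summable hν hy).hasSum
  have hF1 := (besselF_summable (show 1 ≤ ν + 1 by linarith) hy).hasSum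
  have hK := besselF_hasSum_mul_index hν hy
  have h1 : HasSum (fun k : ℕ => (2 * ρ - ρ ^ 2 * (ν + 1)) *
      (y ^ k / ((k.factorial : ℝ) * Real.Gamma ((k : ℝ) + ν + 1))) - ρ ^ 2 *
      ((k : ℝ) * (y ^ k / ((k.factorial : ℝ) * Real.Gamma ((k : ℝ) + ν + 1)))))
      ((2 * ρ - ρ ^ 2 * (ν + 1)) * besselF ν y - ρ ^ 2 * (y * besselF (ν + 1) y)) :=
    (hF.mul_left _).sub (hK.mul_left _)
  have h2 := hasSum_le (fun k => ?_) h1 hF1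
  · change _ ≤ besselF (ν + 1) y at h2
    have hp := besselF_pos hν hy
    have h3 : (2 * ρ - ρ ^ 2 * (ν + 1)) * besselF ν y
        ≤ (1 + ρ ^ 2 * y) * besselF (ν + 1) y := by linarith
    have h4 : (1 + ρ ^ 2 * y) * (ρ * besselF ν y) ≤ (2 * ρ - ρ ^ 2 * (ν + 1)) * besselF ν y := by
      rw [← mul_assoc]
      gcongr
      nlinarith
    exact le_of_mul_le_mul_left (h4.trans h3) (by positivity)
  · have hk : (0 : ℝ) < (k : ℝ) + ν + 1 := by positivity
    have hG := Real.Gamma_pos_of_pos hk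
    rw [show (k : ℝ) + (ν + 1) + 1 = (k + ν + 1) + 1 by ring, Real.Gamma_add_one hk.ne']
    have e : y ^ k / (k.factorial * ((k + ν + 1) * Real.Gamma (k + ν + 1)))
        = (1 / (k + ν + 1)) * (y ^ k / (k.factorial * Real.Gamma (k + ν + 1))) := by
      field_simp
    have hq : 2 * ρ - ρ ^ 2 * (k + ν + 1) ≤ 1 / (k + ν + 1) := by
      rw [le_div_iff₀ hk]
      nlinarith [sq_nonneg (ρ * (k + ν + 1) - 1)]
    have := mul_le_mul_of_nonneg_right hq
      (besselF_term_nonneg (show 0 ≤ ν by linarith) hy k)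
    rw [e]
    linarith

lemma pow_succ_tangent_le {x y : ℝ} (hx : 0 ≤ x) (hxy : x ≤ y) (k : ℕ) :
    x ^ k + k * (y - x) * x ^ (k - 1) ≤ y ^ k := by
  induction k with
  | zero => simp
  | succ k ih =>
    rcases k with _ | k
    · simp
    · simp only [Nat.add_sub_cancel] at ih ⊢
      push_cast at ih ⊢
      have hy : 0 ≤ y := hx.trans hxy
      have := mul_le_mul_of_nonneg_right ih hy
      rw [pow_succ y (k + 1)]
      refine le_trans ?_ this
      have hk : 0 ≤ ((k : ℝ) + 1) * (y - x) ^ 2 * x ^ k := by positivity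
      have e : x ^ (k + 1) = x * x ^ k := by ring
      have e2 : x ^ (k + 1 + 1) = x * (x * x ^ k) := by ring
      rw [e2, e]
      nlinarith

lemma besselF_tangent {ν x y : ℝ} (hν : 1 ≤ ν) (hx : 0 ≤ x) (hxy : x ≤ y) :
    besselF ν x + (y - x) * besselF (ν + 1) x ≤ besselF ν y := by
  rcases hx.eq_or_lt with rfl | hx'
  · have hF := (besselF_summable hν (le_refl 0)).hasSum
    have hy := (besselF_summable hν hxy).hasSum
    have h0 : ∀ ν : ℝ, besselF ν 0 = 1 / Real.Gamma (ν + 1) := by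
      intro ν
      unfold besselF
      rw [tsum_eq_single 0]
      · simp
      · intro k hk; simp [hk]
    have := (besselF_summable hν hxy).sum_le_tsum (Finset.range 2)
      (fun k _ => besselF_term_nonneg (by linarith) hxy k)
    rw [h0, h0]
    refine le_trans (le_of_eq ?_) this
    simp [Finset.sum_range_succ]
    rw [show 1 + ν + 1 = ν + 1 + 1 by ring]
    ring
  · have hF := (besselF_summable hν hx).hasSum
    have hy := (besselF_summable hν (hx.trans hxy)).hasSum
    have hK := (besselF_hasSum_mul_index hν hx).mul_left ((y - x) / x)
    have e : (y - x) / x * (x * besselF (ν + 1) x) = (y - x) * besselF (ν + 1) x := by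
      field_simp
    rw [e] at hK
    refine hasSum_le (fun k => ?_) (hF.add hK) hy
    have hG := Real.Gamma_pos_of_pos (show 0 < (k : ℝ) + ν + 1 by positivity)
    have ht := pow_succ_tangent_le hx hxy k
    have e3 : (k : ℝ) * (y - x) * x ^ (k - 1) = (y - x) / x * (k * x ^ k) := by
      rcases k with _ | k
      · simp
      · simp only [Nat.add_sub_cancel]; field_simp; ring
    rw [e3] at ht
    have := div_le_div_of_nonneg_right ht
      (show 0 ≤ (k.factorial : ℝ) * Real.Gamma ((k : ℝ) + ν + 1) by positivity)
    refine le_trans (le_of_eq ?_) this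
    ring

lemma besselF_growth {ν x y ρ : ℝ} (hν : 1 ≤ ν) (hx : 0 ≤ x) (hxy : x ≤ y) (hρ : 0 ≤ ρ)
    (h : y * ρ ^ 2 + (ν + 1) * ρ ≤ 1) :
    Real.exp (ρ * (y - x)) * besselF ν x ≤ besselF ν y := by
  have hstep : ∀ N : ℕ, 0 < N → ∀ j : ℕ, j ≤ N →
      (1 + ρ * (y - x) / N) ^ j * besselF ν x ≤ besselF ν (x + j * ((y - x) / N)) := by
    intro N hN j
    have hN' : (0 : ℝ) < N := by exact_mod_cast hN
    have hd : 0 ≤ (y - x) / N := div_nonneg (by linarith) hN'.le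
    induction j with
    | zero => simp
    | succ j ih =>
      intro hj
      have ih := ih (by omega)
      have hz : 0 ≤ x + j * ((y - x) / N) := by positivity
      have hzy : x + j * ((y - x) / N) ≤ y := by
        have : (j : ℝ) ≤ N := by exact_mod_cast (by omega : j ≤ N)
        calc x + j * ((y - x) / N) ≤ x + N * ((y - x) / N) := by gcongr
          _ = y := by field_simp; ring
      have hz1 := besselF_add_one_ge hν hz hρ (le_trans (by gcongr) h)
      have ht := besselF_tangent hν hz
        (show x + j * ((y - x) / N) ≤ x + (j + 1 : ℕ) * ((y - x) / N) by push_cast; linarith)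
      refine le_trans ?_ ht
      have e : x + ((j + 1 : ℕ) : ℝ) * ((y - x) / N) - (x + j * ((y - x) / N)) = (y - x) / N := by
        push_cast; ring
      rw [e]
      have h5 := mul_le_mul_of_nonneg_left hz1 hd
      have h6 := mul_le_mul_of_nonneg_left ih
        (show 0 ≤ 1 + ρ * (y - x) / N by rw [mul_div_assoc]; positivity)
      calc (1 + ρ * (y - x) / N) ^ (j + 1) * besselF ν x
          = (1 + ρ * (y - x) / N) * ((1 + ρ * (y - x) / N) ^ j * besselF ν x) := by ring
        _ ≤ _ := h6
        _ = besselF ν (x + j * ((y - x) / N))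
            + (y - x) / N * (ρ * besselF ν (x + j * ((y - x) / N))) := by ring
        _ ≤ _ := by linarith
  have hlim := (Real.tendsto_one_add_div_pow_exp (ρ * (y - x))).mul_const (besselF ν x)
  refine le_of_tendsto hlim ?_
  filter_upwards [Filter.eventually_gt_atTop 0] with N hN
  have := hstep N hN N le_rfl
  have hN' : (N : ℝ) ≠ 0 := by exact_mod_cast hN.ne'
  rwa [show x + N * ((y - x) / N) = y by field_simp; ring] at this

lemma norm_exp_two_pi_I_mul (z : ℂ) (x : ℝ) (h : z = x) :
    ‖Complex.exp (2 * (Real.pi : ℂ) * Complex.I * z)‖ = 1 := by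
  rw [h, show 2 * (Real.pi : ℂ) * Complex.I * (x : ℂ) = ((2 * Real.pi * x : ℝ) : ℂ) * Complex.I by
    push_cast; ring]
  exact Complex.norm_exp_ofReal_mul_I _

lemma norm_natCast_mul_I_cpow_neg_half (r : ℕ) (hr : 0 < r) :
    ‖((r : ℂ) * Complex.I) ^ (-(1 / 2 : ℂ))‖ = (√r)⁻¹ := by
  have hr' : (0 : ℝ) < r := by exact_mod_cast hr
  have e : (-(1 / 2 : ℂ)) = ((-(1 / 2) : ℝ) : ℂ) := by push_cast; ring
  rw [e, Complex.norm_cpow_real, norm_mul, Complex.norm_I, mul_one, Complex.norm_natCast,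
    Real.rpow_neg hr'.le, ← Real.sqrt_eq_rpow]

lemma norm_psiMult_le (m γ : ℕ) (hm : 0 < m) (hγ : 0 < γ) (δ ℓt ℓ : ℤ) :
    ‖psiMult m γ δ ℓt ℓ‖ ≤ (√(2 * m * γ))⁻¹ * γ := by
  unfold psiMult
  rw [norm_mul, norm_natCast_mul_I_cpow_neg_half _ (by positivity)]
  push_cast
  gcongr
  refine (norm_sum_le _ _).trans ?_
  refine (Finset.sum_le_card_nsmul _ _ 1 fun T _ => ?_).trans (by simp)
  refine (norm_exp_two_pi_I_mul _
    ((((((δ : ZMod γ)⁻¹).val : ℕ) : ℝ) * ((ℓt : ℝ) - 2 * m * T) ^ 2) / (4 * m * γ)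
          - ((ℓ : ℝ) * ((ℓt : ℝ) - 2 * m * T)) / (2 * m * γ)
          + ((δ : ℝ) * (ℓ : ℝ) ^ 2) / (4 * m * γ)) ?_).le
  push_cast
  rfl

lemma norm_Kl_le (m γ : ℕ) (hm : 0 < m) (hγ : 0 < γ) (A B : ℚ) (ℓ ℓt : ℤ) :
    ‖Kl m A B γ ℓ ℓt‖ ≤ (√(2 * m * γ))⁻¹ * γ ^ 2 := by
  unfold Kl
  refine (norm_sum_le _ _).trans ?_
  have hcard : (((Finset.range γ).filter fun j => Nat.gcd j γ = 1).card : ℝ) ≤ γ := by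
    exact_mod_cast (Finset.card_filter_le _ _).trans (by simp)
  refine (Finset.sum_le_card_nsmul _ _ ((√(2 * m * γ))⁻¹ * γ) fun j _ => ?_).trans ?_
  · rw [norm_mul, norm_exp_two_pi_I_mul _
      (((((-(j : ℤ) : ZMod γ)⁻¹).val : ℕ) : ℝ) * (B : ℝ) / γ + ((-(j : ℤ) : ℤ) : ℝ) * (A : ℝ) / γ)
      (by push_cast; rfl), one_mul]
    exact norm_psiMult_le m γ hm hγ _ _ _
  · rw [nsmul_eq_mul]
    calc _ ≤ (γ : ℝ) * ((√(2 * m * γ))⁻¹ * γ) := by gcongr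
      _ = _ := by ring

lemma natCast_mul_I_cpow_mul_exp (r : ℕ) (hr : 0 < r) :
    Complex.exp ((Real.pi : ℂ) * Complex.I / 4) * ((r : ℂ) * Complex.I) ^ (-(1 / 2 : ℂ))
      = (((√r)⁻¹ : ℝ) : ℂ) := by
  have hr' : (0 : ℝ) < r := by exact_mod_cast hr
  have hne : (r : ℂ) * Complex.I ≠ 0 :=
    mul_ne_zero (by exact_mod_cast hr.ne') Complex.I_ne_zero
  rw [Complex.cpow_def_of_ne_zero hne, ← Complex.exp_add]
  have hl : Complex.log ((r : ℂ) * Complex.I) = (Real.log r : ℂ) + Real.pi / 2 * Complex.I := by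
    have := Complex.log_ofReal_mul hr' Complex.I_ne_zero
    rw [Complex.log_I] at this
    exact_mod_cast this
  rw [hl, show (Real.pi : ℂ) * Complex.I / 4 + ((Real.log r : ℂ) + Real.pi / 2 * Complex.I) *
    (-(1 / 2)) = ((-(Real.log r / 2) : ℝ) : ℂ) by push_cast; ring, ← Complex.ofReal_exp,
    Real.exp_neg, Real.exp_half, Real.exp_log hr']

lemma Kl_one_self (m : ℕ) (hm : 0 < m) (A B : ℚ) (ℓ : ℤ) :
    (-1 : ℂ) ^ ℓ * Complex.exp ((Real.pi : ℂ) * Complex.I / 4) * Kl m A B 1 ℓ m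
      = (((√(2 * m))⁻¹ : ℝ) : ℂ) := by
  have hm' : (m : ℂ) ≠ 0 := by exact_mod_cast hm.ne'
  have h1 : Kl m A B 1 ℓ m = (((2 * m : ℕ) : ℂ) * Complex.I) ^ (-(1 / 2 : ℂ)) * (-1 : ℂ) ^ ℓ := by
    unfold Kl psiMult
    have hf : ((Finset.range 1).filter fun j => Nat.gcd j 1 = 1) = {0} := by decide
    have hv : ∀ z : ZMod 1, z.val = 0 := fun z => by
      rw [Subsingleton.elim z 0, ZMod.val_zero]
    rw [hf]
    simp only [Finset.sum_singleton, Finset.range_one, hv]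
    have e : (-1 : ℂ) ^ ℓ = Complex.exp (2 * (Real.pi : ℂ) * Complex.I *
        (-(ℓ : ℂ) * m / (2 * m))) := by
      rw [← Complex.exp_neg_pi_mul_I, ← Complex.exp_int_mul]
      congr 1
      field_simp
    rw [e]
    simp
    left
    congr 1
    ring
  rw [h1]
  have h2 := natCast_mul_I_cpow_mul_exp (2 * m) (by positivity)
  have h3 : (-1 : ℂ) ^ ℓ * (-1 : ℂ) ^ ℓ = 1 := by
    rw [← mul_zpow]; simp
  push_cast at h2 ⊢
  calc _ = ((-1 : ℂ) ^ ℓ * (-1 : ℂ) ^ ℓ) * (Complex.exp ((Real.pi : ℂ) * Complex.I / 4) *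
      ((2 * m : ℂ) * Complex.I) ^ (-(1 / 2 : ℂ))) := by ring
    _ = _ := by rw [h3, h2]; simp

/-- The coefficients `3^n · C(n+7, 7)` of `(1 - 3q)^{-8}`, which majorize those of `1/Δ`. -/
def majE (n : ℕ) : ℕ := 3 ^ n * (n + 7).choose 7

lemma sum_antidiagonalTuple_prod (f : ℕ → ℚ) (k n : ℕ) :
    ∑ v ∈ Finset.Nat.antidiagonalTuple k n, ∏ i, f (v i)
      = PowerSeries.coeff n ((PowerSeries.mk f) ^ k) := by
  have h := PowerSeries.coeff_prod (fun _ : Fin k => PowerSeries.mk f) n Finset.univ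
  rw [Finset.prod_const, Finset.card_univ, Fintype.card_fin] at h
  rw [h]
  refine (Finset.sum_equiv Finsupp.equivFunOnFinite (fun l => ?_) (fun l _ => ?_)).symm
  · rw [Finset.mem_finsuppAntidiag, Finset.Nat.mem_antidiagonalTuple]
    simp
  · simp

lemma coeff_pow_mono {f g : PowerSeries ℚ} (hf : ∀ n, 0 ≤ PowerSeries.coeff n f)
    (hfg : ∀ n, PowerSeries.coeff n f ≤ PowerSeries.coeff n g) (k n : ℕ) :
    0 ≤ PowerSeries.coeff n (f ^ k) ∧
      PowerSeries.coeff n (f ^ k) ≤ PowerSeries.coeff n (g ^ k) := by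
  induction k generalizing n with
  | zero =>
    simp only [pow_zero, le_refl, and_true, PowerSeries.coeff_one]
    split_ifs <;> norm_num
  | succ k ih =>
    rw [pow_succ, pow_succ, PowerSeries.coeff_mul, PowerSeries.coeff_mul]
    refine ⟨Finset.sum_nonneg fun x _ => mul_nonneg (ih _).1 (hf _),
      Finset.sum_le_sum fun x _ => ?_⟩
    exact mul_le_mul (ih _).2 (hfg _) (hf _) ((ih _).1.trans (ih _).2)

lemma coeff_mk_geom_pow (a : ℚ) (d n : ℕ) :
    PowerSeries.coeff n ((PowerSeries.mk fun j => a ^ j) ^ (d + 1))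
      = a ^ n * ((d + n).choose d : ℕ) := by
  have h : (PowerSeries.mk fun j => a ^ j) = PowerSeries.rescale a (PowerSeries.mk 1) := by
    ext j; simp [PowerSeries.coeff_rescale]
  rw [h, ← map_pow, PowerSeries.mk_one_pow_eq_mk_choose_add, PowerSeries.coeff_rescale]
  simp

lemma card_partition_le (n : ℕ) : Fintype.card (Nat.Partition n) ≤ 2 ^ (n - 1) := by
  rw [← composition_card]
  exact Fintype.card_le_of_surjective _ Nat.Partition.ofComposition_surj

lemma coeff_partition_cube_le (n : ℕ) :
    PowerSeries.coeff n
      ((PowerSeries.mk fun j => ((Fintype.card (Nat.Partition j) : ℕ) : ℚ)) ^ 3) ≤ 3 ^ n := by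
  set R : PowerSeries ℚ := PowerSeries.mk fun j => (2 : ℚ) ^ j with hR
  set G : PowerSeries ℚ := PowerSeries.C (1 / 2 : ℚ) * (1 + R) with hG
  refine (coeff_pow_mono (g := G) (fun j => by simp) (fun j => ?_) 3 n).2.trans ?_
  · rw [PowerSeries.coeff_mk, hG, PowerSeries.coeff_C_mul, map_add, PowerSeries.coeff_one, hR,
      PowerSeries.coeff_mk]
    have := card_partition_le j
    have h2 : ((Fintype.card (Nat.Partition j) : ℕ) : ℚ) ≤ (2 : ℚ) ^ (j - 1) := by exact_mod_cast this
    refine h2.trans ?_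
    rcases j with _ | j
    · norm_num
    · rw [if_neg (by omega), Nat.add_sub_cancel, pow_succ]
      linarith
  · have e : G ^ 3 = PowerSeries.C (1 / 8 : ℚ) * (1 + (R ^ 1 + R ^ 1 + R ^ 1)
        + (R ^ 2 + R ^ 2 + R ^ 2) + R ^ 3) := by
      rw [hG, mul_pow, ← map_pow]
      norm_num
      ring
    have h1 := coeff_mk_geom_pow 2 0 n
    have h2 := coeff_mk_geom_pow 2 1 n
    have h3 := coeff_mk_geom_pow 2 2 n
    rw [← hR] at h1 h2 h3
    rw [e, PowerSeries.coeff_C_mul]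
    simp only [map_add, PowerSeries.coeff_one]
    norm_num at h1 h2 h3
    have hc : (((2 + n).choose 2 : ℕ) : ℚ) = (n + 2) * (n + 1) / 2 := by
      rw [Nat.cast_choose_two]; push_cast; ring
    rw [pow_one, h1, h2, h3, hc]
    rcases n with _ | n
    · norm_num
    · simp only [Nat.add_eq_zero_iff, one_ne_zero, and_false, if_false]
      have key : ∀ k : ℕ, (2 : ℚ) ^ (k + 1) * ((k + 3) * (k + 8)) ≤ 16 * 3 ^ (k + 1) := by
        intro k
        induction k with
        | zero => norm_num
        | succ k ih =>
          rcases k with _ | k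
          · norm_num
          · push_cast at ih ⊢
            have hk : (0 : ℚ) ≤ k := k.cast_nonneg
            have h2 : (0 : ℚ) ≤ 2 ^ (k + 1 + 1) := by positivity
            calc (2 : ℚ) ^ (k + 1 + 1 + 1) * ((k + 1 + 1 + 3) * (k + 1 + 1 + 8))
                = 2 ^ (k + 1 + 1) * (2 * ((k + 5) * (k + 10))) := by ring
              _ ≤ 2 ^ (k + 1 + 1) * (3 * ((k + 1 + 3) * (k + 1 + 8))) := by
                  gcongr 2 ^ (k + 1 + 1) * ?_
                  nlinarith
              _ = 3 * (2 ^ (k + 1 + 1) * ((k + 1 + 3) * (k + 1 + 8))) := by ring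
              _ ≤ 3 * (16 * 3 ^ (k + 1 + 1)) := by gcongr
              _ = _ := by ring
      have := key n
      push_cast
      nlinarith

lemma dcoef_eq_zero {n : ℤ} (h : n < -1) : dcoef n = 0 := by
  unfold dcoef; rw [if_neg (by omega)]

lemma dcoef_nonneg (n : ℤ) : 0 ≤ dcoef n := by
  unfold dcoef
  split_ifs
  · exact Finset.sum_nonneg fun v _ => Finset.prod_nonneg fun i _ => by positivity
  · rfl

lemma dcoef_neg_one : dcoef (-1) = 1 := by
  unfold dcoef
  rw [if_pos (by norm_num)]
  norm_num
  rw [Finset.Nat.antidiagonalTuple_zero_right]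
  simp

lemma dcoef_le (k : ℕ) : dcoef ((k : ℤ) - 1) ≤ majE k := by
  unfold dcoef
  rw [if_pos (by omega), show ((k : ℤ) - 1 + 1).toNat = k by omega]
  have h := sum_antidiagonalTuple_prod
    (fun j => ((Fintype.card (Nat.Partition j) : ℕ) : ℚ)) 24 k
  set P : PowerSeries ℚ := PowerSeries.mk fun j => ((Fintype.card (Nat.Partition j) : ℕ) : ℚ)
    with hP
  have h2 := (coeff_pow_mono (f := P ^ 3) (g := PowerSeries.mk fun j => (3 : ℚ) ^ j)
    (fun j => (coeff_pow_mono (f := P) (g := P) (fun j => by simp [hP]) (fun j => le_rfl) 3 j).1)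
    (fun j => by rw [PowerSeries.coeff_mk]; exact coeff_partition_cube_le j) 8 k).2
  rw [coeff_mk_geom_pow 3 7 k, ← pow_mul] at h2
  rw [← h] at h2
  unfold majE
  rw [add_comm k 7]
  exact_mod_cast h2

lemma dcoef_le_majE {n : ℤ} (h : -1 ≤ n) : dcoef n ≤ majE (n + 1).toNat := by
  have := dcoef_le (n + 1).toNat
  rwa [show (((n + 1).toNat : ℕ) : ℤ) - 1 = n by omega] at this

lemma majE_pos (n : ℕ) : 0 < majE n := by
  unfold majE
  have := Nat.choose_pos (show 7 ≤ n + 7 by omega)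
  positivity

lemma majE_succ (n : ℕ) : (majE (n + 1) : ℝ) * (n + 1) = majE n * (3 * (n + 8)) := by
  unfold majE
  have h := Nat.add_one_mul_choose_eq (n + 7) 7
  have h2 := Nat.choose_succ_right_eq (n + 1 + 7) 7
  have h3 : (n + 1 + 7).choose 7 * (n + 1) = (n + 8) * (n + 7).choose 7 := by
    have : (n + 1 + 7) - 7 = n + 1 := by omega
    rw [this] at h2
    rw [← h2, show n + 8 = n + 7 + 1 by omega, h]
  have h4 : ((n + 1 + 7).choose 7 : ℝ) * (n + 1) = (n + 8) * (n + 7).choose 7 := by exact_mod_cast h3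
  push_cast
  rw [pow_succ]
  linear_combination (3 : ℝ) ^ n * 3 * h4

lemma majE_succ_le (n : ℕ) : (majE (n + 1) : ℝ) ≤ 24 * majE n := by
  have h := majE_succ n
  have hn : (0 : ℝ) ≤ n := n.cast_nonneg
  have hp : (0 : ℝ) < majE n := by exact_mod_cast majE_pos n
  have : (majE (n + 1) : ℝ) * (n + 1) ≤ 24 * majE n * (n + 1) := by
    rw [h]; nlinarith [mul_nonneg hp.le hn]
  exact le_of_mul_le_mul_right this (by positivity)

/-- `e_{n} ≤ 3.24 · 10^n`. -/
lemma majE_le_ten_pow (n : ℕ) : (majE n : ℝ) ≤ 3.24 * 10 ^ n := by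
  rcases lt_or_ge n 2 with h | h
  · interval_cases n <;> norm_num [majE, Nat.choose]
  · induction n, h using Nat.le_induction with
    | base => norm_num [majE, Nat.choose]
    | succ n hn ih =>
      have h := majE_succ n
      have hn' : (2 : ℝ) ≤ n := by exact_mod_cast hn
      have hp : (0 : ℝ) < majE n := by exact_mod_cast majE_pos n
      have : (majE (n + 1) : ℝ) * (n + 1) ≤ (10 * majE n) * (n + 1) := by
        rw [h]; nlinarith
      have := le_of_mul_le_mul_right this (by positivity)
      rw [pow_succ]
      linarith

/-- The summand of the polar coefficient. -/
noncomputable def polarTerm (m nt ℓt p q r s : ℤ) : ℤ :=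
  if p * s - q * r = 1 ∧ 0 < r ∧ 0 < s ∧
        0 ≤ (ℓt : ℚ) / (2 * m) - (q : ℚ) / s ∧
        (ℓt : ℚ) / (2 * m) - (q : ℚ) / s < 1 / ((r : ℚ) * s) then
      (-2 * r * s * nt - 2 * p * q * m + (p * s + q * r) * ℓt) *
        dcoef (r ^ 2 * nt + p ^ 2 * m - p * r * ℓt) *
        dcoef (s ^ 2 * nt + q ^ 2 * m - q * s * ℓt)
    else 0

lemma polarCoef_eq_finsum (m nt ℓt : ℤ) :
    polarCoef m nt ℓt = ∑ᶠ (p : ℤ) (q : ℤ) (r : ℤ) (s : ℤ), polarTerm m nt ℓt p q r s := rfl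

/-- The arithmetic content of a summand satisfying the summation conditions. -/
lemma polar_cond_int {m ℓt p q r s : ℤ} (hm : 0 < m)
    (h : p * s - q * r = 1 ∧ 0 < r ∧ 0 < s ∧
        0 ≤ (ℓt : ℚ) / (2 * m) - (q : ℚ) / s ∧
        (ℓt : ℚ) / (2 * m) - (q : ℚ) / s < 1 / ((r : ℚ) * s)) :
    p * s - q * r = 1 ∧ 0 < r ∧ 0 < s ∧ 0 ≤ s * ℓt - 2 * m * q ∧ 0 < 2 * m * p - r * ℓt := by
  obtain ⟨h1, hr, hs, h2, h3⟩ := h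
  have hm' : (0 : ℚ) < m := by exact_mod_cast hm
  have hr' : (0 : ℚ) < r := by exact_mod_cast hr
  have hs' : (0 : ℚ) < s := by exact_mod_cast hs
  have e : (ℓt : ℚ) / (2 * m) - (q : ℚ) / s = (s * ℓt - 2 * m * q) / (2 * m * s) := by
    field_simp
  rw [e] at h2 h3
  have h4 : (0 : ℚ) ≤ s * ℓt - 2 * m * q := by
    by_contra hc
    push Not at hc
    have := div_neg_of_neg_of_pos hc (show (0 : ℚ) < 2 * m * s by positivity)
    linarith
  rw [div_lt_div_iff₀ (by positivity) (by positivity)] at h3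
  have h5 : (s : ℚ) * ((s * ℓt - 2 * m * q) * r) < s * (2 * m) := by nlinarith
  have h6 := lt_of_mul_lt_mul_left h5 hs'.le
  have h4' : 0 ≤ s * ℓt - 2 * m * q := by exact_mod_cast h4
  have h6' : (s * ℓt - 2 * m * q) * r < 2 * m := by exact_mod_cast h6
  refine ⟨h1, hr, hs, h4', ?_⟩
  have h7 : s * (2 * m * p - r * ℓt) = 2 * m - (s * ℓt - 2 * m * q) * r := by
    linear_combination 2 * m * h1
  by_contra hc
  push Not at hc
  nlinarith

lemma polarTerm_facts {m nt ℓt p q r s : ℤ} (hm : 0 < m) (hD : 4 * m * nt - ℓt ^ 2 < 0)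
    (h : polarTerm m nt ℓt p q r s ≠ 0) :
    p * s - q * r = 1 ∧ 0 < r ∧ 0 < s ∧ 0 ≤ s * ℓt - 2 * m * q ∧ 0 < 2 * m * p - r * ℓt ∧
      -1 ≤ r ^ 2 * nt + p ^ 2 * m - p * r * ℓt ∧ -1 ≤ s ^ 2 * nt + q ^ 2 * m - q * s * ℓt ∧
      1 ≤ -2 * r * s * nt - 2 * p * q * m + (p * s + q * r) * ℓt := by
  unfold polarTerm at h
  split_ifs at h with hc
  · obtain ⟨h1, hr, hs, hv, hu⟩ := polar_cond_int hm hc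
    set a := r ^ 2 * nt + p ^ 2 * m - p * r * ℓt with ha
    set b := s ^ 2 * nt + q ^ 2 * m - q * s * ℓt with hb
    set L := -2 * r * s * nt - 2 * p * q * m + (p * s + q * r) * ℓt with hL
    have ha1 : -1 ≤ a := by
      by_contra hc; exact h (by rw [dcoef_eq_zero (by omega : a < -1)]; ring)
    have hb1 : -1 ≤ b := by
      by_contra hc; exact h (by rw [dcoef_eq_zero (by omega : b < -1)]; ring)
    refine ⟨h1, hr, hs, hv, hu, ha1, hb1, ?_⟩
    by_contra hL0
    have hL0 : L ≤ 0 := by omega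
    have eu : 2 * s * a + r * L = 2 * m * p - r * ℓt := by
      rw [ha, hL]; linear_combination (2 * m * p - r * ℓt) * h1
    have ev : 2 * r * b + s * L = s * ℓt - 2 * m * q := by
      rw [hb, hL]; linear_combination (s * ℓt - 2 * m * q) * h1
    have eD : L ^ 2 - 4 * a * b = ℓt ^ 2 - 4 * m * nt := by
      rw [ha, hb, hL]
      have : (p * s - q * r) ^ 2 = 1 := by rw [h1]; ring
      linear_combination (ℓt ^ 2 - 4 * m * nt) * this
    have h8 : r * (-L) ≤ 2 * s * a := by linarith
    have h9 : s * (-L) ≤ 2 * r * b := by linarith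
    have h10 : (r * (-L)) * (s * (-L)) ≤ (2 * s * a) * (2 * r * b) :=
      mul_le_mul h8 h9 (mul_nonneg hs.le (by linarith))
        (le_trans (mul_nonneg hr.le (by linarith)) h8)
    have h11 : (r * s) * (L ^ 2) ≤ (r * s) * (4 * a * b) := by linarith
    have := le_of_mul_le_mul_left h11 (mul_pos hr hs)
    linarith
  · exact absurd rfl h

lemma polarTerm_eq {m nt ℓt p q r s : ℤ} (h : polarTerm m nt ℓt p q r s ≠ 0) :
    polarTerm m nt ℓt p q r s =
      (-2 * r * s * nt - 2 * p * q * m + (p * s + q * r) * ℓt) *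
        dcoef (r ^ 2 * nt + p ^ 2 * m - p * r * ℓt) *
        dcoef (s ^ 2 * nt + q ^ 2 * m - q * s * ℓt) := by
  unfold polarTerm at h ⊢
  split_ifs at h ⊢ with hc
  · rfl
  · exact absurd rfl h

lemma polarTerm_nonneg {m nt ℓt : ℤ} (hm : 0 < m) (hD : 4 * m * nt - ℓt ^ 2 < 0) (p q r s : ℤ) :
    0 ≤ polarTerm m nt ℓt p q r s := by
  by_cases h : polarTerm m nt ℓt p q r s = 0
  · rw [h]
  · rw [polarTerm_eq h]
    have := (polarTerm_facts hm hD h).2.2.2.2.2.2.2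
    exact mul_nonneg (mul_nonneg (by linarith) (dcoef_nonneg _)) (dcoef_nonneg _)

lemma polarTerm_box {m nt ℓt p q r s : ℤ} (hm : 3 ≤ m) (h0 : 0 ≤ ℓt) (h0m : ℓt ≤ m)
    (hD : 4 * m * nt - ℓt ^ 2 < 0) (h : polarTerm m nt ℓt p q r s ≠ 0) :
    (1 ≤ r ∧ r ≤ 2 * m) ∧ (1 ≤ s ∧ s ≤ 2 * m) ∧ (0 ≤ p ∧ p ≤ 2 * m) ∧ (0 ≤ q ∧ q ≤ 2 * m) := by
  obtain ⟨h1, hr, hs, hv, hu, ha, hb, hL⟩ := polarTerm_facts (by linarith) hD h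
  have hsum : r * (s * ℓt - 2 * m * q) + s * (2 * m * p - r * ℓt) = 2 * m := by
    linear_combination 2 * m * h1
  have hs2 : s ≤ 2 * m := by nlinarith
  have hr2 : r ≤ 2 * m := by
    rcases hv.eq_or_lt with hv0 | hv1
    · set a := r ^ 2 * nt + p ^ 2 * m - p * r * ℓt with ha'
      set b := s ^ 2 * nt + q ^ 2 * m - q * s * ℓt with hb'
      set L := -2 * r * s * nt - 2 * p * q * m + (p * s + q * r) * ℓt with hL'
      have ev : 2 * r * b + s * L = 0 := by
        rw [hv0, hb', hL']; linear_combination (s * ℓt - 2 * m * q) * h1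
      have em : s ^ 2 * a + r ^ 2 * b + r * s * L = m := by
        rw [ha', hb', hL']
        have : (p * s - q * r) ^ 2 = 1 := by rw [h1]; ring
        linear_combination m * this
      have hb2 : b = -1 := by
        have : b < 0 := by
          by_contra hc
          push Not at hc
          have : 0 < s * L := mul_pos hs (by linarith)
          have : 0 ≤ 2 * r * b := by positivity
          linarith
        omega
      rw [hb2] at ev em
      have hs3 : s * (2 * p - q * L) = 2 := by linear_combination 2 * h1 - q * ev
      have hs4 : s ≤ 2 := by
        have : 0 < 2 * p - q * L := by
          by_contra hc
          push Not at hc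
          nlinarith
        nlinarith
      have em2 : s ^ 2 * a + r ^ 2 = m := by linear_combination em - r * ev
      have : -4 ≤ s ^ 2 * a := by nlinarith
      nlinarith
    · nlinarith [mul_pos hs hu]
  have hq0 : 0 ≤ q := by
    by_contra hc
    have hq : q ≤ -1 := by omega
    have : 2 * m ≤ s * ℓt - 2 * m * q := by nlinarith
    nlinarith [mul_pos hs hu]
  have hq2 : q ≤ 2 * m := by
    have : 2 * m * q ≤ 2 * m * m := by nlinarith
    have := le_of_mul_le_mul_left this (by linarith)
    linarith
  have hp0 : 0 ≤ p := by
    by_contra hc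
    have hq : p ≤ -1 := by omega
    nlinarith [mul_nonneg hr.le h0]
  have hp2 : p ≤ 2 * m := by
    have hu2 : 2 * m * p - r * ℓt ≤ 2 * m := by nlinarith [mul_nonneg hr.le hv]
    have : 2 * m * p ≤ 2 * m * (1 + m) := by nlinarith
    have := le_of_mul_le_mul_left this (by linarith)
    linarith
  exact ⟨⟨hr, hr2⟩, ⟨hs, hs2⟩, ⟨hp0, hp2⟩, ⟨hq0, hq2⟩⟩

lemma polarTerm_unique {m nt ℓt p q p' q' r s : ℤ} (hm : 0 < m) (hD : 4 * m * nt - ℓt ^ 2 < 0)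
    (h : polarTerm m nt ℓt p q r s ≠ 0) (h' : polarTerm m nt ℓt p' q' r s ≠ 0) :
    p = p' ∧ q = q' := by
  obtain ⟨h1, hr, hs, hv, hu, -, -, -⟩ := polarTerm_facts hm hD h
  obtain ⟨h1', -, -, hv', hu', -, -, -⟩ := polarTerm_facts hm hD h'
  have hsum : r * (s * ℓt - 2 * m * q) + s * (2 * m * p - r * ℓt) = 2 * m := by
    linear_combination 2 * m * h1
  have hsum' : r * (s * ℓt - 2 * m * q') + s * (2 * m * p' - r * ℓt) = 2 * m := by
    linear_combination 2 * m * h1'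
  have hb : s * ℓt - 2 * m * q < 2 * m := by nlinarith [mul_pos hs hu]
  have hb' : s * ℓt - 2 * m * q' < 2 * m := by nlinarith [mul_pos hs hu']
  have hq : q = q' := by
    have h3 : 2 * m * (q - q') < 2 * m * 1 := by linarith
    have h4 : 2 * m * (q' - q) < 2 * m * 1 := by linarith
    have h3 := lt_of_mul_lt_mul_left h3 (by linarith)
    have h4 := lt_of_mul_lt_mul_left h4 (by linarith)
    omega
  refine ⟨?_, hq⟩
  subst hq
  have : s * p = s * p' := by linarith
  exact mul_left_cancel₀ hs.ne' this

lemma polarCoef_eq_sum {m nt ℓt : ℤ} (hm : 3 ≤ m) (h0 : 0 ≤ ℓt) (h0m : ℓt ≤ m)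
    (hD : 4 * m * nt - ℓt ^ 2 < 0) :
    polarCoef m nt ℓt = ∑ r ∈ Finset.Icc 1 (2 * m), ∑ s ∈ Finset.Icc 1 (2 * m),
      ∑ x ∈ Finset.Icc 0 (2 * m) ×ˢ Finset.Icc 0 (2 * m),
        polarTerm m nt ℓt x.1 x.2 r s := by
  rw [polarCoef_eq_finsum]
  have key := fun p q r s => polarTerm_box (p := p) (q := q) (r := r) (s := s) hm h0 h0m hD
  have e1 : ∀ p q r, ∑ᶠ s, polarTerm m nt ℓt p q r s
      = ∑ s ∈ Finset.Icc 1 (2 * m), polarTerm m nt ℓt p q r s := fun p q r =>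
    finsum_eq_sum_of_support_subset _ fun s hs => by
      simpa using (key p q r s hs).2.1
  simp_rw [e1]
  have e2 : ∀ p q, ∑ᶠ r, ∑ s ∈ Finset.Icc 1 (2 * m), polarTerm m nt ℓt p q r s
      = ∑ r ∈ Finset.Icc 1 (2 * m), ∑ s ∈ Finset.Icc 1 (2 * m), polarTerm m nt ℓt p q r s :=
    fun p q => finsum_eq_sum_of_support_subset _ fun r hr => by
      obtain ⟨s, -, hs⟩ := Finset.exists_ne_zero_of_sum_ne_zero hr
      simpa using (key p q r s hs).1
  simp_rw [e2]
  have e3 : ∀ p, ∑ᶠ q, ∑ r ∈ Finset.Icc 1 (2 * m), ∑ s ∈ Finset.Icc 1 (2 * m),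
        polarTerm m nt ℓt p q r s
      = ∑ q ∈ Finset.Icc 0 (2 * m), ∑ r ∈ Finset.Icc 1 (2 * m), ∑ s ∈ Finset.Icc 1 (2 * m),
        polarTerm m nt ℓt p q r s :=
    fun p => finsum_eq_sum_of_support_subset _ fun q hq => by
      obtain ⟨r, -, hr⟩ := Finset.exists_ne_zero_of_sum_ne_zero hq
      obtain ⟨s, -, hs⟩ := Finset.exists_ne_zero_of_sum_ne_zero hr
      simpa using (key p q r s hs).2.2.2
  simp_rw [e3]
  have e4 : ∑ᶠ p, ∑ q ∈ Finset.Icc 0 (2 * m), ∑ r ∈ Finset.Icc 1 (2 * m),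
        ∑ s ∈ Finset.Icc 1 (2 * m), polarTerm m nt ℓt p q r s
      = ∑ p ∈ Finset.Icc 0 (2 * m), ∑ q ∈ Finset.Icc 0 (2 * m), ∑ r ∈ Finset.Icc 1 (2 * m),
        ∑ s ∈ Finset.Icc 1 (2 * m), polarTerm m nt ℓt p q r s :=
    finsum_eq_sum_of_support_subset _ fun p hp => by
      obtain ⟨q, -, hq⟩ := Finset.exists_ne_zero_of_sum_ne_zero hp
      obtain ⟨r, -, hr⟩ := Finset.exists_ne_zero_of_sum_ne_zero hq
      obtain ⟨s, -, hs⟩ := Finset.exists_ne_zero_of_sum_ne_zero hr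
      simpa using (key p q r s hs).2.2.1
  rw [e4, ← Finset.sum_product', Finset.sum_comm]
  refine Finset.sum_congr rfl fun r _ => ?_
  rw [Finset.sum_comm]

lemma polarCoef_nonneg {m nt ℓt : ℤ} (hm : 3 ≤ m) (h0 : 0 ≤ ℓt) (h0m : ℓt ≤ m)
    (hD : 4 * m * nt - ℓt ^ 2 < 0) : 0 ≤ polarCoef m nt ℓt := by
  rw [polarCoef_eq_sum hm h0 h0m hD]
  exact Finset.sum_nonneg fun r _ => Finset.sum_nonneg fun s _ => Finset.sum_nonneg fun x _ =>
    polarTerm_nonneg (by linarith) hD _ _ _ _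

lemma polarCoef_main_ge {m : ℤ} (hm : 3 ≤ m) : m + 2 ≤ polarCoef m (-1) m := by
  have hD : 4 * m * (-1) - m ^ 2 < 0 := by nlinarith
  rw [polarCoef_eq_sum hm (by linarith) le_rfl hD]
  have hn := fun p q r s => polarTerm_nonneg (m := m) (nt := -1) (ℓt := m) (by linarith) hD p q r s
  have h1 : polarTerm m (-1) m 1 0 1 1 = m + 2 := by
    unfold polarTerm
    have hm' : (0 : ℚ) < m := by exact_mod_cast (by linarith : 0 < m)
    rw [if_pos]
    · rw [show (1 : ℤ) ^ 2 * (-1) + 1 ^ 2 * m - 1 * 1 * m = -1 by ring,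
        show (1 : ℤ) ^ 2 * (-1) + 0 ^ 2 * m - 0 * 1 * m = -1 by ring, dcoef_neg_one]
      ring
    · refine ⟨by norm_num, by norm_num, by norm_num, ?_, ?_⟩
      · simp; positivity
      · simp; rw [div_lt_one (by positivity)]; linarith
  rw [← h1]
  have m1 : (1 : ℤ) ∈ Finset.Icc 1 (2 * m) := by simp; linarith
  have mx : ((1, 0) : ℤ × ℤ) ∈ Finset.Icc 0 (2 * m) ×ˢ Finset.Icc 0 (2 * m) := by
    simp; constructor <;> linarith
  refine le_trans ?_ (Finset.single_le_sum (f := fun r => ∑ s ∈ Finset.Icc 1 (2 * m),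
      ∑ x ∈ Finset.Icc 0 (2 * m) ×ˢ Finset.Icc 0 (2 * m),
        polarTerm m (-1) m x.1 x.2 r s) (fun r _ => Finset.sum_nonneg fun s _ =>
        Finset.sum_nonneg fun x _ => hn _ _ _ _) m1)
  refine le_trans ?_ (Finset.single_le_sum (f := fun s =>
      ∑ x ∈ Finset.Icc 0 (2 * m) ×ˢ Finset.Icc 0 (2 * m),
        polarTerm m (-1) m x.1 x.2 1 s) (fun s _ =>
        Finset.sum_nonneg fun x _ => hn _ _ _ _) m1)
  exact Finset.single_le_sum (f := fun x : ℤ × ℤ =>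
        polarTerm m (-1) m x.1 x.2 1 1) (fun x _ => hn _ _ _ _) mx

/-- The decay rate used to compare Bessel functions at smaller discriminants. -/
noncomputable def muC (m : ℕ) : ℝ := 5.44 / (2 * m + 9)

/-- The weight `(D/D₀)^{23/2} exp(-μ(D₀ - D))`, with `D₀ = m² + 4m`. -/
noncomputable def wX (m : ℕ) (D : ℝ) : ℝ :=
  (D / (m ^ 2 + 4 * m)) ^ ((23 : ℝ) / 2) * Real.exp (-muC m * (m ^ 2 + 4 * m - D))

/-- Bound for the weighted summands of the polar coefficients with `(r, s) ≠ (1, 1)`. -/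
noncomputable def epsE (m : ℕ) : ℝ :=
  (m + 2) / 2 * 32.4 ^ 2 * (1 / 2) ^ 23 * 10 ^ m * Real.exp (-muC m * (m ^ 2 + 4 * m))
  + (m + 5) / 2 * wX m ((m + 1) * (m + 9) / 4)
  + (if m ≤ 3 then 0 else (m + 4) / 2 * 32.4 * (10 ^ m / 10 ^ 4) *
      ((m + 4) / (4 * m)) ^ ((23 : ℝ) / 2) * Real.exp (-muC m * m ^ 2))
  + (m + 1) / 2 * 32.4 * (9 / 5) ^ m * wX m ((m + 1) ^ 2 / 4)

lemma muC_pos (m : ℕ) : 0 < muC m := by unfold muC; positivity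

lemma muC_mul_le (m : ℕ) : muC m * m ≤ 2.72 := by
  unfold muC
  have : (0 : ℝ) ≤ m := m.cast_nonneg
  rw [div_mul_eq_mul_div, div_le_iff₀ (by positivity)]
  linarith

lemma wX_nonneg (m : ℕ) {D : ℝ} (hD : 0 ≤ D) : 0 ≤ wX m D := by unfold wX; positivity

lemma wX_mono (m : ℕ) {D D' : ℝ} (hD : 0 ≤ D) (h : D ≤ D') : wX m D ≤ wX m D' := by
  unfold wX
  have := muC_pos m
  have h1 : (D / ((m : ℝ) ^ 2 + 4 * m)) ^ ((23 : ℝ) / 2)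
      ≤ (D' / ((m : ℝ) ^ 2 + 4 * m)) ^ ((23 : ℝ) / 2) := by gcongr
  have h2 : Real.exp (-muC m * (m ^ 2 + 4 * m - D)) ≤ Real.exp (-muC m * (m ^ 2 + 4 * m - D')) :=
    Real.exp_le_exp.2 (by nlinarith)
  gcongr
  exact Real.rpow_nonneg (div_nonneg (hD.trans h) (by positivity)) _

lemma exp_le_ten {x : ℝ} (h : x ≤ 1) : Real.exp x ≤ 10 := by
  have h1 : Real.exp x ≤ Real.exp 1 := Real.exp_le_exp.2 h
  have := Real.exp_one_lt_d9
  linarith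

lemma epsE_nonneg (m : ℕ) : 0 ≤ epsE m := by
  unfold epsE
  have h1 := wX_nonneg m (D := ((m : ℝ) + 1) * (m + 9) / 4) (by positivity)
  have h2 := wX_nonneg m (D := ((m : ℝ) + 1) ^ 2 / 4) (by positivity)
  split_ifs <;> positivity

lemma le_epsE_of_le_sum {m : ℕ} {x : ℝ}
    (h : x ≤ (m + 2) / 2 * 32.4 ^ 2 * (1 / 2) ^ 23 * 10 ^ m * Real.exp (-muC m * (m ^ 2 + 4 * m)) ∨
      x ≤ (m + 5) / 2 * wX m ((m + 1) * (m + 9) / 4) ∨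
      (3 < m ∧ x ≤ (m + 4) / 2 * 32.4 * (10 ^ m / 10 ^ 4) *
        ((m + 4) / (4 * m)) ^ ((23 : ℝ) / 2) * Real.exp (-muC m * m ^ 2)) ∨
      x ≤ (m + 1) / 2 * 32.4 * (9 / 5) ^ m * wX m ((m + 1) ^ 2 / 4)) : x ≤ epsE m := by
  have h1 := wX_nonneg m (D := ((m : ℝ) + 1) * (m + 9) / 4) (by positivity)
  have h2 := wX_nonneg m (D := ((m : ℝ) + 1) ^ 2 / 4) (by positivity)
  have a1 : 0 ≤ ((m : ℝ) + 2) / 2 * 32.4 ^ 2 * (1 / 2) ^ 23 * 10 ^ m *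
    Real.exp (-muC m * (m ^ 2 + 4 * m)) := by positivity
  have a2 : 0 ≤ ((m : ℝ) + 5) / 2 * wX m ((m + 1) * (m + 9) / 4) := by positivity
  have a3 : 0 ≤ ((m : ℝ) + 4) / 2 * 32.4 * (10 ^ m / 10 ^ 4) *
        ((m + 4) / (4 * m)) ^ ((23 : ℝ) / 2) * Real.exp (-muC m * m ^ 2) := by positivity
  have a4 : 0 ≤ ((m : ℝ) + 1) / 2 * 32.4 * (9 / 5) ^ m * wX m ((m + 1) ^ 2 / 4) := by positivity
  unfold epsE
  rcases h with h | h | ⟨h3, h⟩ | h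
  · split_ifs <;> linarith
  · split_ifs <;> linarith
  · rw [if_neg (by omega)]; linarith
  · split_ifs <;> linarith

lemma majE_succ_le_ten_pow (n : ℕ) : (majE (n + 1) : ℝ) ≤ 32.4 * 10 ^ n := by
  have := majE_le_ten_pow (n + 1)
  rw [pow_succ] at this
  linarith

lemma weight_bound_nonneg_nonneg {m a b : ℕ} {r s L : ℤ} (hm : 3 ≤ m) (hr : 1 ≤ r) (hs : 1 ≤ s)
    (hrs : ¬(r = 1 ∧ s = 1)) (hL : 1 ≤ L)
    (em : s ^ 2 * a + r ^ 2 * b + r * s * L = m) (hD : 0 < L ^ 2 - 4 * a * b) :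
    (L : ℝ) * majE (a + 1) * majE (b + 1) * wX m ((L ^ 2 - 4 * a * b : ℤ) : ℝ) ≤ epsE m := by
  have hrs2 : 2 ≤ r * s := by
    by_contra hc
    have h1 : r * s ≤ 1 := by omega
    have : r ≤ 1 := by nlinarith
    have : s ≤ 1 := by nlinarith
    exact hrs ⟨by omega, by omega⟩
  have hs2 : (a : ℤ) ≤ s ^ 2 * a := le_mul_of_one_le_left (by positivity) (one_le_pow₀ hs)
  have hr2 : (b : ℤ) ≤ r ^ 2 * b := le_mul_of_one_le_left (by positivity) (one_le_pow₀ hr)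
  have hLm : 2 * L + a + b ≤ m := by nlinarith
  obtain ⟨k, hk⟩ : ∃ k : ℕ, m = a + b + k := ⟨m - (a + b), by omega⟩
  have hLk : 2 * L ≤ k := by omega
  have hmR : (3 : ℝ) ≤ m := by exact_mod_cast hm
  have hkm : (k : ℝ) ≤ m := by exact_mod_cast (by omega : k ≤ m)
  have hLkR : 2 * (L : ℝ) ≤ k := by exact_mod_cast hLk
  have hLR : (1 : ℝ) ≤ L := by exact_mod_cast hL
  have hDle : ((L ^ 2 - 4 * a * b : ℤ) : ℝ) ≤ m * k / 4 := by
    push_cast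
    have : (0 : ℝ) ≤ 4 * a * b := by positivity
    nlinarith
  have hD0 : (0 : ℝ) ≤ ((L ^ 2 - 4 * a * b : ℤ) : ℝ) := by exact_mod_cast hD.le
  refine le_epsE_of_le_sum (Or.inl ?_)
  have hX : wX m ((L ^ 2 - 4 * a * b : ℤ) : ℝ)
      ≤ (1 / 2) ^ 23 * (Real.exp (-muC m * (m ^ 2 + 4 * m)) * 10 ^ k) := by
    refine (wX_mono m hD0 hDle).trans ?_
    unfold wX
    have h1 : ((m : ℝ) * k / 4 / (m ^ 2 + 4 * m)) ^ ((23 : ℝ) / 2) ≤ (1 / 2) ^ 23 := by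
      have h2 : (m : ℝ) * k / 4 / (m ^ 2 + 4 * m) ≤ (1 / 2) ^ (2 : ℝ) := by
        rw [div_le_iff₀ (by positivity)]
        norm_num
        nlinarith
      calc ((m : ℝ) * k / 4 / (m ^ 2 + 4 * m)) ^ ((23 : ℝ) / 2)
          ≤ ((1 / 2 : ℝ) ^ (2 : ℝ)) ^ ((23 : ℝ) / 2) :=
            Real.rpow_le_rpow (by positivity) h2 (by norm_num)
        _ = (1 / 2) ^ 23 := by
            rw [← Real.rpow_mul (by norm_num), ← Real.rpow_natCast]; norm_num
    have h3 : Real.exp (-muC m * (m ^ 2 + 4 * m - m * k / 4))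
        ≤ Real.exp (-muC m * (m ^ 2 + 4 * m)) * 10 ^ k := by
      rw [show -muC m * ((m : ℝ) ^ 2 + 4 * m - m * k / 4)
        = -muC m * (m ^ 2 + 4 * m) + k * (muC m * m / 4) by ring, Real.exp_add, Real.exp_nat_mul]
      gcongr
      exact exp_le_ten (by linarith [muC_mul_le m])
    gcongr
  have ha := majE_succ_le_ten_pow a
  have hb := majE_succ_le_ten_pow b
  have hL2 : (L : ℝ) ≤ (m + 2) / 2 := by linarith
  calc (L : ℝ) * majE (a + 1) * majE (b + 1) * wX m ((L ^ 2 - 4 * a * b : ℤ) : ℝ)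
      ≤ (m + 2) / 2 * (32.4 * 10 ^ a) * (32.4 * 10 ^ b) *
        ((1 / 2) ^ 23 * (Real.exp (-muC m * (m ^ 2 + 4 * m)) * 10 ^ k)) := by
        gcongr
        exact wX_nonneg m hD0
    _ = _ := by
      rw [show (10 : ℝ) ^ m = 10 ^ a * 10 ^ b * 10 ^ k by rw [hk]; ring]; ring

lemma weight_bound_neg_neg {m : ℕ} {r s L : ℤ} (hm : 3 ≤ m) (hr : 1 ≤ r) (hs : 1 ≤ s)
    (hrs : ¬(r = 1 ∧ s = 1)) (hL : 1 ≤ L) (em : -s ^ 2 - r ^ 2 + r * s * L = m)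
    (hu : 0 ≤ r * L - 2 * s) (hv : 0 ≤ s * L - 2 * r) (hD : 0 < L ^ 2 - 4) :
    (L : ℝ) * wX m ((L ^ 2 - 4 : ℤ) : ℝ) ≤ epsE m := by
  have hmZ : (3 : ℤ) ≤ m := by exact_mod_cast hm
  have hr2 : r ^ 2 ≤ m + s ^ 2 := by nlinarith
  have hs2 : s ^ 2 ≤ m + r ^ 2 := by nlinarith
  have hLm : 2 * L ≤ m + 5 := by
    have key : ∀ r s : ℤ, 1 ≤ r → 1 ≤ s → ¬(r = 1 ∧ s = 1) → s ≤ r → r ^ 2 ≤ m + s ^ 2 →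
        -s ^ 2 - r ^ 2 + r * s * L = m → 2 * L ≤ m + 5 := by
      intro r s hr hs hrs hsr hr2 em
      have hpos : 0 < r * s := by positivity
      refine le_of_mul_le_mul_left (a := r * s) ?_ hpos
      rcases hs.eq_or_lt with h1 | h1
      · have hr3 : 2 ≤ r := by
          by_contra hc; exact hrs ⟨by omega, h1.symm⟩
        subst h1
        have : 2 * r ≤ m + 1 := by nlinarith
        nlinarith
      · have hr3 : 2 ≤ r := by omega
        have h4 : 4 ≤ r * s := by nlinarith
        have h5 : s ^ 2 ≤ r * s := by nlinarith
        nlinarith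
    rcases le_total s r with h | h
    · exact key r s hr hs hrs h hr2 em
    · exact key s r hs hr (fun h => hrs ⟨h.2, h.1⟩) h hs2 (by linarith)
  have hLR : 2 * (L : ℝ) ≤ m + 5 := by exact_mod_cast hLm
  have hL1 : (1 : ℝ) ≤ L := by exact_mod_cast hL
  have hD0 : (0 : ℝ) ≤ ((L ^ 2 - 4 : ℤ) : ℝ) := by exact_mod_cast hD.le
  have hX := wX_mono m hD0 (D' := ((m : ℝ) + 1) * (m + 9) / 4) (by push_cast; nlinarith)
  refine le_epsE_of_le_sum (Or.inr (Or.inl ?_))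
  gcongr
  · exact wX_nonneg m hD0
  · linarith

lemma weight_bound_nonneg_neg {m a : ℕ} {r s L : ℤ} (hm : 3 ≤ m) (hr : 1 ≤ r) (hs : 1 ≤ s)
    (hrs : ¬(r = 1 ∧ s = 1)) (hL : 1 ≤ L) (em : s ^ 2 * a - r ^ 2 + r * s * L = m)
    (hv : 0 ≤ s * L - 2 * r) :
    (L : ℝ) * majE (a + 1) * wX m ((L ^ 2 + 4 * a : ℤ) : ℝ) ≤ epsE m := by
  have hmZ : (3 : ℤ) ≤ m := by exact_mod_cast hm
  have hm2 : r ^ 2 + s ^ 2 * a ≤ m := by nlinarith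
  have hL1 : (1 : ℝ) ≤ L := by exact_mod_cast hL
  have hmR : (3 : ℝ) ≤ m := by exact_mod_cast hm
  have ha0 : (0 : ℝ) ≤ a := a.cast_nonneg
  have hD0 : (0 : ℝ) ≤ ((L ^ 2 + 4 * a : ℤ) : ℝ) := by positivity
  have haE := majE_succ_le_ten_pow a
  rcases hs.eq_or_lt with h1 | h1
  · have hr3 : 2 ≤ r := by
      by_contra hc; exact hrs ⟨by omega, h1.symm⟩
    subst h1
    have ham : (a : ℤ) + 4 ≤ m := by nlinarith
    have hLm : 2 * L ≤ m - a + 4 := by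
      refine le_of_mul_le_mul_left (a := r) ?_ (by linarith)
      have : 2 * r ≤ m - a := by nlinarith
      nlinarith
    obtain ⟨k, hk⟩ : ∃ k : ℕ, m = a + k + 4 := ⟨m - a - 4, by omega⟩
    have hLR : 2 * (L : ℝ) ≤ m - a + 4 := by exact_mod_cast hLm
    have hamR : (a : ℝ) + 4 ≤ m := by exact_mod_cast ham
    have hkR : (m : ℝ) = a + k + 4 := by exact_mod_cast hk
    have hDle : ((L ^ 2 + 4 * a : ℤ) : ℝ) ≤ ((m + 4) ^ 2 - a * (m - 4)) / 4 := by
      push_cast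
      have h5 : (2 * (L : ℝ)) ^ 2 ≤ (m - a + 4) ^ 2 := by gcongr
      nlinarith [mul_nonneg ha0 (by linarith : (0 : ℝ) ≤ m - 4 - a)]
    refine le_epsE_of_le_sum (Or.inr (Or.inr (Or.inl ⟨by omega, ?_⟩)))
    have hX : wX m ((L ^ 2 + 4 * a : ℤ) : ℝ) ≤ ((m + 4) / (4 * m)) ^ ((23 : ℝ) / 2) *
        (Real.exp (-muC m * m ^ 2) * 10 ^ k) := by
      refine (wX_mono m hD0 hDle).trans ?_
      unfold wX
      have hnn : (0 : ℝ) ≤ a * (m - 4) := mul_nonneg ha0 (by linarith)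
      gcongr ?_ ^ ((23 : ℝ) / 2) * ?_
      · exact div_nonneg (hD0.trans hDle) (by positivity)
      · rw [div_le_div_iff₀ (by positivity) (by positivity)]
        nlinarith [mul_nonneg hnn (by positivity : (0 : ℝ) ≤ m)]
      · rw [show -muC m * ((m : ℝ) ^ 2 + 4 * m - ((m + 4) ^ 2 - a * (m - 4)) / 4)
          = -muC m * m ^ 2 + k * (muC m * (m - 4) / 4) by
            rw [show (a : ℝ) = m - 4 - k by linarith]; ring, Real.exp_add, Real.exp_nat_mul]
        gcongr
        refine exp_le_ten ?_
        have := muC_mul_le m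
        have := muC_pos m
        nlinarith
    have hL2 : (L : ℝ) ≤ (m + 4) / 2 := by linarith
    calc (L : ℝ) * majE (a + 1) * wX m ((L ^ 2 + 4 * a : ℤ) : ℝ)
        ≤ (m + 4) / 2 * (32.4 * 10 ^ a) * (((m + 4) / (4 * m)) ^ ((23 : ℝ) / 2) *
        (Real.exp (-muC m * m ^ 2) * 10 ^ k)) := by
          gcongr
          exact wX_nonneg m hD0
      _ = _ := by
        rw [show (10 : ℝ) ^ m = 10 ^ a * 10 ^ k * 10 ^ 4 by rw [hk]; ring]
        field_simp
  · have hs4 : 4 ≤ s ^ 2 := by nlinarith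
    have ha4 : 4 * (a : ℤ) ≤ s ^ 2 * a := by gcongr
    have ham : 4 * (a : ℤ) + 1 ≤ m := by nlinarith
    have hLm : 2 * L ≤ m + 1 - 4 * a := by
      have hpos : 0 < r * s := by positivity
      refine le_of_mul_le_mul_left (a := r * s) ?_ hpos
      have h2r : 2 * r ≤ r * s := by nlinarith
      have h6 : (r * s) * (m + 1 - 4 * a) ≥ (2 * r) * (m + 1 - 4 * a) := by
        gcongr
        linarith
      have h7 : 0 ≤ (r - 1) * (m - r ^ 2 - s ^ 2 * a) := mul_nonneg (by linarith) (by linarith)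
      have h8 : 0 ≤ r * (s ^ 2 * a - 4 * a) := mul_nonneg (by linarith) (by linarith)
      have h9 : 0 ≤ r * (r - 1) ^ 2 := by positivity
      nlinarith
    have hLR : 2 * (L : ℝ) ≤ m + 1 - 4 * a := by exact_mod_cast hLm
    have hamR : 4 * (a : ℝ) + 1 ≤ m := by exact_mod_cast ham
    have hX := wX_mono m hD0 (D' := ((m : ℝ) + 1) ^ 2 / 4) (by
      push_cast
      have h5 : (2 * (L : ℝ)) ^ 2 ≤ (m + 1 - 4 * a) ^ 2 := by gcongr
      nlinarith [mul_nonneg ha0 (by linarith : (0 : ℝ) ≤ m - 1 - 2 * a)])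
    refine le_epsE_of_le_sum (Or.inr (Or.inr (Or.inr ?_)))
    have h10 : (10 : ℝ) ^ a ≤ (9 / 5) ^ m := by
      calc (10 : ℝ) ^ a ≤ ((9 / 5) ^ 4) ^ a := by gcongr; norm_num
        _ = (9 / 5) ^ (4 * a) := by rw [pow_mul]
        _ ≤ _ := pow_le_pow_right₀ (by norm_num) (by omega)
    have hL2 : (L : ℝ) ≤ (m + 1) / 2 := by linarith
    calc (L : ℝ) * majE (a + 1) * wX m ((L ^ 2 + 4 * a : ℤ) : ℝ)
        ≤ (m + 1) / 2 * (32.4 * (9 / 5) ^ m) * wX m ((m + 1) ^ 2 / 4) := by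
          gcongr
          · exact wX_nonneg m hD0
          · exact haE.trans (by gcongr)
      _ = _ := by ring

lemma weight_bound {m : ℕ} {a b r s L : ℤ} (hm : 3 ≤ m) (hr : 1 ≤ r) (hs : 1 ≤ s)
    (hrs : ¬(r = 1 ∧ s = 1)) (ha : -1 ≤ a) (hb : -1 ≤ b) (hL : 1 ≤ L)
    (em : s ^ 2 * a + r ^ 2 * b + r * s * L = m)
    (hu : 0 ≤ 2 * s * a + r * L) (hv : 0 ≤ 2 * r * b + s * L) (hD : 0 < L ^ 2 - 4 * a * b) :
    (L : ℝ) * majE (a + 1).toNat * majE (b + 1).toNat * wX m ((L ^ 2 - 4 * a * b : ℤ) : ℝ)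
      ≤ epsE m := by
  have h0 : majE 0 = 1 := by decide
  rcases ha.eq_or_lt with ha | ha <;> rcases hb.eq_or_lt with hb | hb
  · subst ha hb
    have := weight_bound_neg_neg hm hr hs hrs hL (by linarith) (by linarith) (by linarith)
      (by linarith)
    simpa [h0] using this
  · subst ha
    lift b to ℕ using by omega
    have := weight_bound_nonneg_neg (a := b) hm hs hr (fun h => hrs ⟨h.2, h.1⟩) hL
      (by linarith) (by linarith)
    rw [show ((b : ℤ) + 1).toNat = b + 1 by omega]
    simpa [h0] using this
  · subst hb
    lift a to ℕ using by omega
    have := weight_bound_nonneg_neg (a := a) hm hr hs hrs hL (by linarith) (by linarith)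
    rw [show ((a : ℤ) + 1).toNat = a + 1 by omega]
    simpa [h0] using this
  · lift a to ℕ using by omega
    lift b to ℕ using by omega
    have := weight_bound_nonneg_nonneg (a := a) (b := b) hm hr hs hrs hL em hD
    rw [show ((a : ℤ) + 1).toNat = a + 1 by omega, show ((b : ℤ) + 1).toNat = b + 1 by omega]
    exact this

lemma sum_le_of_subsingleton_support {ι : Type*} {S : Finset ι} {f : ι → ℝ} {M : ℝ} (hM : 0 ≤ M)
    (hf : ∀ x ∈ S, f x ≤ M) (hu : ∀ x ∈ S, ∀ y ∈ S, f x ≠ 0 → f y ≠ 0 → x = y) : ∑ x ∈ S, f x ≤ M := by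
  classical
  by_cases h : ∃ x ∈ S, f x ≠ 0
  · obtain ⟨x, hx, hfx⟩ := h
    rw [Finset.sum_eq_single x]
    · exact hf x hx
    · intro y hyS hy
      by_contra hc
      exact hy (hu _ hyS _ hx hc hfx)
    · exact fun h => absurd hx h
  · push Not at h
    rw [Finset.sum_eq_zero h]
    exact hM

lemma polarCoef_weight_bound {m : ℕ} {nt l : ℤ} (hm : 3 ≤ m) (hnt : -1 ≤ nt) (h0 : 0 ≤ l)
    (hlm : l ≤ m) (hD : 4 * (m : ℤ) * nt - l ^ 2 < 0) :
    (polarCoef m nt l : ℝ) * wX m ((l ^ 2 - 4 * m * nt : ℤ) : ℝ)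
      ≤ ((l - 2 * nt : ℤ) : ℝ) * majE (nt + 1).toNat * majE (nt + m - l + 1).toNat
          * wX m ((l ^ 2 - 4 * m * nt : ℤ) : ℝ) + 4 * m ^ 2 * epsE m := by
  have hmZ : (3 : ℤ) ≤ m := by exact_mod_cast hm
  set W := wX m ((l ^ 2 - 4 * m * nt : ℤ) : ℝ) with hW
  have hW0 : 0 ≤ W := wX_nonneg m (by exact_mod_cast (by linarith : 0 ≤ l ^ 2 - 4 * (m : ℤ) * nt))
  have hpos : 0 ≤ l - 2 * nt := by
    rcases hnt.eq_or_lt with h | h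
    · rw [← h]; linarith
    · have : 0 ≤ nt := by omega
      by_contra hc
      push Not at hc
      nlinarith
  set B : ℝ := ((l - 2 * nt : ℤ) : ℝ) * majE (nt + 1).toNat * majE (nt + m - l + 1).toNat * W
    with hB
  have hB0 : 0 ≤ B := by
    have : (0 : ℝ) ≤ ((l - 2 * nt : ℤ) : ℝ) := by exact_mod_cast hpos
    positivity
  have hE := epsE_nonneg m
  have hterm : ∀ r ∈ Finset.Icc (1 : ℤ) (2 * m), ∀ s ∈ Finset.Icc (1 : ℤ) (2 * m),
      ∑ x ∈ Finset.Icc 0 (2 * (m : ℤ)) ×ˢ Finset.Icc 0 (2 * (m : ℤ)),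
        (polarTerm m nt l x.1 x.2 r s : ℝ) * W
      ≤ (if r = 1 then (if s = 1 then B else 0) else 0) + epsE m := by
    intro r hr s hs
    have hr1 := (Finset.mem_Icc.1 hr).1
    have hs1 := (Finset.mem_Icc.1 hs).1
    have hM : 0 ≤ (if r = 1 then (if s = 1 then B else 0) else 0) + epsE m := by
      split_ifs <;> linarith
    refine sum_le_of_subsingleton_support hM ?_ ?_
    · rintro ⟨p, q⟩ -
      by_cases h : polarTerm m nt l p q r s = 0
      · simp only [h]; simpa using hM
      · have hfacts := polarTerm_facts (by linarith) hD h
        have hbox := polarTerm_box hmZ h0 hlm hD h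
        obtain ⟨h1, -, -, hv, hu, ha, hb, hL⟩ := hfacts
        have he := polarTerm_eq h
        simp only
        by_cases h11 : r = 1 ∧ s = 1
        · obtain ⟨rfl, rfl⟩ := h11
          have hq : q = 0 := by
            have : 0 ≤ q := hbox.2.2.2.1
            by_contra hc
            have : 1 ≤ q := by omega
            nlinarith
          subst hq
          have hp : p = 1 := by linarith
          subst hp
          rw [he]
          simp only [if_true]
          have d1 := dcoef_le_majE (n := nt) hnt
          have d2 := dcoef_le_majE (n := nt + m - l) (by
            have := ha; ring_nf at this ⊢; linarith)
          rw [show (-2 * 1 * 1 * nt - 2 * 1 * 0 * (m : ℤ) + (1 * 1 + 0 * 1) * l) = l - 2 * nt by ring,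
            show (1 : ℤ) ^ 2 * nt + 1 ^ 2 * m - 1 * 1 * l = nt + m - l by ring,
            show (1 : ℤ) ^ 2 * nt + 0 ^ 2 * m - 0 * 1 * l = nt by ring]
          have hcalc : (l - 2 * nt) * dcoef (nt + m - l) * dcoef nt
              ≤ (l - 2 * nt) * majE (nt + 1).toNat * majE (nt + m - l + 1).toNat := by
            rw [mul_assoc, mul_assoc, mul_comm (majE (nt + 1).toNat : ℤ)]
            have := dcoef_nonneg nt
            gcongr
          have hcalcR : (((l - 2 * nt) * dcoef (nt + m - l) * dcoef nt : ℤ) : ℝ)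
              ≤ ((l - 2 * nt : ℤ) : ℝ) * majE (nt + 1).toNat * majE (nt + m - l + 1).toNat := by
            exact_mod_cast hcalc
          have := mul_le_mul_of_nonneg_right hcalcR hW0
          linarith
        · have e11 : (if r = 1 then (if s = 1 then B else 0) else 0) = (0 : ℝ) := by
            split_ifs with ha1 ha2
            · exact absurd ⟨ha1, ha2⟩ h11
            · rfl
            · rfl
          rw [e11, zero_add, he]
          set a := r ^ 2 * nt + p ^ 2 * m - p * r * l with ha'
          set b := s ^ 2 * nt + q ^ 2 * m - q * s * l with hb'
          set L := -2 * r * s * nt - 2 * p * q * m + (p * s + q * r) * l with hL'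
          have eu : 2 * s * a + r * L = 2 * m * p - r * l := by
            rw [ha', hL']; linear_combination (2 * m * p - r * l) * h1
          have ev : 2 * r * b + s * L = s * l - 2 * m * q := by
            rw [hb', hL']; linear_combination (s * l - 2 * m * q) * h1
          have hsq : (p * s - q * r) ^ 2 = 1 := by rw [h1]; ring
          have eD : L ^ 2 - 4 * a * b = l ^ 2 - 4 * m * nt := by
            rw [ha', hb', hL']
            linear_combination (l ^ 2 - 4 * m * nt) * hsq
          have em : s ^ 2 * a + r ^ 2 * b + r * s * L = m := by
            rw [ha', hb', hL']
            linear_combination m * hsq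
          have hw := weight_bound hm hr1 hs1 h11 ha hb hL em (by linarith) (by linarith)
            (by linarith)
          rw [eD] at hw
          refine le_trans ?_ hw
          have d1 := dcoef_le_majE ha
          have d2 := dcoef_le_majE hb
          have hcalc : L * dcoef a * dcoef b ≤ L * majE (a + 1).toNat * majE (b + 1).toNat := by
            have := dcoef_nonneg a
            have := dcoef_nonneg b
            gcongr
          have hcalcR : ((L * dcoef a * dcoef b : ℤ) : ℝ)
              ≤ L * majE (a + 1).toNat * majE (b + 1).toNat := by exact_mod_cast hcalc
          exact mul_le_mul_of_nonneg_right hcalcR hW0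
    · rintro ⟨p, q⟩ - ⟨p', q'⟩ - hx hy
      have hx : polarTerm m nt l p q r s ≠ 0 := by
        rintro h; simp [h] at hx
      have hy : polarTerm m nt l p' q' r s ≠ 0 := by
        rintro h; simp [h] at hy
      obtain ⟨rfl, rfl⟩ := polarTerm_unique (by linarith) hD hx hy
      rfl
  rw [polarCoef_eq_sum hmZ h0 hlm hD]
  push_cast
  simp_rw [Finset.sum_mul]
  calc _ ≤ ∑ r ∈ Finset.Icc (1 : ℤ) (2 * m), ∑ s ∈ Finset.Icc (1 : ℤ) (2 * m),
        ((if r = 1 then (if s = 1 then B else 0) else 0) + epsE m) :=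
        Finset.sum_le_sum fun r hr => Finset.sum_le_sum fun s hs => hterm r hr s hs
    _ = B + 4 * m ^ 2 * epsE m := by
      have hm1 : (1 : ℤ) ≤ 2 * m := by linarith
      simp only [Finset.sum_add_distrib, Finset.sum_const, Int.card_Icc, nsmul_eq_mul]
      congr 1
      · rw [Finset.sum_eq_single 1]
        · simp [hm1]
        · intro r _ hr; simp [hr]
        · intro h; simp [hm1] at h
      · have : ((2 * (m : ℤ) + 1 - 1).toNat : ℝ) = 2 * m := by
          rw [show (2 * (m : ℤ) + 1 - 1).toNat = 2 * m by omega]; push_cast; ring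
        rw [this]; ring

lemma sinh_le_mul_cosh {u : ℝ} (hu : 0 ≤ u) : Real.sinh u ≤ u * Real.cosh u := by
  have hmono : MonotoneOn (fun u : ℝ => u * Real.cosh u - Real.sinh u) (Set.Ici 0) := by
    refine monotoneOn_of_deriv_nonneg (convex_Ici 0) (by fun_prop) (by fun_prop) ?_
    intro x hx
    rw [interior_Ici] at hx
    have : HasDerivAt (fun u : ℝ => u * Real.cosh u - Real.sinh u)
        ((1 * Real.cosh x + x * Real.sinh x) - Real.cosh x) x :=
      ((hasDerivAt_id x).mul (Real.hasDerivAt_cosh x)).sub (Real.hasDerivAt_sinh x)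
    rw [this.deriv]
    have h1 : 0 ≤ Real.sinh x := Real.sinh_nonneg_iff.2 (le_of_lt hx)
    have h2 : 0 ≤ x * Real.sinh x := mul_nonneg (le_of_lt hx) h1
    linarith
  have := hmono (Set.mem_Ici.2 le_rfl) (Set.mem_Ici.2 hu) hu
  simp at this
  linarith

lemma abs_inv_sinh_sq_sub_le {u : ℝ} : |1 / Real.sinh u ^ 2 - 1 / u ^ 2| ≤ 1 := by
  wlog hu : 0 ≤ u generalizing u
  · have := this (u := -u) (by linarith)
    simpa using this
  rcases hu.eq_or_lt with rfl | hu
  · simp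
  have hs : u ≤ Real.sinh u := Real.self_le_sinh_iff.2 hu.le
  have hc := sinh_le_mul_cosh hu.le
  have hcs := Real.cosh_sq u
  have hs0 : 0 < Real.sinh u := hu.trans_le hs
  have h1 : 1 / Real.sinh u ^ 2 ≤ 1 / u ^ 2 := by gcongr
  have h2 : 1 / u ^ 2 ≤ 1 + 1 / Real.sinh u ^ 2 := by
    have : Real.sinh u ^ 2 ≤ u ^ 2 * (1 + Real.sinh u ^ 2) := by
      have := pow_le_pow_left₀ hs0.le hc 2
      rw [mul_pow, hcs] at this
      linarith
    rw [div_le_iff₀ (by positivity)]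
    have h3 : (1 + 1 / Real.sinh u ^ 2) * u ^ 2
        = u ^ 2 * (1 + Real.sinh u ^ 2) / Real.sinh u ^ 2 := by field_simp; ring
    rw [h3, le_div_iff₀ (by positivity)]
    linarith
  rw [abs_le]; constructor <;> linarith

lemma inv_sin_sq_le {t : ℝ} (h0 : t ≠ 0) (h1 : |t| ≤ π / 2) :
    0 < Real.sin t ^ 2 ∧ 1 / Real.sin t ^ 2 ≤ 1 + 1 / t ^ 2 := by
  wlog hu : 0 < t generalizing t
  · have := this (t := -t) (by simpa) (by simpa) (by
      rcases lt_or_gt_of_ne h0 with h | h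
      · linarith
      · exact absurd h hu)
    simpa using this
  rw [abs_of_pos hu] at h1
  have hs : 0 < Real.sin t := Real.sin_pos_of_pos_of_lt_pi hu (by linarith [Real.pi_pos])
  refine ⟨by positivity, ?_⟩
  have hc0 : 0 ≤ Real.cos t := Real.cos_nonneg_of_mem_Icc ⟨by linarith, h1⟩
  have hc : t * Real.cos t ≤ Real.sin t := by
    rcases h1.eq_or_lt with h | h
    · rw [h, Real.cos_pi_div_two]; simp
    · have h3 := Real.le_tan hu.le h
      have hc1 : 0 < Real.cos t := Real.cos_pos_of_mem_Ioo ⟨by linarith, h⟩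
      rwa [Real.tan_eq_sin_div_cos, le_div_iff₀ hc1] at h3
  have h4 := pow_le_pow_left₀ (by positivity) hc 2
  rw [mul_pow, Real.cos_sq'] at h4
  have h3 : 1 + 1 / t ^ 2 = (1 + t ^ 2) / t ^ 2 := by field_simp; ring
  rw [h3, div_le_div_iff₀ (by positivity) (by positivity)]
  nlinarith

lemma normSq_sinh_sub (u t : ℝ) :
    ‖Complex.sinh ((u : ℂ) - t * Complex.I)‖ ^ 2 = Real.sinh u ^ 2 + Real.sin t ^ 2 := by
  have e : Complex.sinh ((u : ℂ) - t * Complex.I)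
      = ((Real.sinh u * Real.cos t : ℝ) : ℂ)
        + ((-(Real.cosh u * Real.sin t) : ℝ) : ℂ) * Complex.I := by
    rw [Complex.sinh_sub, Complex.sinh_mul_I, Complex.cosh_mul_I]
    push_cast
    ring
  rw [e, Complex.sq_norm, Complex.normSq_add_mul_I]
  have h1 := Real.cosh_sq u
  have h2 := Real.cos_sq' t
  rw [neg_sq, mul_pow, mul_pow, h1, h2]
  ring

/-- Uniform bound for `fFun` with the frequency `g` in the fundamental range. -/
lemma norm_fFun_le {m γ : ℕ} (hm : 0 < m) (hγ : 0 < γ) {g : ℤ} (h1 : -(m : ℤ) * γ < g)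
    (h2 : g ≤ m * γ) (x : ℝ) :
    ‖fFun m γ g x‖ ≤ π ^ 2 + 4 * m ^ 2 * γ ^ 2 / (g : ℝ) ^ 2 := by
  have hmγ : (0 : ℝ) < m * γ := by positivity
  have hγ' : (0 : ℝ) < γ := by positivity
  have hm' : (0 : ℝ) < m := by positivity
  have hmγZ : (0 : ℤ) < m * γ := by positivity
  unfold fFun
  split_ifs with h
  · have hg : g = 0 := by
      obtain ⟨k, hk⟩ := Int.dvd_of_emod_eq_zero h
      have hk0 : k = 0 := by
        have a1 : -1 < 2 * k := by nlinarith
        have a2 : 2 * k ≤ 1 := by nlinarith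
        omega
      rw [hk, hk0]; simp
    rw [hg, Complex.norm_real, Real.norm_eq_abs]
    have := @abs_inv_sinh_sq_sub_le (π * x / γ)
    have e : π ^ 2 / Real.sinh (π * x / γ) ^ 2 - (γ : ℝ) ^ 2 / x ^ 2
        = π ^ 2 * (1 / Real.sinh (π * x / γ) ^ 2 - 1 / (π * x / γ) ^ 2) := by
      have := Real.pi_pos
      rcases eq_or_ne x 0 with rfl | hx
      · simp
      · field_simp
    rw [e, abs_mul, abs_of_pos (by positivity)]
    simp only [Int.cast_zero]
    have := mul_le_mul_of_nonneg_left this (by positivity : (0 : ℝ) ≤ π ^ 2)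
    simpa using this
  · have hg : g ≠ 0 := by rintro rfl; simp at h
    have hgR : (g : ℝ) ≠ 0 := by exact_mod_cast hg
    set t : ℝ := π * g / (2 * m * γ) with ht
    have e : (π : ℂ) * x / γ - (π : ℂ) * Complex.I * g / (2 * m * γ)
        = ((π * x / γ : ℝ) : ℂ) - (t : ℂ) * Complex.I := by
      rw [ht]; push_cast; ring
    have ht0 : t ≠ 0 := by
      have := Real.pi_pos
      rw [ht]; positivity
    have habs : |(g : ℝ)| ≤ m * γ := by
      rw [abs_le]
      constructor
      · have : (-(m : ℝ) * γ) < g := by exact_mod_cast h1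
        linarith
      · exact_mod_cast h2
    have ht1 : |t| ≤ π / 2 := by
      rw [ht, abs_div, abs_mul, abs_of_pos Real.pi_pos,
        abs_of_pos (by positivity : (0 : ℝ) < 2 * m * γ),
        div_le_div_iff₀ (by positivity) (by positivity)]
      nlinarith [Real.pi_pos]
    obtain ⟨hs0, hs⟩ := inv_sin_sq_le ht0 ht1
    rw [e, norm_div, norm_pow, norm_pow, normSq_sinh_sub, Complex.norm_real, Real.norm_eq_abs,
      abs_of_pos Real.pi_pos]
    calc π ^ 2 / (Real.sinh (π * x / γ) ^ 2 + Real.sin t ^ 2) ≤ π ^ 2 / Real.sin t ^ 2 := by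
          gcongr
          nlinarith [sq_nonneg (Real.sinh (π * x / γ))]
      _ = π ^ 2 * (1 / Real.sin t ^ 2) := by ring
      _ ≤ π ^ 2 * (1 + 1 / t ^ 2) := by gcongr
      _ = _ := by
          rw [ht]
          have := Real.pi_pos
          field_simp
          ring

lemma rpow_mul_besselI {ν a b z : ℝ} (hν : 0 ≤ ν) (ha : 0 ≤ a) (hb : 0 ≤ b) (hz : 0 ≤ z)
    (h : a * (z / 2) ^ 2 = b ^ 2) :
    a ^ (ν / 2) * besselI ν z = b ^ ν * besselF ν (z ^ 2 / 4) := by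
  rw [besselI_eq hν hz, ← mul_assoc]
  congr 1
  have h1 : ∀ t : ℝ, 0 ≤ t → t ^ ν = (t ^ 2) ^ (ν / 2) := by
    intro t ht
    rw [← Real.rpow_natCast, ← Real.rpow_mul ht]
    congr 1
    push_cast
    ring
  rw [h1 _ (by positivity), h1 _ hb, ← Real.mul_rpow ha (by positivity), h]

lemma integral_exp_neg_mul_sq_le {a b c : ℝ} (hab : a ≤ b) (hc : 0 < c) :
    ∫ x in a..b, Real.exp (-c * x ^ 2) ≤ √(π / c) := by
  rw [← integral_gaussian, intervalIntegral.integral_of_le hab]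
  refine MeasureTheory.setIntegral_le_integral (integrable_exp_neg_mul_sq hc) ?_
  exact Filter.Eventually.of_forall fun x => (Real.exp_pos _).le

lemma norm_innerInt_le {m γ : ℕ} (hm : 0 < m) (hγ : 0 < γ) {g Δ : ℤ} (hΔ : 0 < Δ) {C : ℝ}
    (hC : ∀ x, ‖fFun m γ g x‖ ≤ C) :
    (4 * (m : ℝ) / Δ) ^ ((25 : ℝ) / 4) * ‖innerInt m γ g Δ‖ ≤
      C * (2 * π / γ) ^ ((25 : ℝ) / 2) * besselF (25 / 2) (π ^ 2 * Δ / m)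
        * √(π / (25 / 2 * m)) := by
  have hm' : (0 : ℝ) < m := by positivity
  have hγ' : (1 : ℝ) ≤ γ := by exact_mod_cast hγ
  have hΔ' : (0 : ℝ) < Δ := by exact_mod_cast hΔ
  have hπ := Real.pi_pos
  have hC0 : 0 ≤ C := (norm_nonneg _).trans (hC 0)
  set A : ℝ := (4 * (m : ℝ) / Δ) ^ ((25 : ℝ) / 4) with hA
  have hA0 : 0 < A := by positivity
  set K : ℝ := C * (2 * π / γ) ^ ((25 : ℝ) / 2) * besselF (25 / 2) (π ^ 2 * Δ / m) with hK
  have hF0 : 0 < besselF (25 / 2) (π ^ 2 * Δ / m) := besselF_pos (by norm_num) (by positivity)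
  have hK0 : 0 ≤ K := by positivity
  have hab : -(1 : ℝ) / √m ≤ 1 / √m := by
    have : 0 < 1 / √(m : ℝ) := by positivity
    rw [neg_div]; linarith
  have key : ‖innerInt m γ g Δ‖
      ≤ ∫ x in (-(1 : ℝ) / √m)..(1 / √m), A⁻¹ * K * Real.exp (-(25 / 2 * m) * x ^ 2) := by
    refine intervalIntegral.norm_integral_le_of_norm_le hab ?_
      (Continuous.intervalIntegrable (by fun_prop) _ _)
    refine Filter.Eventually.of_forall fun x hx => ?_
    set s : ℝ := 1 - m * x ^ 2 with hs
    have hx2 : x ^ 2 ≤ (1 / √m) ^ 2 := by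
      rw [sq_le_sq, abs_of_pos (by positivity : (0 : ℝ) < 1 / √m), abs_le]
      refine ⟨?_, hx.2⟩
      have := hx.1
      rw [neg_div] at this
      exact this.le
    rw [div_pow, Real.sq_sqrt hm'.le, one_pow, le_div_iff₀ hm'] at hx2
    have hs0 : 0 ≤ s := by rw [hs]; linarith
    have hs1 : s ≤ 1 := by rw [hs]; nlinarith [sq_nonneg x]
    set z : ℝ := 2 * π * √((Δ : ℝ) * s) / (γ * √m) with hz
    have hz0 : 0 ≤ z := by positivity
    have hzsq : z ^ 2 / 4 = π ^ 2 * Δ / m * s / γ ^ 2 := by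
      rw [hz, div_pow, mul_pow, mul_pow, mul_pow, Real.sq_sqrt (by positivity),
        Real.sq_sqrt hm'.le]
      field_simp
      ring
    have hI := rpow_mul_besselI (ν := 25 / 2) (a := 4 * m / Δ * s) (b := 2 * π / γ * s) (z := z)
      (by norm_num) (by positivity) (by positivity) hz0 (by
        have : (z / 2) ^ 2 = z ^ 2 / 4 := by ring
        rw [this, hzsq]; field_simp; ring)
    have h25 : (25 : ℝ) / 2 / 2 = 25 / 4 := by norm_num
    rw [h25, Real.mul_rpow (by positivity) hs0, ← hA, hzsq,
      Real.mul_rpow (by positivity) hs0] at hI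
    have hIb : 0 ≤ besselI (25 / 2) z := by
      rw [besselI_eq (by norm_num) hz0]
      have := besselF_pos (ν := 25 / 2) (y := z ^ 2 / 4) (by norm_num) (by positivity)
      positivity
    have hFle : besselF (25 / 2) (π ^ 2 * Δ / m * s / γ ^ 2)
        ≤ besselF (25 / 2) (π ^ 2 * Δ / m) := by
      refine besselF_mono (by norm_num) (by positivity) ?_
      rw [div_le_iff₀ (by positivity)]
      have h1 : (1 : ℝ) ≤ γ ^ 2 := one_le_pow₀ hγ'
      have h2 : 0 ≤ π ^ 2 * Δ / m := by positivity
      nlinarith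
    have hexp : s ^ ((25 : ℝ) / 2) ≤ Real.exp (-(25 / 2 * m) * x ^ 2) := by
      have h1 : s ≤ Real.exp (-(m * x ^ 2)) := by
        have := Real.add_one_le_exp (-(m * x ^ 2))
        rw [hs]; linarith
      refine (Real.rpow_le_rpow hs0 h1 (by norm_num)).trans_eq ?_
      rw [← Real.exp_mul]
      congr 1; ring
    rw [norm_mul, norm_mul, Complex.norm_real, Complex.norm_real, Real.norm_eq_abs,
      Real.norm_eq_abs, abs_of_nonneg hIb, abs_of_nonneg (by positivity)]
    have hF1 : 0 < besselF (25 / 2) (π ^ 2 * Δ / m * s / γ ^ 2) :=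
      besselF_pos (by norm_num) (by positivity)
    calc ‖fFun m γ g x‖ * s ^ ((25 : ℝ) / 4) * besselI (25 / 2) z
        = A⁻¹ * ‖fFun m γ g x‖ * (A * s ^ ((25 : ℝ) / 4) * besselI (25 / 2) z) := by
          field_simp
      _ = A⁻¹ * ‖fFun m γ g x‖ * ((2 * π / γ) ^ ((25 : ℝ) / 2) * s ^ ((25 : ℝ) / 2)
            * besselF (25 / 2) (π ^ 2 * Δ / m * s / γ ^ 2)) := by rw [hI]
      _ ≤ A⁻¹ * C * ((2 * π / γ) ^ ((25 : ℝ) / 2) * Real.exp (-(25 / 2 * m) * x ^ 2)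
            * besselF (25 / 2) (π ^ 2 * Δ / m)) := by
          gcongr
          exact hC x
      _ = A⁻¹ * K * Real.exp (-(25 / 2 * m) * x ^ 2) := by rw [hK]; ring
  rw [intervalIntegral.integral_const_mul] at key
  have hG := integral_exp_neg_mul_sq_le hab (by positivity : (0 : ℝ) < 25 / 2 * m)
  calc A * ‖innerInt m γ g Δ‖ ≤ A * (A⁻¹ * K * √(π / (25 / 2 * m))) := by
        gcongr
        exact key.trans (by gcongr)
    _ = _ := by field_simp

lemma sum_inv_int_sq_le (s : Finset ℤ) : ∑ g ∈ s, 1 / (g : ℝ) ^ 2 ≤ π ^ 2 / 3 := by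
  have h1 : HasSum (fun n : ℕ => 1 / ((n : ℤ) : ℝ) ^ 2) (π ^ 2 / 6) := by
    simpa using hasSum_zeta_two
  have h2 : HasSum (fun n : ℕ => 1 / ((-((n : ℤ) + 1) : ℤ) : ℝ) ^ 2) (π ^ 2 / 6) := by
    have h := (hasSum_nat_add_iff' 1).2 hasSum_zeta_two
    simp only [Finset.range_one, Finset.sum_singleton, Nat.cast_zero] at h
    rw [zero_pow two_ne_zero, div_zero, sub_zero] at h
    have e : (fun n : ℕ => 1 / ((-((n : ℤ) + 1) : ℤ) : ℝ) ^ 2)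
        = fun n : ℕ => 1 / ((n + 1 : ℕ) : ℝ) ^ 2 := by
      funext n
      push_cast
      rw [neg_sq]
    rw [e]
    exact h
  have h3 : HasSum (fun g : ℤ => 1 / (g : ℝ) ^ 2) (π ^ 2 / 6 + π ^ 2 / 6) :=
    HasSum.of_nat_of_neg_add_one h1 h2
  have := sum_le_hasSum s (fun g _ => by positivity) h3
  linarith

lemma sum_fFun_bound_le {m γ : ℕ} (hγ : 0 < γ) :
    ∑ g ∈ Finset.Ioc (-(m : ℤ) * γ) ((m : ℤ) * γ), (π ^ 2 + 4 * (m : ℝ) ^ 2 * γ ^ 2 / (g : ℝ) ^ 2)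
      ≤ π ^ 2 * γ ^ 2 * (2 * m + 4 * m ^ 2 / 3) := by
  have hγ' : (1 : ℝ) ≤ γ := by exact_mod_cast hγ
  have e : ∀ g : ℤ, π ^ 2 + 4 * (m : ℝ) ^ 2 * γ ^ 2 / (g : ℝ) ^ 2
      = π ^ 2 + 4 * (m : ℝ) ^ 2 * γ ^ 2 * (1 / (g : ℝ) ^ 2) := fun g => by ring
  simp only [e]
  rw [Finset.sum_add_distrib, ← Finset.mul_sum, Finset.sum_const, Int.card_Ioc, nsmul_eq_mul]
  have h1 : ((((m : ℤ) * γ - -(m : ℤ) * γ).toNat : ℕ) : ℝ) = 2 * m * γ := by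
    have : ((m : ℤ) * γ - -(m : ℤ) * γ).toNat = 2 * m * γ := by
      have : (m : ℤ) * γ - -(m : ℤ) * γ = ((2 * m * γ : ℕ) : ℤ) := by push_cast; ring
      rw [this, Int.toNat_natCast]
    rw [this]; push_cast; ring
  rw [h1]
  have h2 := sum_inv_int_sq_le (Finset.Ioc (-(m : ℤ) * γ) ((m : ℤ) * γ))
  have h3 : 4 * (m : ℝ) ^ 2 * γ ^ 2 * ∑ g ∈ Finset.Ioc (-(m : ℤ) * γ) ((m : ℤ) * γ), 1 / (g : ℝ) ^ 2
      ≤ 4 * (m : ℝ) ^ 2 * γ ^ 2 * (π ^ 2 / 3) := by gcongr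
  have h4 : 2 * (m : ℝ) * γ * π ^ 2 ≤ 2 * m * γ ^ 2 * π ^ 2 := by
    gcongr
    nlinarith
  linarith

lemma sum_residue_le {m : ℕ} (s : Finset ℤ) {h : ℤ → ℝ} (hh : ∀ g, 0 ≤ h g) :
    ∑ l ∈ Finset.Icc (-(m : ℤ) + 1) (m : ℤ),
      ∑ g ∈ s.filter (fun g => g % (2 * (m : ℤ)) = l % (2 * (m : ℤ))), h g
    ≤ ∑ g ∈ s, h g := by
  simp only [Finset.sum_filter]
  rw [Finset.sum_comm]
  refine Finset.sum_le_sum fun g _ => ?_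
  refine sum_le_of_subsingleton_support (hh g) (fun l _ => ?_) ?_
  · split_ifs
    · exact le_rfl
    · exact hh g
  · intro a ha b hb hfa hfb
    have h1 : g % (2 * (m : ℤ)) = a % (2 * (m : ℤ)) := by
      by_contra hc; simp [hc] at hfa
    have h2 : g % (2 * (m : ℤ)) = b % (2 * (m : ℤ)) := by
      by_contra hc; simp [hc] at hfb
    rw [Finset.mem_Icc] at ha hb
    obtain ⟨k, hk⟩ := Int.ModEq.dvd (h1.symm.trans h2)
    have hk0 : k = 0 := by
      have : k < 1 := by nlinarith
      have : -1 < k := by nlinarith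
      omega
    rw [hk0] at hk
    linarith

/-- Bound for the total contribution of the integrals to `Sgamma`. -/
lemma norm_integral_terms_le {m γ : ℕ} (hm : 0 < m) (hγ : 0 < γ) {Δ : ℤ} (hΔ : 0 < Δ) (A : ℚ)
    (B : ℤ → ℚ) (ℓ : ℤ) :
    ∑ l ∈ Finset.Icc (-(m : ℤ) + 1) (m : ℤ),
      ‖∑ g ∈ (Finset.Ioc (-(m : ℤ) * γ) ((m : ℤ) * γ)).filter
        (fun g => g % (2 * (m : ℤ)) = l % (2 * (m : ℤ))),
        Kl m A (B g) γ ℓ l * ((γ : ℂ) ^ 2)⁻¹ *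
          ((((4 * (m : ℝ)) / (Δ : ℝ)) ^ ((25 : ℝ) / 4) : ℝ) : ℂ) * innerInt m γ g Δ‖
    ≤ (√(2 * m * γ))⁻¹ * ((2 * π / γ) ^ ((25 : ℝ) / 2) * besselF (25 / 2) (π ^ 2 * Δ / m)
        * √(π / (25 / 2 * m))) * (π ^ 2 * γ ^ 2 * (2 * m + 4 * m ^ 2 / 3)) := by
  have hγ' : (0 : ℝ) < γ := by exact_mod_cast hγ
  have hΔ' : (0 : ℝ) < Δ := by exact_mod_cast hΔ
  have hF0 : 0 < besselF (25 / 2) (π ^ 2 * Δ / m) := besselF_pos (by norm_num) (by positivity)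
  set P : ℝ := (2 * π / γ) ^ ((25 : ℝ) / 2) * besselF (25 / 2) (π ^ 2 * Δ / m)
        * √(π / (25 / 2 * m)) with hP
  have hP0 : 0 ≤ P := by positivity
  set h : ℤ → ℝ := fun g => (√(2 * m * γ))⁻¹ * P *
    (π ^ 2 + 4 * (m : ℝ) ^ 2 * γ ^ 2 / (g : ℝ) ^ 2) with hh
  calc _ ≤ ∑ l ∈ Finset.Icc (-(m : ℤ) + 1) (m : ℤ),
      ∑ g ∈ (Finset.Ioc (-(m : ℤ) * γ) ((m : ℤ) * γ)).filter
        (fun g => g % (2 * (m : ℤ)) = l % (2 * (m : ℤ))), h g := by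
        refine Finset.sum_le_sum fun l _ => norm_sum_le_of_le _ fun g hg => ?_
        rw [Finset.mem_filter, Finset.mem_Ioc] at hg
        have hK := norm_Kl_le m γ hm hγ A (B g) ℓ l
        have hI := norm_innerInt_le hm hγ hΔ (norm_fFun_le hm hγ hg.1.1 hg.1.2)
        have hA0 : 0 < ((4 * (m : ℝ)) / (Δ : ℝ)) ^ ((25 : ℝ) / 4) := by positivity
        rw [norm_mul, norm_mul, norm_mul, Complex.norm_real, Real.norm_eq_abs, abs_of_pos hA0,
          norm_inv, norm_pow, Complex.norm_natCast, mul_assoc]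
        calc _ ≤ (√(2 * m * γ))⁻¹ * γ ^ 2 * ((γ : ℝ) ^ 2)⁻¹ *
            ((π ^ 2 + 4 * m ^ 2 * γ ^ 2 / (g : ℝ) ^ 2) * (2 * π / γ) ^ ((25 : ℝ) / 2)
              * besselF (25 / 2) (π ^ 2 * Δ / m) * √(π / (25 / 2 * m))) := by
              gcongr
          _ = h g := by
              rw [hh, hP]
              field_simp
    _ ≤ ∑ g ∈ Finset.Ioc (-(m : ℤ) * γ) ((m : ℤ) * γ), h g :=
        sum_residue_le _ fun g => by rw [hh]; positivity
    _ ≤ _ := by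
        rw [hh, ← Finset.mul_sum]
        gcongr
        exact sum_fFun_bound_le hγ

/-- The `k`-th term of the leading row of the polar sum. -/
noncomputable def rowTerm (m k : ℕ) : ℝ :=
  ((m : ℝ) + 2 - k) * majE k * wX m (m ^ 2 + 4 * m - k * (2 * m - k))

/-- Rational factor multiplying `majE (m + 1) * wX m (4 * m)` in the non-polar corrections. -/
noncomputable def corrC (m : ℕ) : ℝ :=
  (m / 10.8 + 0.3) / 2 + (0.867 / m + 0.29) / 2 * 0.1257 * (2 * m + 4 * m ^ 2 / 3)

/-- Bound for the sum of all terms, relative to the leading term. -/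
noncomputable def totalB (m : ℕ) : ℝ :=
  70 / 69 * (∑ k ∈ Finset.range m, rowTerm m k + ∑ k ∈ Finset.range m, rowTerm m (k + 1))
  + 8 * m ^ 3 * (m + 2) * epsE m + majE (m + 1) * wX m (4 * m) * corrC m

/-- A rational upper bound for `exp (-muC m)`. -/
def expQ (m : ℕ) : ℚ :=
  let x : ℚ := 5.44 / (2 * m + 9)
  1 / (1 + x + x ^ 2 / 2 + x ^ 3 / 6 + x ^ 4 / 24)

/-- A rational form of `majE`. -/
def majQ (n : ℕ) : ℚ :=
  3 ^ n * ((n + 1) * (n + 2) * (n + 3) * (n + 4) * (n + 5) * (n + 6) * (n + 7)) / 5040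

/-- A rational upper bound for `r ^ (23 / 2) * exp (-muC m * d)`. -/
def wQ (t r : ℚ) (d : ℕ) : ℚ := r ^ 11 * ((1 + r) / 2) * t ^ d

/-- A rational upper bound for `rowTerm`. -/
def rowQ (t : ℚ) (m k : ℕ) : ℚ :=
  ((m : ℚ) + 2 - k) * majQ k * wQ t ((m ^ 2 + 4 * m - k * (2 * m - k)) / (m ^ 2 + 4 * m))
    (k * (2 * m - k))

/-- A rational upper bound for `epsE`. -/
def epsQ (t : ℚ) (m : ℕ) : ℚ :=
  (m + 2) / 2 * 32.4 ^ 2 * (1 / 2) ^ 23 * 10 ^ m * t ^ (m ^ 2 + 4 * m)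
  + (m + 5) / 2 * wQ t (((m + 1) * (m + 9) / 4) / (m ^ 2 + 4 * m)) (3 * (m + 3) * (m - 1) / 4)
  + (if m ≤ 3 then 0 else (m + 4) / 2 * 32.4 * (10 ^ m / 10 ^ 4) *
      wQ t ((m + 4) / (4 * m)) (m ^ 2))
  + (m + 1) / 2 * 32.4 * (9 / 5) ^ m *
      wQ t (((m + 1) ^ 2 / 4) / (m ^ 2 + 4 * m)) ((3 * m ^ 2 + 14 * m - 1) / 4)

/-- A rational upper bound for `totalB`. -/
def totalQ (t : ℚ) (m : ℕ) : ℚ :=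
  70 / 69 * (∑ k ∈ Finset.range m, rowQ t m k + ∑ k ∈ Finset.range m, rowQ t m (k + 1))
  + 8 * m ^ 3 * (m + 2) * epsQ t m + majQ (m + 1) * wQ t (4 * m / (m ^ 2 + 4 * m)) (m ^ 2) *
    ((m / 10.8 + 0.3) / 2 + (0.867 / m + 0.29) / 2 * 0.1257 * (2 * m + 4 * m ^ 2 / 3))

lemma totalQ_le : ∀ m ∈ Finset.Icc 3 19, totalQ (expQ m) m ≤ 1.99 * (m + 2) := by
  decide +kernel

lemma majE_eq_majQ (n : ℕ) : (majE n : ℝ) = ((majQ n : ℚ) : ℝ) := by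
  induction n with
  | zero => norm_num [majE, majQ]
  | succ n ih =>
    have h := majE_succ n
    have hn : (n : ℝ) + 1 ≠ 0 := by positivity
    rw [ih] at h
    have : (majE (n + 1) : ℝ) = (majQ n : ℝ) * (3 * (n + 8)) / (n + 1) := by
      rw [eq_div_iff hn]; exact h
    rw [this]
    unfold majQ
    push_cast
    rw [pow_succ]
    field_simp
    ring

lemma exp_neg_le_taylor {x : ℝ} (hx : 0 ≤ x) :
    Real.exp (-x) ≤ 1 / (1 + x + x ^ 2 / 2 + x ^ 3 / 6 + x ^ 4 / 24) := by
  have h := Real.sum_le_exp_of_nonneg hx 5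
  simp only [Finset.sum_range_succ, Finset.sum_range_zero, Nat.factorial] at h
  norm_num at h
  rw [Real.exp_neg, ← one_div]
  gcongr

lemma exp_neg_muC_le (m : ℕ) : Real.exp (-muC m) ≤ ((expQ m : ℚ) : ℝ) := by
  refine (exp_neg_le_taylor (muC_pos m).le).trans_eq ?_
  simp only [expQ, muC]
  push_cast
  rfl

lemma exp_neg_muC_mul_le {m d : ℕ} {y : ℝ} (h : (d : ℝ) ≤ y) :
    Real.exp (-muC m * y) ≤ ((expQ m ^ d : ℚ) : ℝ) := by
  have h1 : Real.exp (-muC m * y) ≤ Real.exp (-muC m) ^ d := by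
    rw [← Real.exp_nat_mul]
    exact Real.exp_le_exp.2 (by nlinarith [muC_pos m])
  push_cast
  exact h1.trans (pow_le_pow_left₀ (Real.exp_pos _).le (exp_neg_muC_le m) d)

lemma rpow_half_le {r : ℝ} (hr : 0 ≤ r) : r ^ ((23 : ℝ) / 2) ≤ r ^ 11 * ((1 + r) / 2) := by
  have h : r ^ ((23 : ℝ) / 2) = r ^ 11 * √r := by
    rw [Real.sqrt_eq_rpow, ← Real.rpow_natCast r 11, ← Real.rpow_add_of_nonneg hr (by norm_num)
      (by norm_num)]
    norm_num
  rw [h]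
  gcongr
  have := Real.sq_sqrt hr
  nlinarith [sq_nonneg (√r - 1)]

lemma rpow_mul_exp_le_wQ {m d : ℕ} {r : ℝ} {q : ℚ} {y : ℝ} (hq : (q : ℝ) = r) (hr : 0 ≤ r)
    (h : (d : ℝ) ≤ y) :
    r ^ ((23 : ℝ) / 2) * Real.exp (-muC m * y) ≤ ((wQ (expQ m) q d : ℚ) : ℝ) := by
  have h1 := rpow_half_le hr
  have h2 := exp_neg_muC_mul_le (m := m) h
  unfold wQ
  rw [Rat.cast_mul]
  have e : ((q ^ 11 * ((1 + q) / 2) : ℚ) : ℝ) = r ^ 11 * ((1 + r) / 2) := by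
    push_cast; rw [hq]
  rw [e]
  gcongr

lemma wX_le_wQ {m d : ℕ} {D : ℝ} {q : ℚ} (hq : (q : ℝ) = D / (m ^ 2 + 4 * m)) (hD : 0 ≤ D)
    (h : (d : ℝ) ≤ m ^ 2 + 4 * m - D) : wX m D ≤ ((wQ (expQ m) q d : ℚ) : ℝ) :=
  rpow_mul_exp_le_wQ hq (by positivity) h

lemma rowTerm_le_rowQ {m k : ℕ} (hk : k ≤ m) : rowTerm m k ≤ ((rowQ (expQ m) m k : ℚ) : ℝ) := by
  have hk' : (k : ℝ) ≤ m := by exact_mod_cast hk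
  have hD : (0 : ℝ) ≤ m ^ 2 + 4 * m - k * (2 * m - k) := by
    nlinarith [sq_nonneg ((m : ℝ) - k), (m.cast_nonneg : (0 : ℝ) ≤ m)]
  have hw := wX_le_wQ (m := m) (d := k * (2 * m - k))
    (D := (m : ℝ) ^ 2 + 4 * m - k * (2 * m - k))
    (q := ((m : ℚ) ^ 2 + 4 * m - k * (2 * m - k)) / (m ^ 2 + 4 * m)) (by push_cast; rfl) hD (by
      rw [Nat.cast_mul, Nat.cast_sub (by omega)]; push_cast; linarith)
  unfold rowTerm rowQ
  rw [Rat.cast_mul, Rat.cast_mul, ← majE_eq_majQ]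
  have e : (((m : ℚ) + 2 - k : ℚ) : ℝ) = (m : ℝ) + 2 - k := by push_cast; rfl
  rw [e]
  have : (0 : ℝ) ≤ (m : ℝ) + 2 - k := by linarith
  gcongr

lemma epsE_le_epsQ {m : ℕ} (hm : 1 ≤ m) : epsE m ≤ ((epsQ (expQ m) m : ℚ) : ℝ) := by
  have hm' : (1 : ℝ) ≤ m := by exact_mod_cast hm
  have h0 := exp_neg_muC_mul_le (m := m) (d := m ^ 2 + 4 * m) (y := m ^ 2 + 4 * m)
    (by push_cast; exact le_rfl)
  have div4 : ∀ a : ℕ, ((a / 4 : ℕ) : ℝ) ≤ a / 4 := fun a => by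
    simpa using Nat.cast_div_le (α := ℝ) (m := a) (n := 4)
  have h1 := wX_le_wQ (m := m) (d := 3 * (m + 3) * (m - 1) / 4) (D := (m + 1) * (m + 9) / 4)
    (q := (((m : ℚ) + 1) * (m + 9) / 4) / (m ^ 2 + 4 * m)) (by push_cast; rfl) (by positivity) (by
      refine (div4 _).trans ?_
      rw [Nat.cast_mul, Nat.cast_sub hm]
      push_cast
      nlinarith)
  have h2 := rpow_mul_exp_le_wQ (m := m) (d := m ^ 2) (r := ((m : ℝ) + 4) / (4 * m))
    (q := ((m : ℚ) + 4) / (4 * m)) (y := m ^ 2) (by push_cast; rfl) (by positivity)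
    (by push_cast; exact le_rfl)
  have h3 := wX_le_wQ (m := m) (d := (3 * m ^ 2 + 14 * m - 1) / 4) (D := (m + 1) ^ 2 / 4)
    (q := (((m : ℚ) + 1) ^ 2 / 4) / (m ^ 2 + 4 * m)) (by push_cast; rfl) (by positivity) (by
      refine (div4 _).trans ?_
      rw [Nat.cast_sub (by nlinarith)]
      push_cast
      nlinarith)
  unfold epsE epsQ
  rw [Rat.cast_add, Rat.cast_add, Rat.cast_add]
  refine add_le_add (add_le_add (add_le_add ?_ ?_) ?_) ?_
  · rw [Rat.cast_mul]
    push_cast at h0 ⊢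
    gcongr
  · rw [Rat.cast_mul]
    push_cast at h1 ⊢
    gcongr
  · split_ifs
    · simp
    · rw [mul_assoc, Rat.cast_mul]
      push_cast at h2 ⊢
      gcongr
  · rw [Rat.cast_mul]
    push_cast at h3 ⊢
    gcongr

lemma totalB_le_of_le {m : ℕ} (hm : 3 ≤ m) (hm' : m ≤ 19) : totalB m ≤ 1.99 * (m + 2) := by
  have hm1 : (1 : ℝ) ≤ m := by exact_mod_cast (by omega : 1 ≤ m)
  have h := totalQ_le m (Finset.mem_Icc.2 ⟨hm, hm'⟩)
  have hR : ((totalQ (expQ m) m : ℚ) : ℝ) ≤ 1.99 * (m + 2) := by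
    have h' := (Rat.cast_le (K := ℝ)).2 h
    push_cast at h'
    exact h'
  refine le_trans ?_ hR
  have h4 := wX_le_wQ (m := m) (d := m ^ 2) (D := 4 * m)
    (q := (4 * (m : ℚ)) / (m ^ 2 + 4 * m)) (by push_cast; rfl) (by positivity)
    (by push_cast; linarith)
  have hs1 : ∑ k ∈ Finset.range m, rowTerm m k
      ≤ ((∑ k ∈ Finset.range m, rowQ (expQ m) m k : ℚ) : ℝ) := by
    rw [Rat.cast_sum]
    exact Finset.sum_le_sum fun k hk => rowTerm_le_rowQ (Finset.mem_range.1 hk).le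
  have hs2 : ∑ k ∈ Finset.range m, rowTerm m (k + 1)
      ≤ ((∑ k ∈ Finset.range m, rowQ (expQ m) m (k + 1) : ℚ) : ℝ) := by
    rw [Rat.cast_sum]
    exact Finset.sum_le_sum fun k hk => rowTerm_le_rowQ (Finset.mem_range.1 hk)
  have he := epsE_le_epsQ (m := m) (by omega)
  unfold totalB totalQ
  rw [Rat.cast_add, Rat.cast_add]
  refine add_le_add (add_le_add ?_ ?_) ?_
  · rw [Rat.cast_mul, Rat.cast_add]
    have e : ((70 / 69 : ℚ) : ℝ) = 70 / 69 := by norm_num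
    rw [e]
    gcongr
  · rw [Rat.cast_mul]
    have e : ((8 * (m : ℚ) ^ 3 * (m + 2) : ℚ) : ℝ) = 8 * (m : ℝ) ^ 3 * (m + 2) := by push_cast; rfl
    rw [e]
    gcongr
  · rw [Rat.cast_mul, Rat.cast_mul, ← majE_eq_majQ]
    have e : (((m / 10.8 + 0.3) / 2 + (0.867 / m + 0.29) / 2 * 0.1257 * (2 * m + 4 * m ^ 2 / 3) : ℚ) : ℝ)
        = corrC m := by unfold corrC; push_cast; rfl
    rw [e]
    have : 0 ≤ corrC m := by unfold corrC; positivity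
    gcongr

lemma le_exp_of_pow_le {a x : ℝ} {p q : ℕ} (hq : q ≠ 0) (hx : q * x = p)
    (h : a ^ q ≤ 2.7182818283 ^ p) : a ≤ Real.exp x := by
  refine le_of_pow_le_pow_left₀ hq (Real.exp_pos _).le (h.trans ?_)
  rw [← Real.exp_nat_mul, hx, ← mul_one (p : ℝ), Real.exp_nat_mul]
  gcongr
  exact Real.exp_one_gt_d9.le

lemma exp_le_of_le_pow {a x : ℝ} {p q : ℕ} (hq : q ≠ 0) (hx : q * x = p) (ha : 0 ≤ a)
    (h : 2.7182818286 ^ p ≤ a ^ q) : Real.exp x ≤ a := by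
  refine le_of_pow_le_pow_left₀ hq ha (le_trans ?_ h)
  rw [← Real.exp_nat_mul, hx, ← mul_one (p : ℝ), Real.exp_nat_mul]
  gcongr
  exact Real.exp_one_lt_d9.le

lemma exp_neg_le_of_pow_le {a x : ℝ} {p q : ℕ} (hq : q ≠ 0) (hx : q * x = p) (ha : 0 < a)
    (h : a⁻¹ ^ q ≤ 2.7182818283 ^ p) : Real.exp (-x) ≤ a := by
  rw [Real.exp_neg]
  exact inv_le_of_inv_le₀ ha (le_exp_of_pow_le hq hx h)

/-- The total exponential decay rate of `wX`. -/
noncomputable def rateC (m : ℕ) : ℝ := muC m + 11.5 / (m ^ 2 + 4 * m)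

lemma rateC_nonneg (m : ℕ) : 0 ≤ rateC m := by
  have := muC_pos m
  unfold rateC; positivity

lemma wX_sub_le {m : ℕ} {D δ : ℝ} (hD : 0 < D) (hDm : D ≤ m ^ 2 + 4 * m) (h0 : 0 ≤ δ)
    (hδ : δ ≤ D) : wX m (D - δ) ≤ wX m D * Real.exp (-(rateC m * δ)) := by
  have hP : (0 : ℝ) < m ^ 2 + 4 * m := hD.trans_le hDm
  have h1 : (D - δ) / ((m : ℝ) ^ 2 + 4 * m)
      ≤ D / ((m : ℝ) ^ 2 + 4 * m) * Real.exp (-(δ / (m ^ 2 + 4 * m))) := by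
    have h2 : (1 - δ / D) ≤ Real.exp (-(δ / (m ^ 2 + 4 * m))) := by
      have h3 := Real.add_one_le_exp (-(δ / D))
      have h4 : Real.exp (-(δ / D)) ≤ Real.exp (-(δ / (m ^ 2 + 4 * m))) := by
        apply Real.exp_le_exp.2
        have : δ / (m ^ 2 + 4 * m) ≤ δ / D := by gcongr
        linarith
      linarith
    have h5 := mul_le_mul_of_nonneg_left h2 (by positivity : 0 ≤ D / ((m : ℝ) ^ 2 + 4 * m))
    refine le_trans (le_of_eq ?_) h5
    field_simp
  have h6 : ((D - δ) / ((m : ℝ) ^ 2 + 4 * m)) ^ ((23 : ℝ) / 2)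
      ≤ (D / ((m : ℝ) ^ 2 + 4 * m)) ^ ((23 : ℝ) / 2)
        * Real.exp (-(11.5 / (m ^ 2 + 4 * m) * δ)) := by
    refine (Real.rpow_le_rpow (div_nonneg (by linarith) hP.le) h1 (by norm_num)).trans_eq ?_
    rw [Real.mul_rpow (by positivity) (Real.exp_pos _).le, ← Real.exp_mul]
    congr 2
    ring
  unfold wX rateC
  calc _ ≤ (D / ((m : ℝ) ^ 2 + 4 * m)) ^ ((23 : ℝ) / 2)
        * Real.exp (-(11.5 / (m ^ 2 + 4 * m) * δ))
        * Real.exp (-muC m * (m ^ 2 + 4 * m - (D - δ))) := by gcongr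
    _ = _ := by
      rw [mul_assoc, mul_assoc, ← Real.exp_add, ← Real.exp_add]
      congr 2
      ring

lemma wX_top {m : ℕ} (hm : 0 < m) : wX m (m ^ 2 + 4 * m) = 1 := by
  have : (m : ℝ) ^ 2 + 4 * m ≠ 0 := by positivity
  unfold wX
  rw [div_self this]; simp

lemma majE_add_two_le (k : ℕ) : (majE (k + 2) : ℝ) ≤ 324 * 10 ^ k := by
  induction k with
  | zero => norm_num [majE, Nat.choose]
  | succ k ih =>
    have h := majE_succ (k + 2)
    push_cast at h
    have hp : (0 : ℝ) < majE (k + 2) := by exact_mod_cast majE_pos _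
    have hk : (0 : ℝ) ≤ k := k.cast_nonneg
    have h2 : (majE (k + 2 + 1) : ℝ) * (k + 2 + 1) ≤ (10 * majE (k + 2)) * (k + 2 + 1) := by
      rw [h]; nlinarith
    have h3 := le_of_mul_le_mul_right h2 (by positivity)
    rw [show k + 1 + 2 = k + 2 + 1 by ring, pow_succ]
    linarith

lemma rateC_eq {m : ℕ} (hm : 0 < m) :
    rateC m = (5.44 * (m ^ 2 + 4 * m) + 11.5 * (2 * m + 9)) / ((2 * m + 9) * (m ^ 2 + 4 * m)) := by
  have : (0 : ℝ) < m := by positivity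
  unfold rateC muC
  field_simp

lemma rateC_bounds {m : ℕ} (hm : 20 ≤ m) :
    5 ≤ rateC m * (2 * m - 1) ∧ 10 ≤ rateC m * (4 * (m - 1)) ∧ 2.4 ≤ rateC m * (m - 2) := by
  have hm' : (20 : ℝ) ≤ m := by exact_mod_cast hm
  rw [rateC_eq (by omega)]
  have hpos : (0 : ℝ) < (2 * m + 9) * (m ^ 2 + 4 * m) := by positivity
  obtain ⟨u, hu⟩ : ∃ u : ℝ, (m : ℝ) = 20 + u := ⟨m - 20, by ring⟩
  have hu0 : 0 ≤ u := by linarith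
  refine ⟨?_, ?_, ?_⟩
  all_goals
    rw [div_mul_eq_mul_div, le_div_iff₀ hpos, hu, ← sub_nonneg]
    ring_nf
    positivity

lemma rowTerm_succ_le {m k : ℕ} (hm : 20 ≤ m) (hk : k < m) :
    rowTerm m (k + 1) ≤ (m + 2) * ((if k = 0 then 0.146 else 0) + 0.0163 * 0.909 ^ k) := by
  have hm' : (20 : ℝ) ≤ m := by exact_mod_cast hm
  have hk' : ((k + 1 : ℕ) : ℝ) ≤ m := by exact_mod_cast hk
  obtain ⟨b1, b2, b3⟩ := rateC_bounds hm
  have hc := rateC_nonneg m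
  set δ : ℝ := ((k + 1 : ℕ) : ℝ) * (2 * m - ((k + 1 : ℕ) : ℝ)) with hδ
  have hδ0 : 0 ≤ δ := by
    have : (0 : ℝ) ≤ ((k + 1 : ℕ) : ℝ) := Nat.cast_nonneg _
    rw [hδ]; apply mul_nonneg this; linarith
  have hw : wX m (m ^ 2 + 4 * m - δ) ≤ Real.exp (-(rateC m * δ)) := by
    have := wX_sub_le (m := m) (D := m ^ 2 + 4 * m) (δ := δ) (by positivity) le_rfl hδ0 (by
      rw [hδ]; nlinarith [sq_nonneg ((m : ℝ) - ((k + 1 : ℕ) : ℝ))])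
    rwa [wX_top (by omega), one_mul] at this
  have hexp : (majE (k + 1) : ℝ) * Real.exp (-(rateC m * δ))
      ≤ (if k = 0 then 0.146 else 0) + 0.0163 * 0.909 ^ k := by
    rcases Nat.eq_zero_or_pos k with rfl | hk0
    · have e5 : Real.exp (-5) ≤ 0.00674 :=
        exp_neg_le_of_pow_le (p := 5) (q := 1) (by norm_num) (by norm_num) (by norm_num)
          (by norm_num)
      have h1 : Real.exp (-(rateC m * δ)) ≤ Real.exp (-5) := by
        apply Real.exp_le_exp.2
        have : rateC m * δ = rateC m * (2 * m - 1) := by rw [hδ]; push_cast; ring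
        linarith
      have h2 : (majE (0 + 1) : ℝ) = 24 := by norm_num [majE, Nat.choose]
      rw [h2]
      norm_num
      linarith
    · obtain ⟨j, rfl⟩ : ∃ j, k = j + 1 := ⟨k - 1, by omega⟩
      rw [if_neg (by omega)]
      have e10 : Real.exp (-10) ≤ 0.0000455 :=
        exp_neg_le_of_pow_le (p := 10) (q := 1) (by norm_num) (by norm_num) (by norm_num)
          (by norm_num)
      have e24 : Real.exp (-2.4) ≤ 0.0909 :=
        exp_neg_le_of_pow_le (p := 12) (q := 5) (by norm_num) (by norm_num) (by norm_num)
          (by norm_num)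
      have h1 : Real.exp (-(rateC m * δ)) ≤ Real.exp (-10) * Real.exp (-2.4) ^ j := by
        rw [← Real.exp_nat_mul, ← Real.exp_add]
        apply Real.exp_le_exp.2
        have h2 : 4 * ((m : ℝ) - 1) + j * (m - 2) ≤ δ := by
          rw [hδ]
          push_cast at hk' ⊢
          have hj : (0 : ℝ) ≤ j := j.cast_nonneg
          nlinarith [mul_nonneg hj (by linarith : (0 : ℝ) ≤ m - (j + 2))]
        have h3 := mul_le_mul_of_nonneg_left h2 hc
        have h4 : (j : ℝ) * 2.4 ≤ j * (rateC m * (m - 2)) := by gcongr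
        linarith
      calc (majE (j + 1 + 1) : ℝ) * Real.exp (-(rateC m * δ))
          ≤ 324 * 10 ^ j * (0.0000455 * 0.0909 ^ j) := by
            gcongr
            · exact majE_add_two_le j
            · exact h1.trans (by gcongr)
        _ = 0.014742 * (10 * 0.0909) ^ j := by rw [mul_pow]; ring
        _ ≤ _ := by
          rw [pow_succ]
          have : (0 : ℝ) ≤ (909 / 1000) ^ j := by positivity
          norm_num
          linarith
  have hw0 : 0 ≤ wX m (m ^ 2 + 4 * m - δ) :=
    wX_nonneg m (by rw [hδ]; nlinarith [sq_nonneg ((m : ℝ) - ((k + 1 : ℕ) : ℝ))])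
  have hk0 : (0 : ℝ) ≤ ((k + 1 : ℕ) : ℝ) := Nat.cast_nonneg _
  unfold rowTerm
  rw [← hδ]
  calc _ ≤ ((m : ℝ) + 2) * majE (k + 1) * Real.exp (-(rateC m * δ)) := by
        gcongr
        linarith
    _ ≤ _ := by rw [mul_assoc]; gcongr

lemma sum_rowTerm_succ_le {m N : ℕ} (hm : 20 ≤ m) (hN : N ≤ m) :
    ∑ k ∈ Finset.range N, rowTerm m (k + 1) ≤ 0.3252 * (m + 2) := by
  have h1 : ∑ k ∈ Finset.range N, ((if k = 0 then 0.146 else 0) + 0.0163 * (0.909 : ℝ) ^ k)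
      ≤ 0.3252 := by
    rw [Finset.sum_add_distrib, ← Finset.mul_sum]
    have a1 : ∑ k ∈ Finset.range N, (if k = 0 then (0.146 : ℝ) else 0) ≤ 0.146 := by
      rw [Finset.sum_ite_eq' (Finset.range N) 0 (fun _ => (0.146 : ℝ))]
      split_ifs <;> norm_num
    have a2 : ∑ k ∈ Finset.range N, (0.909 : ℝ) ^ k ≤ (1 - 0.909)⁻¹ :=
      sum_le_hasSum _ (fun _ _ => by positivity)
        (hasSum_geometric_of_lt_one (by norm_num) (by norm_num))
    have a3 : (0.0163 : ℝ) * ∑ k ∈ Finset.range N, (0.909 : ℝ) ^ k ≤ 0.0163 * (1 - 0.909)⁻¹ := by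
      gcongr
    have a4 : (0.0163 : ℝ) * (1 - 0.909)⁻¹ ≤ 0.1792 := by norm_num
    linarith
  calc _ ≤ ∑ k ∈ Finset.range N,
        ((m : ℝ) + 2) * ((if k = 0 then 0.146 else 0) + 0.0163 * 0.909 ^ k) :=
        Finset.sum_le_sum fun k hk =>
          rowTerm_succ_le hm ((Finset.mem_range.1 hk).trans_le hN)
    _ ≤ _ := by
        rw [← Finset.mul_sum, mul_comm (0.3252 : ℝ)]
        gcongr

lemma sum_rowTerms_le {m : ℕ} (hm : 20 ≤ m) :
    ∑ k ∈ Finset.range m, rowTerm m k + ∑ k ∈ Finset.range m, rowTerm m (k + 1)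
      ≤ 1.6504 * (m + 2) := by
  have h1 := sum_rowTerm_succ_le hm le_rfl
  obtain ⟨N, rfl⟩ : ∃ N, m = N + 1 := ⟨m - 1, by omega⟩
  have h2 := sum_rowTerm_succ_le hm (Nat.le_succ N)
  have h3 : rowTerm (N + 1) 0 = ((N + 1 : ℕ) : ℝ) + 2 := by
    unfold rowTerm
    have := wX_top (m := N + 1) (by omega)
    simp only [Nat.cast_zero, zero_mul, sub_zero]
    rw [this]
    simp [majE]
  rw [Finset.sum_range_succ' (fun k => rowTerm (N + 1) k), h3]
  linarith

lemma poly_mul_pow_le {m : ℕ} (hm : 20 ≤ m) : (m : ℝ) ^ 3 * (m + 5) * 0.66 ^ m ≤ 50 := by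
  induction m, hm using Nat.le_induction with
  | base => norm_num
  | succ n hn ih =>
    have hn' : (20 : ℝ) ≤ n := by exact_mod_cast hn
    have h1 : ((n : ℝ) + 1) ^ 3 * (n + 1 + 5) * 0.66 ≤ n ^ 3 * (n + 5) := by
      obtain ⟨u, hu⟩ : ∃ u : ℝ, (n : ℝ) = 20 + u := ⟨n - 20, by ring⟩
      have hu0 : 0 ≤ u := by linarith
      rw [hu, ← sub_nonneg]
      ring_nf
      positivity
    have h2 : (0 : ℝ) ≤ 0.66 ^ n := by positivity
    push_cast
    rw [pow_succ (0.66 : ℝ) n]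
    nlinarith [mul_le_mul_of_nonneg_right h1 h2]

lemma ten_pow_mul_exp_le {m : ℕ} {y a : ℝ} (h : 2.72 * (m : ℝ) - a ≤ y) :
    (10 : ℝ) ^ m * Real.exp (-y) ≤ 0.66 ^ m * Real.exp a := by
  have e : Real.exp (-2.72) ≤ 0.066 :=
    exp_neg_le_of_pow_le (p := 68) (q := 25) (by norm_num) (by norm_num) (by norm_num)
      (by norm_num)
  have h1 : Real.exp (-y) ≤ Real.exp (-2.72) ^ m * Real.exp a := by
    rw [← Real.exp_nat_mul, ← Real.exp_add]
    exact Real.exp_le_exp.2 (by linarith)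
  calc _ ≤ (10 : ℝ) ^ m * (0.066 ^ m * Real.exp a) := by
        gcongr
        exact h1.trans (by gcongr)
    _ = _ := by
        rw [← mul_assoc, ← mul_pow]
        norm_num

lemma exp_le_small_mul_pow {m : ℕ} {y : ℝ} (hy : y ≤ 7 - 0.42 * m - 14) :
    Real.exp y ≤ 0.001 * 0.66 ^ m := by
  have e : Real.exp (-0.42) ≤ 0.66 :=
    exp_neg_le_of_pow_le (p := 21) (q := 50) (by norm_num) (by norm_num) (by norm_num)
      (by norm_num)
  have e7 : Real.exp (-7) ≤ 0.001 :=
    exp_neg_le_of_pow_le (p := 7) (q := 1) (by norm_num) (by norm_num) (by norm_num)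
      (by norm_num)
  calc Real.exp y ≤ Real.exp (-7) * Real.exp (-0.42) ^ m := by
        rw [← Real.exp_nat_mul, ← Real.exp_add]
        exact Real.exp_le_exp.2 (by linarith)
    _ ≤ _ := by gcongr

lemma rpow_le_of_le {r a b : ℝ} (hr : 0 ≤ r) (h : r ≤ a) (hb : a ≤ b ^ 2) (hb0 : 0 ≤ b) :
    r ^ ((23 : ℝ) / 2) ≤ b ^ 23 := by
  have h1 : r ≤ b ^ 2 := h.trans hb
  refine (Real.rpow_le_rpow hr h1 (by norm_num)).trans_eq ?_
  rw [← Real.rpow_natCast b 2, ← Real.rpow_mul hb0, ← Real.rpow_natCast]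
  norm_num

lemma corrC_le {m : ℕ} (hm : 20 ≤ m) : corrC m ≤ m ^ 2 := by
  have hm' : (20 : ℝ) ≤ m := by exact_mod_cast hm
  unfold corrC
  have h1 : 0.867 / (m : ℝ) ≤ 0.1 := by
    rw [div_le_iff₀ (by positivity)]; linarith
  have h2 : (0.867 / (m : ℝ) + 0.29) / 2 * 0.1257 * (2 * m + 4 * m ^ 2 / 3)
      ≤ (0.1 + 0.29) / 2 * 0.1257 * (2 * m + 4 * m ^ 2 / 3) := by gcongr
  norm_num at h2 ⊢
  nlinarith

set_option maxHeartbeats 1000000 in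
lemma totalB_le_of_ge {m : ℕ} (hm : 20 ≤ m) : totalB m ≤ 1.99 * (m + 2) := by
  have hm' : (20 : ℝ) ≤ m := by exact_mod_cast hm
  have hm0 : (0 : ℝ) < m := by linarith
  have hP := poly_mul_pow_le hm
  set y : ℝ := 0.66 ^ m with hy
  have hy0 : 0 < y := by positivity
  have hrow := sum_rowTerms_le hm
  have hμ : ∀ z : ℝ, muC m * z = 5.44 * z / (2 * m + 9) := fun z => by unfold muC; ring
  have h9 : (0 : ℝ) < 2 * m + 9 := by positivity
  have a0 : (10 : ℝ) ^ m * Real.exp (-muC m * (m ^ 2 + 4 * m)) ≤ y * 3.9 := by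
    have h1 := ten_pow_mul_exp_le (m := m) (a := 1.36) (y := muC m * (m ^ 2 + 4 * m)) (by
      rw [hμ, le_div_iff₀ h9]; nlinarith)
    have h2 : Real.exp 1.36 ≤ 3.9 :=
      exp_le_of_le_pow (p := 34) (q := 25) (by norm_num) (by norm_num) (by norm_num) (by norm_num)
    rw [neg_mul]
    exact h1.trans (by gcongr)
  have a2 : (10 : ℝ) ^ m * Real.exp (-muC m * m ^ 2) ≤ y * 207000 := by
    have h1 := ten_pow_mul_exp_le (m := m) (a := 12.24) (y := muC m * m ^ 2) (by
      rw [hμ, le_div_iff₀ h9]; nlinarith)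
    have h2 : Real.exp 12.24 ≤ 207000 := by
      have h3 : Real.exp 12 ≤ 162755 :=
        exp_le_of_le_pow (p := 12) (q := 1) (by norm_num) (by norm_num) (by norm_num)
          (by norm_num)
      have h4 : Real.exp 0.24 ≤ 1.2713 :=
        exp_le_of_le_pow (p := 6) (q := 25) (by norm_num) (by norm_num) (by norm_num)
          (by norm_num)
      calc Real.exp 12.24 = Real.exp 12 * Real.exp 0.24 := by rw [← Real.exp_add]; norm_num
        _ ≤ 162755 * 1.2713 := by gcongr
        _ ≤ 207000 := by norm_num
    rw [neg_mul]
    exact h1.trans (by gcongr)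
  have hrate : 2.04 * (m : ℝ) - 5.1 ≤ muC m * (3 * (m + 3) * (m - 1) / 4) := by
    rw [hμ, le_div_iff₀ h9]; nlinarith
  have hDm : (0 : ℝ) < m ^ 2 + 4 * m := by positivity
  have a1 : wX m ((m + 1) * (m + 9) / 4) ≤ 0.7072 ^ 23 * (0.001 * y) := by
    unfold wX
    have h1 := rpow_le_of_le (r := ((m : ℝ) + 1) * (m + 9) / 4 / (m ^ 2 + 4 * m)) (a := 1 / 2)
      (b := 0.7072) (by positivity) (by rw [div_le_iff₀ hDm]; nlinarith) (by norm_num) (by norm_num)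
    have h2 : Real.exp (-muC m * (m ^ 2 + 4 * m - (m + 1) * (m + 9) / 4)) ≤ 0.001 * y := by
      apply exp_le_small_mul_pow
      have : (m : ℝ) ^ 2 + 4 * m - (m + 1) * (m + 9) / 4 = 3 * (m + 3) * (m - 1) / 4 := by ring
      rw [this]
      linarith
    gcongr
  have a3 : (9 / 5 : ℝ) ^ m * wX m ((m + 1) ^ 2 / 4) ≤ 0.001 * y * 0.55 ^ 23 := by
    unfold wX
    have h1 := rpow_le_of_le (r := ((m : ℝ) + 1) ^ 2 / 4 / (m ^ 2 + 4 * m)) (a := 1 / 4)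
      (b := 0.55) (by positivity) (by rw [div_le_iff₀ hDm]; nlinarith) (by norm_num) (by norm_num)
    have h0 : (9 / 5 : ℝ) ≤ Real.exp 0.6 :=
      le_exp_of_pow_le (p := 3) (q := 5) (by norm_num) (by norm_num) (by norm_num)
    have h2 : (9 / 5 : ℝ) ^ m * Real.exp (-muC m * (m ^ 2 + 4 * m - (m + 1) ^ 2 / 4))
        ≤ 0.001 * y := by
      refine le_trans (mul_le_mul_of_nonneg_right (pow_le_pow_left₀ (by norm_num) h0 m)
        (Real.exp_pos _).le) ?_
      rw [← Real.exp_nat_mul, ← Real.exp_add]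
      apply exp_le_small_mul_pow
      have h3 : 3 * ((m : ℝ) + 3) * (m - 1) / 4 ≤ m ^ 2 + 4 * m - (m + 1) ^ 2 / 4 := by nlinarith
      have h4 := mul_le_mul_of_nonneg_left h3 (muC_pos m).le
      linarith
    calc _ = ((9 / 5 : ℝ) ^ m * Real.exp (-muC m * (m ^ 2 + 4 * m - (m + 1) ^ 2 / 4)))
          * ((((m : ℝ) + 1) ^ 2 / 4 / (m ^ 2 + 4 * m)) ^ ((23 : ℝ) / 2)) := by ring
      _ ≤ _ := by gcongr
  have b0 : (m + 2 : ℝ) / 2 * 32.4 ^ 2 * (1 / 2) ^ 23 * 10 ^ m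
      * Real.exp (-muC m * (m ^ 2 + 4 * m)) ≤ (m + 5) * y * 0.000245 := by
    calc _ = (m + 2 : ℝ) / 2 * 32.4 ^ 2 * (1 / 2) ^ 23 *
          (10 ^ m * Real.exp (-muC m * (m ^ 2 + 4 * m))) := by ring
      _ ≤ (m + 5 : ℝ) / 2 * 32.4 ^ 2 * (1 / 2) ^ 23 * (y * 3.9) := by gcongr; norm_num
      _ ≤ _ := by
        have : 0 ≤ (m + 5) * y := by positivity
        nlinarith
  have b1 : (m + 5 : ℝ) / 2 * wX m ((m + 1) * (m + 9) / 4) ≤ (m + 5) * y * 0.000001 := by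
    have : 0 ≤ (m + 5) * y := by positivity
    calc _ ≤ (m + 5 : ℝ) / 2 * (0.7072 ^ 23 * (0.001 * y)) := by gcongr
      _ ≤ _ := by nlinarith
  have b2 : (m + 4 : ℝ) / 2 * 32.4 * (10 ^ m / 10 ^ 4) * ((m + 4) / (4 * m)) ^ ((23 : ℝ) / 2)
      * Real.exp (-muC m * m ^ 2) ≤ (m + 5) * y * 0.00033 := by
    have h1 := rpow_le_of_le (r := ((m : ℝ) + 4) / (4 * m)) (a := 0.3) (b := 0.548)
      (by positivity) (by rw [div_le_iff₀ (by positivity)]; linarith) (by norm_num) (by norm_num)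
    have : 0 ≤ (m + 5) * y := by positivity
    calc _ = (m + 4 : ℝ) / 2 * 32.4 * (1 / 10 ^ 4) * ((m + 4) / (4 * m)) ^ ((23 : ℝ) / 2)
          * (10 ^ m * Real.exp (-muC m * m ^ 2)) := by ring
      _ ≤ (m + 5 : ℝ) / 2 * 32.4 * (1 / 10 ^ 4) * 0.548 ^ 23 * (y * 207000) := by
        gcongr; norm_num
      _ ≤ _ := by nlinarith
  have hw := wX_nonneg m (D := ((m : ℝ) + 1) ^ 2 / 4) (by positivity)
  have b3 : (m + 1 : ℝ) / 2 * 32.4 * (9 / 5) ^ m * wX m ((m + 1) ^ 2 / 4)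
      ≤ (m + 5) * y * 0.000001 := by
    have : 0 ≤ (m + 5) * y := by positivity
    calc _ = (m + 1 : ℝ) / 2 * 32.4 * ((9 / 5) ^ m * wX m ((m + 1) ^ 2 / 4)) := by ring
      _ ≤ (m + 5 : ℝ) / 2 * 32.4 * (0.001 * y * 0.55 ^ 23) := by
        gcongr
        norm_num
      _ ≤ _ := by nlinarith
  have hE : epsE m ≤ (m + 5) * y * 0.000577 := by
    unfold epsE
    rw [if_neg (by omega)]
    linarith
  have hθ : majE (m + 1) * wX m (4 * m) * corrC m ≤ 0.01 * (m + 2) := by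
    have h1 := rpow_le_of_le (r := 4 * (m : ℝ) / (m ^ 2 + 4 * m)) (a := 1 / 6) (b := 0.409)
      (by positivity) (by rw [div_le_iff₀ hDm]; nlinarith) (by norm_num) (by norm_num)
    have h2 : m ^ 2 * y ≤ 0.1 := by
      have : m ^ 2 * y * 500 ≤ m ^ 3 * (m + 5) * y := by
        have h5 : (500 : ℝ) ≤ m * (m + 5) := by nlinarith
        calc m ^ 2 * y * 500 ≤ m ^ 2 * y * (m * (m + 5)) := by gcongr
          _ = _ := by ring
      linarith
    have h3 := majE_succ_le_ten_pow m
    have h4 : (0 : ℝ) ≤ corrC m := by unfold corrC; positivity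
    calc _ ≤ 32.4 * 10 ^ m * wX m (4 * m) * m ^ 2 := by
          have := wX_nonneg m (D := 4 * m) (by positivity)
          gcongr
          exact corrC_le hm
      _ = 32.4 * (4 * (m : ℝ) / (m ^ 2 + 4 * m)) ^ ((23 : ℝ) / 2) *
          (10 ^ m * Real.exp (-muC m * m ^ 2)) * m ^ 2 := by
        unfold wX
        rw [show (m : ℝ) ^ 2 + 4 * m - 4 * m = m ^ 2 by ring]
        ring
      _ ≤ 32.4 * 0.409 ^ 23 * (y * 207000) * m ^ 2 := by gcongr
      _ = 32.4 * 0.409 ^ 23 * 207000 * (m ^ 2 * y) := by ring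
      _ ≤ 32.4 * 0.409 ^ 23 * 207000 * 0.1 := by gcongr
      _ ≤ 0.01 * (0 + 2) := by norm_num
      _ ≤ _ := by gcongr
  have hE' : 8 * (m : ℝ) ^ 3 * (m + 2) * epsE m ≤ 0.2308 * (m + 2) := by
    calc _ ≤ 8 * (m : ℝ) ^ 3 * (m + 2) * ((m + 5) * y * 0.000577) := by gcongr
      _ = 8 * (m + 2) * 0.000577 * (m ^ 3 * (m + 5) * y) := by ring
      _ ≤ 8 * (m + 2) * 0.000577 * 50 := by gcongr
      _ = _ := by ring
  unfold totalB
  linarith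

/-- The combined error budget stays below twice the leading term. -/
lemma totalB_le {m : ℕ} (hm : 3 ≤ m) : totalB m ≤ 1.99 * (m + 2) := by
  rcases le_or_gt m 19 with h | h
  · exact totalB_le_of_le hm h
  · exact totalB_le_of_ge h

lemma majE_add_le (k j : ℕ) : (majE (k + j) : ℝ) ≤ 24 ^ j * majE k := by
  induction j with
  | zero => simp
  | succ j ih =>
    have h : (majE (k + j + 1) : ℝ) ≤ 24 * majE (k + j) := by exact_mod_cast majE_succ_le (k + j)
    rw [← add_assoc, pow_succ]
    linarith

lemma exp_neg_rateC_le {m : ℕ} (hm : 0 < m) :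
    576 * Real.exp (-(rateC m * (4 * m))) ≤ 1 / 70 := by
  have hm' : (0 : ℝ) < m := by exact_mod_cast hm
  have h1 : 10.7 ≤ rateC m * (4 * m) := by
    have : rateC m * (4 * m) = (21.76 * m * (m + 4) + 46 * (2 * m + 9)) / ((2 * m + 9) * (m + 4)) := by
      unfold rateC muC
      field_simp
      ring
    rw [this, le_div_iff₀ (by positivity)]
    nlinarith [sq_nonneg ((m : ℝ) - 4)]
  have h2 : Real.exp (-10.7) ≤ 1 / 40320 :=
    exp_neg_le_of_pow_le (p := 107) (q := 10) (by norm_num) (by norm_num) (by norm_num)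
      (by norm_num)
  have h3 := Real.exp_le_exp.2 (neg_le_neg h1)
  linarith

/-- The leading contribution to a polar coefficient decays geometrically along a row. -/
lemma base_le_rowTerm {m : ℕ} {j a : ℕ} (hm : 3 ≤ m) (ham : a ≤ m)
    (hD : 4 * (m : ℝ) * j < a ^ 2 + 4 * m) :
    ((a : ℝ) + 2 - 2 * j) * majE j * majE (m - a + j) * wX m (a ^ 2 + 4 * m - 4 * m * j)
      ≤ rowTerm m (m - a) * (1 / 70) ^ j := by
  have hm' : (3 : ℝ) ≤ m := by exact_mod_cast hm
  have hm0 : (0 : ℝ) < m := by linarith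
  have ha : (a : ℝ) ≤ m := by exact_mod_cast ham
  have h1 := wX_sub_le (m := m) (D := a ^ 2 + 4 * m) (δ := 4 * m * j) (by positivity)
    (by nlinarith [Nat.cast_nonneg (α := ℝ) a]) (by positivity) hD.le
  have h2 : (majE j : ℝ) ≤ 24 ^ j := by
    have := majE_add_le 0 j
    simpa [majE] using this
  have h3 := majE_add_le (m - a) j
  have hw := wX_nonneg m (D := (a : ℝ) ^ 2 + 4 * m) (by positivity)
  have hw' := wX_nonneg m (D := (a : ℝ) ^ 2 + 4 * m - 4 * m * j) (by linarith)
  have hq : (576 * Real.exp (-(rateC m * (4 * m)))) ^ j ≤ (1 / 70) ^ j :=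
    pow_le_pow_left₀ (by positivity) (exp_neg_rateC_le (by omega)) j
  have hrow : rowTerm m (m - a) = (a + 2) * majE (m - a) * wX m (a ^ 2 + 4 * m) := by
    unfold rowTerm
    rw [Nat.cast_sub ham]
    congr 2
    · ring
    · ring
  calc _ ≤ ((a : ℝ) + 2) * 24 ^ j * (24 ^ j * majE (m - a)) *
        (wX m (a ^ 2 + 4 * m) * Real.exp (-(rateC m * (4 * m * j)))) := by
        gcongr
        linarith [Nat.cast_nonneg (α := ℝ) j]
    _ = (a + 2) * majE (m - a) * wX m (a ^ 2 + 4 * m) *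
        (576 * Real.exp (-(rateC m * (4 * m)))) ^ j := by
        rw [mul_pow, ← Real.exp_nat_mul, show (576 : ℝ) = 24 * 24 by norm_num, mul_pow,
          show (j : ℝ) * -(rateC m * (4 * m)) = -(rateC m * (4 * m * j)) by ring]
        ring
    _ ≤ _ := by
        rw [hrow]
        gcongr

lemma sum_geometric_Icc_le (m : ℕ) :
    ∑ nt ∈ Finset.Icc (-1 : ℤ) m, (1 / 70 : ℝ) ^ (nt + 1).toNat ≤ 70 / 69 := by
  have h : ∑ nt ∈ Finset.Icc (-1 : ℤ) m, (1 / 70 : ℝ) ^ (nt + 1).toNat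
      = ∑ j ∈ Finset.range (m + 2), (1 / 70 : ℝ) ^ j := by
    refine Finset.sum_nbij' (fun nt => (nt + 1).toNat) (fun j => (j : ℤ) - 1) ?_ ?_ ?_ ?_ ?_ <;>
      intro x hx <;> simp at hx ⊢ <;> omega
  rw [h, geom_sum_eq (by norm_num)]
  have : (0 : ℝ) ≤ (1 / 70) ^ (m + 2) := by positivity
  rw [div_le_iff_of_neg (by norm_num)]
  linarith

lemma polar_row_le {m : ℕ} (hm : 3 ≤ m) {l : ℤ} (hl : |l| ≤ m) :
    ∑ nt ∈ (Finset.Icc (-1 : ℤ) m).filter (fun nt => 4 * (m : ℤ) * nt - l ^ 2 < 0),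
        (polarCoef m nt |l| : ℝ) * wX m ((l ^ 2 - 4 * m * nt : ℤ) : ℝ)
      ≤ 70 / 69 * rowTerm m (m - l.natAbs) + 4 * m ^ 2 * (m + 2) * epsE m := by
  have habs : |l| = (l.natAbs : ℤ) := Int.abs_eq_natAbs l
  have ham : l.natAbs ≤ m := by rw [habs] at hl; exact_mod_cast hl
  have hrow0 : 0 ≤ rowTerm m (m - l.natAbs) := by
    have h := base_le_rowTerm (m := m) (j := 0) (a := l.natAbs) hm ham (by
      have : (0 : ℝ) < m := by exact_mod_cast (by omega : 0 < m)
      simp; positivity)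
    have := wX_nonneg m (D := (l.natAbs : ℝ) ^ 2 + 4 * m) (by positivity)
    refine le_trans ?_ (h.trans_eq (by simp))
    simp only [Nat.cast_zero, mul_zero, sub_zero]
    positivity
  have heps : 0 ≤ 4 * (m : ℝ) ^ 2 * epsE m := by
    have := epsE_nonneg m
    positivity
  have key : ∀ nt ∈ (Finset.Icc (-1 : ℤ) m).filter (fun nt => 4 * (m : ℤ) * nt - l ^ 2 < 0),
      (polarCoef m nt |l| : ℝ) * wX m ((l ^ 2 - 4 * m * nt : ℤ) : ℝ)
        ≤ rowTerm m (m - l.natAbs) * (1 / 70) ^ (nt + 1).toNat + 4 * m ^ 2 * epsE m := by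
    intro nt hnt
    rw [Finset.mem_filter, Finset.mem_Icc] at hnt
    obtain ⟨⟨hnt1, -⟩, hD⟩ := hnt
    have hD' : 4 * (m : ℤ) * nt - |l| ^ 2 < 0 := by rw [sq_abs]; exact hD
    have h1 := polarCoef_weight_bound hm hnt1 (abs_nonneg l) hl hD'
    rw [sq_abs] at h1
    refine h1.trans (add_le_add ?_ le_rfl)
    obtain ⟨j, hj⟩ : ∃ j : ℕ, nt + 1 = j := ⟨(nt + 1).toNat, by omega⟩
    have hjt : nt = (j : ℤ) - 1 := by omega
    have hl2 : ((l : ℤ) : ℝ) ^ 2 = (l.natAbs : ℝ) ^ 2 := by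
      rw [← Int.cast_natCast, ← habs, Int.cast_abs, sq_abs]
    have h2 := base_le_rowTerm (m := m) (j := j) (a := l.natAbs) hm ham (by
      rw [hjt] at hD
      have : ((4 * (m : ℤ) * (j - 1) - l ^ 2 : ℤ) : ℝ) < 0 := by exact_mod_cast hD
      push_cast at this
      linarith)
    have e1 : (nt + 1).toNat = j := by omega
    have e2 : (nt + m - |l| + 1).toNat = m - l.natAbs + j := by omega
    rw [e1, e2, habs, hjt]
    refine le_of_eq_of_le ?_ h2
    have hla : |(l : ℝ)| = (l.natAbs : ℝ) := by
      rw [← Int.cast_natCast, ← habs, Int.cast_abs]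
    push_cast
    rw [hl2, hla]
    congr 2
    · ring
    · ring
  refine (Finset.sum_le_sum key).trans ?_
  refine (Finset.sum_le_sum_of_subset_of_nonneg (Finset.filter_subset _ _)
    (fun _ _ _ => by positivity)).trans ?_
  rw [Finset.sum_add_distrib, ← Finset.mul_sum, Finset.sum_const, Int.card_Icc]
  have h3 := mul_le_mul_of_nonneg_left (sum_geometric_Icc_le m) hrow0
  have h4 : ((((m : ℤ) + 1 - -1).toNat : ℕ) : ℝ) = m + 2 := by
    have : ((m : ℤ) + 1 - -1).toNat = m + 2 := by omega
    rw [this]; push_cast; ring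
  rw [nsmul_eq_mul, h4]
  linarith

lemma sum_Icc_natAbs (m : ℕ) (f : ℕ → ℝ) :
    ∑ l ∈ Finset.Icc (-(m : ℤ) + 1) m, f (m - l.natAbs)
      = ∑ k ∈ Finset.range m, f k + ∑ k ∈ Finset.range m, f (k + 1) := by
  rw [← Finset.sum_filter_add_sum_filter_not _ (fun l => 0 < l)]
  congr 1
  · refine Finset.sum_nbij' (fun l => m - l.natAbs) (fun k => (m : ℤ) - k) ?_ ?_ ?_ ?_ ?_ <;>
      intro x hx <;> simp at hx ⊢ <;> omega
  · refine Finset.sum_nbij' (fun l => m - l.natAbs - 1) (fun k => (k : ℤ) + 1 - m) ?_ ?_ ?_ ?_ ?_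
    any_goals (intro x hx; simp at hx ⊢; omega)
    intro x hx
    simp at hx
    congr 1
    omega

lemma polar_sum_le {m : ℕ} (hm : 3 ≤ m) :
    ∑ l ∈ Finset.Icc (-(m : ℤ) + 1) m,
      ∑ nt ∈ (Finset.Icc (-1 : ℤ) m).filter (fun nt => 4 * (m : ℤ) * nt - l ^ 2 < 0),
        (polarCoef m nt |l| : ℝ) * wX m ((l ^ 2 - 4 * m * nt : ℤ) : ℝ)
      ≤ 70 / 69 * (∑ k ∈ Finset.range m, rowTerm m k + ∑ k ∈ Finset.range m, rowTerm m (k + 1))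
        + 8 * m ^ 3 * (m + 2) * epsE m := by
  refine (Finset.sum_le_sum (fun l hl => polar_row_le hm (l := l) ?_)).trans ?_
  · rw [Finset.mem_Icc] at hl
    exact abs_le.2 ⟨by omega, hl.2⟩
  · rw [Finset.sum_add_distrib, ← Finset.mul_sum, sum_Icc_natAbs m (rowTerm m), Finset.sum_const,
      Int.card_Icc]
    have : ((m : ℤ) + 1 - (-m + 1)).toNat = 2 * m := by omega
    rw [this, nsmul_eq_mul]
    push_cast
    exact le_of_eq (by ring)

/-- The size of the leading Bessel factor, attained at `D = m² + 4m`. -/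
noncomputable def leadC (m : ℕ) (Δ : ℝ) : ℝ :=
  (π * (m ^ 2 + 4 * m) / (2 * m)) ^ ((23 : ℝ) / 2) *
    besselF (23 / 2) (π ^ 2 * Δ / (4 * m ^ 2) * (m ^ 2 + 4 * m))

lemma leadC_pos {m : ℕ} (hm : 0 < m) {Δ : ℝ} (hΔ : 0 ≤ Δ) : 0 < leadC m Δ := by
  have hm' : (0 : ℝ) < m := by exact_mod_cast hm
  have := besselF_pos (ν := 23 / 2) (y := π ^ 2 * Δ / (4 * m ^ 2) * (m ^ 2 + 4 * m))
    (by norm_num) (by positivity)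
  unfold leadC
  positivity

lemma muC_growth_condition {m : ℕ} (hm : 3 ≤ m) :
    (m ^ 2 + 4 * m) * muC m ^ 2 + (23 / 2 + 1) * muC m ≤ 7.4 := by
  have hm' : (3 : ℝ) ≤ m := by exact_mod_cast hm
  have : ((m : ℝ) ^ 2 + 4 * m) * muC m ^ 2 + (23 / 2 + 1) * muC m
      = ((m ^ 2 + 4 * m) * 5.44 ^ 2 + 68 * (2 * m + 9)) / (2 * m + 9) ^ 2 := by
    unfold muC
    field_simp
    ring
  rw [this, div_le_iff₀ (by positivity)]
  nlinarith

lemma rpow_mul_besselF_le {m : ℕ} (hm : 3 ≤ m) {Δ D : ℝ} (hΔ : 3 * m ^ 2 ≤ Δ) (hD : 0 ≤ D)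
    (hDm : D ≤ m ^ 2 + 4 * m) :
    (π * D / (2 * m)) ^ ((23 : ℝ) / 2) * besselF (23 / 2) (π ^ 2 * Δ / (4 * m ^ 2) * D)
      ≤ leadC m Δ * wX m D := by
  have hm' : (3 : ℝ) ≤ m := by exact_mod_cast hm
  have hm0 : (0 : ℝ) < m := by linarith
  have hΔ0 : 0 < Δ := lt_of_lt_of_le (by positivity) hΔ
  set w := π ^ 2 * Δ / (4 * m ^ 2) with hw
  have hw0 : 0 < w := by positivity
  have hw1 : 7.4 ≤ w := by
    rw [hw, le_div_iff₀ (by positivity)]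
    have : 9.869 ≤ π ^ 2 := by nlinarith [Real.pi_gt_d4]
    nlinarith
  have hμ := muC_pos m
  have hg := besselF_growth (ν := 23 / 2) (x := w * D) (y := w * (m ^ 2 + 4 * m)) (ρ := muC m / w)
    (by norm_num) (by positivity) (by gcongr) (by positivity) (by
      have : w * (m ^ 2 + 4 * m) * (muC m / w) ^ 2 + (23 / 2 + 1) * (muC m / w)
          = ((m ^ 2 + 4 * m) * muC m ^ 2 + (23 / 2 + 1) * muC m) / w := by
        field_simp
      rw [this, div_le_one hw0]
      exact (muC_growth_condition hm).trans hw1)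
  have he : muC m / w * (w * (m ^ 2 + 4 * m) - w * D) = muC m * (m ^ 2 + 4 * m - D) := by
    field_simp
  rw [he] at hg
  have hg' : besselF (23 / 2) (w * D) ≤
      Real.exp (-muC m * (m ^ 2 + 4 * m - D)) * besselF (23 / 2) (w * (m ^ 2 + 4 * m)) := by
    rw [neg_mul, Real.exp_neg, ← div_eq_inv_mul, le_div_iff₀ (Real.exp_pos _), mul_comm]
    exact hg
  have hsplit : (π * D / (2 * m)) ^ ((23 : ℝ) / 2)
      = (π * (m ^ 2 + 4 * m) / (2 * m)) ^ ((23 : ℝ) / 2)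
        * (D / (m ^ 2 + 4 * m)) ^ ((23 : ℝ) / 2) := by
    rw [← Real.mul_rpow (by positivity) (by positivity)]
    congr 1
    field_simp
  rw [hsplit]
  unfold leadC wX
  calc _ ≤ (π * (m ^ 2 + 4 * m) / (2 * m)) ^ ((23 : ℝ) / 2)
        * (D / (m ^ 2 + 4 * m)) ^ ((23 : ℝ) / 2) *
        (Real.exp (-muC m * (m ^ 2 + 4 * m - D)) * besselF (23 / 2) (w * (m ^ 2 + 4 * m))) := by
        gcongr
    _ = _ := by rw [← hw]; ring

/-- The Bessel factor of a polar term, rewritten through `besselF`. -/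
lemma polar_bessel_eq {m γ : ℕ} (hm : 0 < m) (hγ : 0 < γ) {Δ D : ℝ} (hΔ : 0 < Δ) (hD : 0 ≤ D) :
    (D / Δ) ^ ((23 : ℝ) / 4) * besselI (23 / 2) (π * √(Δ * D) / (γ * m))
      = (π * D / (2 * m) / γ) ^ ((23 : ℝ) / 2) *
        besselF (23 / 2) (π ^ 2 * Δ / (4 * m ^ 2) * D / γ ^ 2) := by
  have hm' : (0 : ℝ) < m := by exact_mod_cast hm
  have hγ' : (0 : ℝ) < γ := by exact_mod_cast hγ
  have hs : √(Δ * D) ^ 2 = Δ * D := Real.sq_sqrt (by positivity)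
  have h := rpow_mul_besselI (ν := 23 / 2) (a := D / Δ) (b := π * D / (2 * m) / γ)
    (z := π * √(Δ * D) / (γ * m)) (by norm_num) (by positivity) (by positivity) (by positivity) (by
      rw [div_pow, div_pow, mul_pow, hs]
      field_simp)
  rw [show (23 / 2 / 2 : ℝ) = 23 / 4 by norm_num] at h
  rw [h]
  congr 2
  rw [div_pow, mul_pow, hs]
  field_simp

lemma polar_bessel_le {m γ : ℕ} (hm : 3 ≤ m) (hγ : 0 < γ) {Δ D : ℝ} (hΔ : 3 * m ^ 2 ≤ Δ)
    (hD : 0 ≤ D) (hDm : D ≤ m ^ 2 + 4 * m) :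
    (D / Δ) ^ ((23 : ℝ) / 4) * besselI (23 / 2) (π * √(Δ * D) / (γ * m))
      ≤ ((γ : ℝ) ^ ((23 : ℝ) / 2))⁻¹ * (leadC m Δ * wX m D) := by
  have hm' : (3 : ℝ) ≤ m := by exact_mod_cast hm
  have hm0 : (0 : ℝ) < m := by linarith
  have hγ' : (1 : ℝ) ≤ γ := by exact_mod_cast hγ
  have hΔ0 : 0 < Δ := lt_of_lt_of_le (by positivity) hΔ
  rw [polar_bessel_eq (by omega) hγ hΔ0 hD, Real.div_rpow (by positivity) (by positivity)]
  have h1 : besselF (23 / 2) (π ^ 2 * Δ / (4 * m ^ 2) * D / γ ^ 2)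
      ≤ besselF (23 / 2) (π ^ 2 * Δ / (4 * m ^ 2) * D) :=
    besselF_mono (by norm_num) (by positivity)
      (div_le_self (by positivity) (one_le_pow₀ hγ'))
  have h2 := rpow_mul_besselF_le hm hΔ hD hDm
  calc _ = ((γ : ℝ) ^ ((23 : ℝ) / 2))⁻¹ * ((π * D / (2 * m)) ^ ((23 : ℝ) / 2) *
        besselF (23 / 2) (π ^ 2 * Δ / (4 * m ^ 2) * D / γ ^ 2)) := by ring
    _ ≤ ((γ : ℝ) ^ ((23 : ℝ) / 2))⁻¹ * ((π * D / (2 * m)) ^ ((23 : ℝ) / 2) *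
        besselF (23 / 2) (π ^ 2 * Δ / (4 * m ^ 2) * D)) := by gcongr
    _ ≤ _ := by gcongr

lemma rpow_two_pi_mul_besselF_le {m : ℕ} (hm : 3 ≤ m) {Δ : ℝ} (hΔ : 3 * m ^ 2 ≤ Δ) :
    (2 * π) ^ ((23 : ℝ) / 2) * besselF (23 / 2) (π ^ 2 * Δ / m)
      ≤ leadC m Δ * wX m (4 * m) := by
  have hm0 : (0 : ℝ) < m := by exact_mod_cast (by omega : 0 < m)
  have h := rpow_mul_besselF_le hm hΔ (D := 4 * m) (by positivity) (by nlinarith)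
  have e1 : π * (4 * m) / (2 * m) = 2 * π := by field_simp; ring
  have e2 : π ^ 2 * Δ / (4 * m ^ 2) * (4 * m) = π ^ 2 * Δ / m := by field_simp
  rwa [e1, e2] at h

/-- The Bessel factor of the middle term. -/
lemma middle_bessel_le {m γ : ℕ} (hm : 3 ≤ m) (hγ : 0 < γ) {Δ : ℝ} (hΔ : 3 * m ^ 2 ≤ Δ) :
    (4 * (m : ℝ) / Δ) ^ 6 * besselI 12 (2 * π * √(Δ / m) / γ)
      ≤ ((γ : ℝ) ^ 12)⁻¹ * (√(2 * π) / √12 * (leadC m Δ * wX m (4 * m))) := by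
  have hm0 : (0 : ℝ) < m := by exact_mod_cast (by omega : 0 < m)
  have hγ' : (1 : ℝ) ≤ γ := by exact_mod_cast hγ
  have hΔ0 : 0 < Δ := lt_of_lt_of_le (by positivity) hΔ
  have hs : √(Δ / m) ^ 2 = Δ / m := Real.sq_sqrt (by positivity)
  have h := rpow_mul_besselI (ν := 12) (a := 4 * (m : ℝ) / Δ) (b := 2 * π / γ)
    (z := 2 * π * √(Δ / m) / γ) (by norm_num) (by positivity) (by positivity) (by positivity) (by
      rw [div_pow, div_pow, mul_pow, hs]
      field_simp
      norm_num)
  rw [show (12 / 2 : ℝ) = ((6 : ℕ) : ℝ) by norm_num, Real.rpow_natCast] at h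
  rw [h, show (2 * π * √(Δ / m) / γ) ^ 2 / 4 = π ^ 2 * Δ / m / γ ^ 2 by
    rw [div_pow, mul_pow, hs]; ring]
  have h1 : besselF 12 (π ^ 2 * Δ / m / γ ^ 2) ≤ besselF 12 (π ^ 2 * Δ / m) :=
    besselF_mono (by norm_num) (by positivity) (div_le_self (by positivity) (one_le_pow₀ hγ'))
  have h2 := besselF_add_half_le (ν := 23 / 2) (y := π ^ 2 * Δ / m) (by norm_num) (by positivity)
  rw [show (23 / 2 + 1 / 2 : ℝ) = 12 by norm_num] at h2
  have h3 := rpow_two_pi_mul_besselF_le hm hΔ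
  have h4 : (2 * π) ^ (12 : ℝ) = √(2 * π) * (2 * π) ^ ((23 : ℝ) / 2) := by
    rw [Real.sqrt_eq_rpow, ← Real.rpow_add (by positivity)]
    norm_num
  have h5 : (2 * π / (γ : ℝ)) ^ (12 : ℝ) = ((γ : ℝ) ^ 12)⁻¹ * (√(2 * π) * (2 * π) ^ ((23 : ℝ) / 2)) := by
    rw [Real.div_rpow (by positivity) (by positivity), h4,
      show (12 : ℝ) = ((12 : ℕ) : ℝ) by norm_num, Real.rpow_natCast]
    ring
  rw [h5]
  calc _ ≤ ((γ : ℝ) ^ 12)⁻¹ * (√(2 * π) * (2 * π) ^ ((23 : ℝ) / 2)) *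
        (besselF (23 / 2) (π ^ 2 * Δ / m) / √12) := by
        gcongr
        exact h1.trans h2
    _ = ((γ : ℝ) ^ 12)⁻¹ * (√(2 * π) / √12 * ((2 * π) ^ ((23 : ℝ) / 2) *
        besselF (23 / 2) (π ^ 2 * Δ / m))) := by ring
    _ ≤ _ := by gcongr

/-- The Bessel factor bounding the integral terms. -/
lemma integral_bessel_le {m γ : ℕ} (hm : 3 ≤ m) (hγ : 0 < γ) {Δ : ℝ} (hΔ : 3 * m ^ 2 ≤ Δ) :
    (2 * π / γ) ^ ((25 : ℝ) / 2) * besselF (25 / 2) (π ^ 2 * Δ / m)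
      ≤ ((γ : ℝ) ^ ((25 : ℝ) / 2))⁻¹ * (2 * π / (25 / 2) * (leadC m Δ * wX m (4 * m))) := by
  have hm0 : (0 : ℝ) < m := by exact_mod_cast (by omega : 0 < m)
  have hγ' : (1 : ℝ) ≤ γ := by exact_mod_cast hγ
  have hΔ0 : 0 < Δ := lt_of_lt_of_le (by positivity) hΔ
  have h2 := besselF_add_one_le (ν := 23 / 2) (y := π ^ 2 * Δ / m) (by norm_num) (by positivity)
  rw [show (23 / 2 + 1 : ℝ) = 25 / 2 by norm_num] at h2
  have h3 := rpow_two_pi_mul_besselF_le hm hΔ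
  have h4 : (2 * π) ^ ((25 : ℝ) / 2) = 2 * π * (2 * π) ^ ((23 : ℝ) / 2) := by
    rw [show (25 : ℝ) / 2 = 1 + 23 / 2 by norm_num, Real.rpow_add (by positivity), Real.rpow_one]
  rw [Real.div_rpow (by positivity) (by positivity), h4]
  calc _ ≤ 2 * π * (2 * π) ^ ((23 : ℝ) / 2) / (γ : ℝ) ^ ((25 : ℝ) / 2) *
        (besselF (23 / 2) (π ^ 2 * Δ / m) / (25 / 2)) := by gcongr
    _ = ((γ : ℝ) ^ ((25 : ℝ) / 2))⁻¹ * (2 * π / (25 / 2) * ((2 * π) ^ ((23 : ℝ) / 2) *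
        besselF (23 / 2) (π ^ 2 * Δ / m))) := by ring
    _ ≤ _ := by gcongr

/-- A single polar contribution to `Sgamma`. -/
noncomputable def polarT (m : ℕ) (Δ ℓ : ℤ) (γ : ℕ) (l nt : ℤ) : ℂ :=
  ((2 * π : ℝ) : ℂ) * (((polarCoef m nt |l| : ℤ) : ℂ) *
    Kl m ((Δ : ℚ) / (4 * m)) (((4 * (m : ℤ) * nt - l ^ 2 : ℤ) : ℚ) / (4 * m)) γ ℓ l * (γ : ℂ)⁻¹ *
    (((((l ^ 2 - 4 * (m : ℤ) * nt : ℤ) : ℝ) / (Δ : ℝ)) ^ ((23 : ℝ) / 4) *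
      besselI (23 / 2) (π * √((Δ : ℝ) * ((l ^ 2 - 4 * (m : ℤ) * nt : ℤ) : ℝ)) / (γ * m)) : ℝ) : ℂ))

/-- The middle contribution to `Sgamma`, present only for `l = 0`. -/
noncomputable def middleT (m : ℕ) (Δ ℓ : ℤ) (γ : ℕ) : ℂ :=
  ((√(2 * m) * (dcoef m : ℝ) : ℝ) : ℂ) * Kl m ((Δ : ℚ) / (4 * m)) (-1) γ ℓ 0 *
    (((γ : ℝ) ^ (-(1 / 2 : ℝ)) : ℝ) : ℂ) *
    (((4 * (m : ℝ) / (Δ : ℝ)) ^ 6 * besselI 12 (2 * π * √((Δ : ℝ) / m) / γ) : ℝ) : ℂ)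

/-- The integral contribution to `Sgamma`. -/
noncomputable def integralT (m : ℕ) (Δ ℓ : ℤ) (γ : ℕ) (l : ℤ) : ℂ :=
  ∑ g ∈ (Finset.Ioc (-(m : ℤ) * γ) ((m : ℤ) * γ)).filter
      fun g => g % (2 * (m : ℤ)) = l % (2 * (m : ℤ)),
    Kl m ((Δ : ℚ) / (4 * m)) (-1 - (g : ℚ) ^ 2 / (4 * m)) γ ℓ l * ((γ : ℂ) ^ 2)⁻¹ *
      (((4 * (m : ℝ) / (Δ : ℝ)) ^ ((25 : ℝ) / 4) : ℝ) : ℂ) * innerInt m γ g Δ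

lemma Sgamma_eq (m : ℕ) (hm : 0 < m) (n ℓ : ℤ) (γ : ℕ) :
    Sgamma m n ℓ γ = (∑ l ∈ Finset.Icc (-(m : ℤ) + 1) m,
        ∑ nt ∈ (Finset.Icc (-1 : ℤ) m).filter (fun nt => 4 * (m : ℤ) * nt - l ^ 2 < 0),
          polarT m (4 * m * n - ℓ ^ 2) ℓ γ l nt)
      + (-middleT m (4 * m * n - ℓ ^ 2) ℓ γ + (((2 * π)⁻¹ * (dcoef m : ℝ) : ℝ) : ℂ) *
        ∑ l ∈ Finset.Icc (-(m : ℤ) + 1) m, integralT m (4 * m * n - ℓ ^ 2) ℓ γ l) := by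
  have h0 : (0 : ℤ) ∈ Finset.Icc (-(m : ℤ) + 1) m := by
    rw [Finset.mem_Icc]; omega
  have hmid : middleT m (4 * m * n - ℓ ^ 2) ℓ γ = ∑ l ∈ Finset.Icc (-(m : ℤ) + 1) m,
      (if l = 0 then (1 : ℂ) else 0) * middleT m (4 * m * n - ℓ ^ 2) ℓ γ := by
    rw [← Finset.sum_mul, Finset.sum_ite_eq' _ (0 : ℤ), if_pos h0, one_mul]
  rw [← add_assoc, ← sub_eq_add_neg, hmid, Finset.mul_sum, ← Finset.sum_sub_distrib, ← Finset.sum_add_distrib]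
  unfold Sgamma
  refine Finset.sum_congr rfl fun l _ => ?_
  unfold polarT middleT integralT
  rw [← Finset.mul_sum]
  simp only [mul_assoc]

/-- The absolute size of the leading term at `γ = 1`, per unit of polar coefficient. -/
noncomputable def leadK (m : ℕ) (Δ : ℝ) : ℝ := 2 * π * (√(2 * m))⁻¹ * leadC m Δ

lemma leadK_pos {m : ℕ} (hm : 0 < m) {Δ : ℝ} (hΔ : 0 ≤ Δ) : 0 < leadK m Δ := by
  have hm' : (0 : ℝ) < m := by exact_mod_cast hm
  have := leadC_pos hm hΔ
  unfold leadK
  positivity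

lemma rpow_nat_add_half {x : ℝ} (hx : 0 < x) (k : ℕ) : x ^ ((k : ℝ) + 1 / 2) = x ^ k * √x := by
  rw [Real.rpow_add hx, Real.rpow_natCast, Real.sqrt_eq_rpow]

lemma norm_polarT_le {m γ : ℕ} (hm : 3 ≤ m) (hγ : 0 < γ) {Δ : ℤ} (ℓ : ℤ) {l nt : ℤ}
    (hΔ : 3 * (m : ℝ) ^ 2 ≤ Δ) (hl : |l| ≤ m) (hnt : -1 ≤ nt) (hD : 4 * (m : ℤ) * nt - l ^ 2 < 0) :
    ‖polarT m Δ ℓ γ l nt‖ ≤ leadK m Δ * ((γ : ℝ) ^ 11)⁻¹ *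
      ((polarCoef m nt |l| : ℝ) * wX m ((l ^ 2 - 4 * m * nt : ℤ) : ℝ)) := by
  have hm' : (3 : ℝ) ≤ m := by exact_mod_cast hm
  have hm0 : (0 : ℝ) < m := by linarith
  have hγ' : (0 : ℝ) < γ := by exact_mod_cast hγ
  have hΔ0 : (0 : ℝ) < Δ := lt_of_lt_of_le (by positivity) hΔ
  have hc : (0 : ℝ) ≤ polarCoef m nt |l| := by
    exact_mod_cast polarCoef_nonneg (by exact_mod_cast hm) (abs_nonneg l) hl (by
      rw [sq_abs]; exact hD)
  set D : ℝ := ((l ^ 2 - 4 * (m : ℤ) * nt : ℤ) : ℝ) with hDdef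
  have hD0 : 0 ≤ D := by
    rw [hDdef]; exact_mod_cast (by linarith : (0 : ℤ) ≤ l ^ 2 - 4 * (m : ℤ) * nt)
  have hDm : D ≤ m ^ 2 + 4 * m := by
    have h1 : l ^ 2 ≤ (m : ℤ) ^ 2 := sq_le_sq' (by linarith [abs_le.1 hl]) (abs_le.1 hl).2
    have h2 : l ^ 2 - 4 * (m : ℤ) * nt ≤ m ^ 2 + 4 * m := by nlinarith
    rw [hDdef]; exact_mod_cast h2
  have hB := polar_bessel_le hm hγ hΔ hD0 hDm
  have hB0 : 0 ≤ (D / Δ) ^ ((23 : ℝ) / 4) * besselI (23 / 2) (π * √(Δ * D) / (γ * m)) := by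
    rw [polar_bessel_eq (by omega) hγ hΔ0 hD0]
    have := besselF_pos (ν := 23 / 2) (y := π ^ 2 * Δ / (4 * m ^ 2) * D / γ ^ 2)
      (by norm_num) (by positivity)
    positivity
  have hK := norm_Kl_le m γ (by omega) hγ ((Δ : ℚ) / (4 * m))
    (((4 * (m : ℤ) * nt - l ^ 2 : ℤ) : ℚ) / (4 * m)) ℓ l
  unfold polarT
  rw [norm_mul, norm_mul, norm_mul, norm_mul, Complex.norm_real, Complex.norm_real, ← hDdef,
    Real.norm_of_nonneg hB0, Real.norm_of_nonneg (by positivity : (0 : ℝ) ≤ 2 * π), norm_inv,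
    Complex.norm_natCast, Complex.norm_intCast, abs_of_nonneg hc]
  have hg : (γ : ℝ) ^ ((23 : ℝ) / 2) = (γ : ℝ) ^ 11 * √γ := by
    rw [← rpow_nat_add_half hγ']; norm_num
  rw [hg] at hB
  have hs : √(2 * (m : ℝ) * γ) = √(2 * m) * √γ := Real.sqrt_mul (by positivity) _
  rw [hs] at hK
  have hw := wX_nonneg m hD0
  have hC := leadC_pos (m := m) (by omega) hΔ0.le
  calc _ ≤ 2 * π * (polarCoef m nt |l| * ((√(2 * m) * √γ)⁻¹ * (γ : ℝ) ^ 2) * (γ : ℝ)⁻¹ *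
        (((γ : ℝ) ^ 11 * √γ)⁻¹ * (leadC m Δ * wX m D))) := by gcongr
    _ = _ := by
      unfold leadK
      have hs2 : (γ : ℝ) = √γ ^ 2 := (Real.sq_sqrt hγ'.le).symm
      have hs0 : 0 < √(γ : ℝ) := Real.sqrt_pos.2 hγ'
      have ht0 : 0 < √(2 * (m : ℝ)) := Real.sqrt_pos.2 (by positivity)
      generalize √(γ : ℝ) = s at *
      rw [hs2]
      field_simp

lemma middle_const_le {m : ℕ} (hm : 0 < m) :
    √(2 * π) / √12 ≤ 2 * π * (√(2 * m))⁻¹ * ((m / 10.8 + 0.3) / 2) := by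
  have hm0 : (0 : ℝ) < m := by exact_mod_cast hm
  have ht0 : 0 < √(2 * (m : ℝ)) := Real.sqrt_pos.2 (by positivity)
  have h : √(2 * π) / √12 * √(2 * m) ≤ π * (m / 10.8 + 0.3) := by
    rw [← Real.sqrt_div (by positivity), ← Real.sqrt_mul (by positivity)]
    apply Real.sqrt_le_iff.2 ⟨by positivity, ?_⟩
    have h1 : (m : ℝ) / 9 ≤ (m / 10.8 + 0.3) ^ 2 := by
      have : ((m : ℝ) / 10.8 + 0.3) ^ 2 = (m / 10.8 - 0.3) ^ 2 + m / 9 := by ring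
      rw [this]
      linarith [sq_nonneg ((m : ℝ) / 10.8 - 0.3)]
    have h2 : π ^ 2 * (m / 9) ≤ π ^ 2 * (m / 10.8 + 0.3) ^ 2 := by gcongr
    nlinarith [mul_pos Real.pi_pos hm0, mul_le_mul_of_nonneg_right Real.pi_gt_three.le
      (mul_pos Real.pi_pos hm0).le]
  calc √(2 * π) / √12 = √(2 * π) / √12 * √(2 * m) * (√(2 * m))⁻¹ := by field_simp
    _ ≤ π * (m / 10.8 + 0.3) * (√(2 * m))⁻¹ := by gcongr
    _ = _ := by ring

lemma dcoef_cast_le (m : ℕ) : (dcoef m : ℝ) ≤ majE (m + 1) := by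
  have h := dcoef_le_majE (n := (m : ℤ)) (by omega)
  rw [show ((m : ℤ) + 1).toNat = m + 1 by omega] at h
  exact_mod_cast h

lemma norm_middleT_le {m γ : ℕ} (hm : 3 ≤ m) (hγ : 0 < γ) {Δ : ℤ} (ℓ : ℤ)
    (hΔ : 3 * (m : ℝ) ^ 2 ≤ Δ) :
    ‖middleT m Δ ℓ γ‖ ≤ leadK m Δ * ((γ : ℝ) ^ 11)⁻¹ *
      (majE (m + 1) * wX m (4 * m) * ((m / 10.8 + 0.3) / 2)) := by
  have hm0 : (0 : ℝ) < m := by exact_mod_cast (by omega : 0 < m)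
  have hγ' : (0 : ℝ) < γ := by exact_mod_cast hγ
  have hΔ0 : (0 : ℝ) < Δ := lt_of_lt_of_le (by positivity) hΔ
  have hd0 : (0 : ℝ) ≤ dcoef m := by exact_mod_cast dcoef_nonneg m
  have hd := dcoef_cast_le m
  have hB := middle_bessel_le hm hγ hΔ
  have hB0 : 0 ≤ (4 * (m : ℝ) / Δ) ^ 6 * besselI 12 (2 * π * √((Δ : ℝ) / m) / γ) := by
    rw [besselI_eq (by norm_num) (by positivity)]
    have := besselF_pos (ν := 12) (y := (2 * π * √((Δ : ℝ) / m) / γ) ^ 2 / 4)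
      (by norm_num) (by positivity)
    positivity
  have hK := norm_Kl_le m γ (by omega) hγ ((Δ : ℚ) / (4 * m)) (-1) ℓ 0
  have hs : √(2 * (m : ℝ) * γ) = √(2 * m) * √γ := Real.sqrt_mul (by positivity) _
  rw [hs] at hK
  have hw := wX_nonneg m (D := 4 * m) (by positivity)
  have hC := leadC_pos (m := m) (by omega) hΔ0.le
  have hp : (γ : ℝ) ^ (-(1 / 2 : ℝ)) = (√γ)⁻¹ := by
    rw [Real.rpow_neg hγ'.le, Real.sqrt_eq_rpow]
  unfold middleT
  rw [norm_mul, norm_mul, norm_mul, Complex.norm_real, Complex.norm_real, Complex.norm_real,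
    Real.norm_of_nonneg hB0, hp, Real.norm_of_nonneg (by positivity : (0 : ℝ) ≤ (√γ)⁻¹),
    Real.norm_of_nonneg (by positivity : (0 : ℝ) ≤ √(2 * m) * dcoef m)]
  calc _ ≤ √(2 * m) * majE (m + 1) * ((√(2 * m) * √γ)⁻¹ * (γ : ℝ) ^ 2) * (√γ)⁻¹ *
        (((γ : ℝ) ^ 12)⁻¹ * (√(2 * π) / √12 * (leadC m Δ * wX m (4 * m)))) := by gcongr
    _ = ((γ : ℝ) ^ 11)⁻¹ * majE (m + 1) * leadC m Δ * wX m (4 * m) * (√(2 * π) / √12) := by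
      have hs2 : (γ : ℝ) = √γ ^ 2 := (Real.sq_sqrt hγ'.le).symm
      have hs0 : 0 < √(γ : ℝ) := Real.sqrt_pos.2 hγ'
      have ht0 : 0 < √(2 * (m : ℝ)) := Real.sqrt_pos.2 (by positivity)
      generalize √(γ : ℝ) = s at *
      rw [hs2]
      field_simp
    _ ≤ ((γ : ℝ) ^ 11)⁻¹ * majE (m + 1) * leadC m Δ * wX m (4 * m) *
        (2 * π * (√(2 * m))⁻¹ * ((m / 10.8 + 0.3) / 2)) := by
      gcongr
      exact middle_const_le (by omega)
    _ = _ := by unfold leadK; ring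

lemma integral_const_le {m : ℕ} (hm : 0 < m) :
    (2 * π)⁻¹ * (2 * π / (25 / 2)) * √(π / (25 / 2 * m)) * π ^ 2
      ≤ 2 * π * ((0.867 / m + 0.29) / 2 * 0.1257) := by
  have hm0 : (0 : ℝ) < m := by exact_mod_cast hm
  have hπ := Real.pi_lt_d4
  have h1 : √(π / (25 / 2 * m)) ≤ (0.867 / m + 0.29) / 2 := by
    apply Real.sqrt_le_iff.2 ⟨by positivity, ?_⟩
    have h2 : 0.25143 / (m : ℝ) ≤ ((0.867 / m + 0.29) / 2) ^ 2 := by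
      have : ((0.867 / (m : ℝ) + 0.29) / 2) ^ 2
        = ((0.867 / (m : ℝ) - 0.29) / 2) ^ 2 + 0.25143 / m := by ring
      rw [this]
      linarith [sq_nonneg ((0.867 / (m : ℝ) - 0.29) / 2)]
    refine le_trans ?_ h2
    rw [← div_div]
    gcongr
    linarith
  have h0 := Real.pi_pos
  calc _ = π * (2 * (π / 25)) * √(π / (25 / 2 * m)) := by field_simp
    _ ≤ π * (2 * 0.1257) * ((0.867 / m + 0.29) / 2) := by gcongr; linarith
    _ = _ := by ring

lemma norm_integral_part_le {m γ : ℕ} (hm : 3 ≤ m) (hγ : 0 < γ) {Δ : ℤ} (ℓ : ℤ)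
    (hΔ : 3 * (m : ℝ) ^ 2 ≤ Δ) :
    ‖(((2 * π)⁻¹ * (dcoef m : ℝ) : ℝ) : ℂ) *
        ∑ l ∈ Finset.Icc (-(m : ℤ) + 1) m, integralT m Δ ℓ γ l‖
      ≤ leadK m Δ * ((γ : ℝ) ^ 11)⁻¹ * (majE (m + 1) * wX m (4 * m) *
        ((0.867 / m + 0.29) / 2 * 0.1257 * (2 * m + 4 * m ^ 2 / 3))) := by
  have hm0 : (0 : ℝ) < m := by exact_mod_cast (by omega : 0 < m)
  have hγ' : (0 : ℝ) < γ := by exact_mod_cast hγ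
  have hΔ0 : (0 : ℝ) < Δ := lt_of_lt_of_le (by positivity) hΔ
  have hd0 : (0 : ℝ) ≤ dcoef m := by exact_mod_cast dcoef_nonneg m
  have hd := dcoef_cast_le m
  have hw := wX_nonneg m (D := 4 * m) (by positivity)
  have hC := leadC_pos (m := m) (by omega) hΔ0.le
  have hI : ‖∑ l ∈ Finset.Icc (-(m : ℤ) + 1) m, integralT m Δ ℓ γ l‖ ≤ _ :=
    (norm_sum_le _ _).trans (norm_integral_terms_le (m := m) (γ := γ) (Δ := Δ) (by omega) hγ
      (by exact_mod_cast hΔ0) ((Δ : ℚ) / (4 * m)) (fun g => -1 - (g : ℚ) ^ 2 / (4 * m)) ℓ)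
  have hs : √(2 * (m : ℝ) * γ) = √(2 * m) * √γ := Real.sqrt_mul (by positivity) _
  have hB := integral_bessel_le hm hγ hΔ
  have hg : (γ : ℝ) ^ ((25 : ℝ) / 2) = (γ : ℝ) ^ 12 * √γ := by
    rw [← rpow_nat_add_half hγ']; norm_num
  rw [hg] at hB
  rw [hs] at hI
  rw [norm_mul, Complex.norm_real,
    Real.norm_of_nonneg (by positivity : (0 : ℝ) ≤ (2 * π)⁻¹ * dcoef m)]
  calc _ ≤ (2 * π)⁻¹ * majE (m + 1) * ((√(2 * m) * √γ)⁻¹ *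
        (((γ : ℝ) ^ 12 * √γ)⁻¹ * (2 * π / (25 / 2) * (leadC m Δ * wX m (4 * m))) *
          √(π / (25 / 2 * m))) * (π ^ 2 * γ ^ 2 * (2 * m + 4 * m ^ 2 / 3))) := by
        gcongr
        refine hI.trans ?_
        gcongr
    _ = ((γ : ℝ) ^ 11)⁻¹ * majE (m + 1) * leadC m Δ * wX m (4 * m) * (√(2 * m))⁻¹ *
        (2 * m + 4 * m ^ 2 / 3) *
        ((2 * π)⁻¹ * (2 * π / (25 / 2)) * √(π / (25 / 2 * m)) * π ^ 2) := by
      have hs2 : (γ : ℝ) = √γ ^ 2 := (Real.sq_sqrt hγ'.le).symm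
      have hs0 : 0 < √(γ : ℝ) := Real.sqrt_pos.2 hγ'
      have ht0 : 0 < √(2 * (m : ℝ)) := Real.sqrt_pos.2 (by positivity)
      generalize √(γ : ℝ) = s at *
      generalize √(π / (25 / 2 * m)) = u at *
      rw [hs2]
      field_simp
    _ ≤ ((γ : ℝ) ^ 11)⁻¹ * majE (m + 1) * leadC m Δ * wX m (4 * m) * (√(2 * m))⁻¹ *
        (2 * m + 4 * m ^ 2 / 3) * (2 * π * ((0.867 / m + 0.29) / 2 * 0.1257)) := by
      have := integral_const_le (m := m) (by omega)
      gcongr ?_ * ?_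
    _ = _ := by unfold leadK; ring

/-- The non-polar part of `Sgamma` is controlled by the last summand of `totalB`. -/
lemma norm_nonpolar_le {m γ : ℕ} (hm : 3 ≤ m) (hγ : 0 < γ) {Δ : ℤ} (ℓ : ℤ)
    (hΔ : 3 * (m : ℝ) ^ 2 ≤ Δ) :
    ‖-middleT m Δ ℓ γ + (((2 * π)⁻¹ * (dcoef m : ℝ) : ℝ) : ℂ) *
        ∑ l ∈ Finset.Icc (-(m : ℤ) + 1) m, integralT m Δ ℓ γ l‖
      ≤ leadK m Δ * ((γ : ℝ) ^ 11)⁻¹ * (majE (m + 1) * wX m (4 * m) * corrC m) := by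
  refine (norm_add_le _ _).trans ?_
  rw [norm_neg]
  refine (add_le_add (norm_middleT_le hm hγ ℓ hΔ) (norm_integral_part_le hm hγ ℓ hΔ)).trans_eq ?_
  unfold corrC
  ring

lemma norm_polarT_le_of_mem {m γ : ℕ} (hm : 3 ≤ m) (hγ : 0 < γ) {Δ : ℤ} (ℓ : ℤ)
    (hΔ : 3 * (m : ℝ) ^ 2 ≤ Δ) {l nt : ℤ} (hl : l ∈ Finset.Icc (-(m : ℤ) + 1) m)
    (hnt : nt ∈ (Finset.Icc (-1 : ℤ) m).filter (fun nt => 4 * (m : ℤ) * nt - l ^ 2 < 0)) :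
    ‖polarT m Δ ℓ γ l nt‖ ≤ leadK m Δ * ((γ : ℝ) ^ 11)⁻¹ *
      ((polarCoef m nt |l| : ℝ) * wX m ((l ^ 2 - 4 * m * nt : ℤ) : ℝ)) := by
  rw [Finset.mem_Icc] at hl
  rw [Finset.mem_filter, Finset.mem_Icc] at hnt
  exact norm_polarT_le hm hγ ℓ hΔ (abs_le.2 ⟨by omega, hl.2⟩) hnt.1.1 hnt.2

lemma norm_Sgamma_le {m γ : ℕ} (hm : 3 ≤ m) (hγ : 0 < γ) (n ℓ : ℤ)
    (hΔ : 3 * (m : ℝ) ^ 2 ≤ ((4 * m * n - ℓ ^ 2 : ℤ) : ℝ)) :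
    ‖Sgamma m n ℓ γ‖
      ≤ leadK m ((4 * m * n - ℓ ^ 2 : ℤ) : ℝ) * ((γ : ℝ) ^ 11)⁻¹ * totalB m := by
  have hK := leadK_pos (m := m) (by omega) (le_trans (by positivity) hΔ)
  have hγ' : (0 : ℝ) < γ := by exact_mod_cast hγ
  have hpol : ‖∑ l ∈ Finset.Icc (-(m : ℤ) + 1) m,
      ∑ nt ∈ (Finset.Icc (-1 : ℤ) m).filter (fun nt => 4 * (m : ℤ) * nt - l ^ 2 < 0),
        polarT m (4 * m * n - ℓ ^ 2) ℓ γ l nt‖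
      ≤ leadK m ((4 * m * n - ℓ ^ 2 : ℤ) : ℝ) * ((γ : ℝ) ^ 11)⁻¹ *
        ∑ l ∈ Finset.Icc (-(m : ℤ) + 1) m,
          ∑ nt ∈ (Finset.Icc (-1 : ℤ) m).filter (fun nt => 4 * (m : ℤ) * nt - l ^ 2 < 0),
            (polarCoef m nt |l| : ℝ) * wX m ((l ^ 2 - 4 * m * nt : ℤ) : ℝ) := by
    rw [Finset.mul_sum]
    refine norm_sum_le_of_le _ fun l hl => ?_
    rw [Finset.mul_sum]
    exact norm_sum_le_of_le _ fun nt hnt => norm_polarT_le_of_mem hm hγ ℓ hΔ hl hnt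
  rw [Sgamma_eq m (by omega)]
  refine (norm_add_le _ _).trans ((add_le_add hpol (norm_nonpolar_le hm hγ ℓ hΔ)).trans ?_)
  rw [← mul_add]
  unfold totalB
  gcongr
  exact polar_sum_le hm

/-- The phase `(-1)^ℓ e^{iπ/4}`. -/
noncomputable def phase (ℓ : ℤ) : ℂ := (-1 : ℂ) ^ ℓ * Complex.exp ((π : ℂ) * Complex.I / 4)

lemma norm_phase (ℓ : ℤ) : ‖phase ℓ‖ = 1 := by
  unfold phase
  rw [norm_mul, norm_zpow, norm_neg, norm_one, one_zpow, one_mul, Complex.norm_exp]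
  simp

lemma neg_norm_le_re (z : ℂ) : -‖z‖ ≤ z.re :=
  (neg_le_neg (Complex.abs_re_le_norm z)).trans (neg_abs_le _)

/-- The leading polar term at `γ = 1` is real and positive after multiplying by the phase. -/
lemma phase_mul_polarT_main {m : ℕ} (hm : 3 ≤ m) {Δ : ℤ} (ℓ : ℤ) (hΔ : 0 < (Δ : ℝ)) :
    (phase ℓ * polarT m Δ ℓ 1 m (-1)).re = leadK m Δ * (polarCoef m (-1) |(m : ℤ)| : ℝ) := by
  have hm0 : (0 : ℝ) < m := by exact_mod_cast (by omega : 0 < m)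
  have hK := Kl_one_self m (by omega) ((Δ : ℚ) / (4 * m))
    (((4 * (m : ℤ) * (-1) - (m : ℤ) ^ 2 : ℤ) : ℚ) / (4 * m)) ℓ
  have hD : (((m : ℤ) ^ 2 - 4 * (m : ℤ) * (-1) : ℤ) : ℝ) = m ^ 2 + 4 * m := by push_cast; ring
  have hB := polar_bessel_eq (m := m) (γ := 1) (by omega) one_pos hΔ
    (D := m ^ 2 + 4 * m) (by positivity)
  have hB' : ((m ^ 2 + 4 * m : ℝ) / Δ) ^ ((23 : ℝ) / 4) *
      besselI (23 / 2) (π * √(Δ * (m ^ 2 + 4 * m)) / (((1 : ℕ) : ℝ) * m)) = leadC m Δ := by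
    rw [hB]
    simp [leadC]
  have : phase ℓ * polarT m Δ ℓ 1 m (-1)
      = ((leadK m Δ * (polarCoef m (-1) |(m : ℤ)| : ℝ) : ℝ) : ℂ) := by
    unfold polarT
    rw [hD, hB']
    calc _ = ((2 * π : ℝ) : ℂ) * ((polarCoef m (-1) |(m : ℤ)| : ℤ) : ℂ) *
          (phase ℓ * Kl m ((Δ : ℚ) / (4 * m))
            (((4 * (m : ℤ) * (-1) - (m : ℤ) ^ 2 : ℤ) : ℚ) / (4 * m)) 1 ℓ m) *
          ((leadC m Δ : ℝ) : ℂ) := by simp; ring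
      _ = _ := by
        unfold phase leadK
        rw [hK]
        push_cast
        ring
  rw [this, Complex.ofReal_re]

lemma re_phase_mul_Sgamma_one_ge {m : ℕ} (hm : 3 ≤ m) (n ℓ : ℤ)
    (hΔ : 3 * (m : ℝ) ^ 2 ≤ ((4 * m * n - ℓ ^ 2 : ℤ) : ℝ)) :
    leadK m ((4 * m * n - ℓ ^ 2 : ℤ) : ℝ) * (2 * (m + 2) - totalB m)
      ≤ (phase ℓ * Sgamma m n ℓ 1).re := by
  have hm0 : (0 : ℝ) < m := by exact_mod_cast (by omega : 0 < m)
  have hΔ0 : 0 < ((4 * m * n - ℓ ^ 2 : ℤ) : ℝ) := lt_of_lt_of_le (by positivity) hΔ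
  have hK := leadK_pos (m := m) (by omega) hΔ0.le
  set Δ : ℤ := 4 * m * n - ℓ ^ 2 with hΔdef
  set v : ℤ → ℤ → ℝ := fun l nt => leadK m Δ *
    ((polarCoef m nt |l| : ℝ) * wX m ((l ^ 2 - 4 * m * nt : ℤ) : ℝ)) with hv
  have hpos : ∀ l ∈ Finset.Icc (-(m : ℤ) + 1) m,
      ∀ nt ∈ (Finset.Icc (-1 : ℤ) m).filter (fun nt => 4 * (m : ℤ) * nt - l ^ 2 < 0),
        0 ≤ (phase ℓ * polarT m Δ ℓ 1 l nt).re + v l nt := by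
    intro l hl nt hnt
    have h1 := norm_polarT_le_of_mem hm one_pos ℓ hΔ hl hnt
    have h2 := neg_norm_le_re (phase ℓ * polarT m Δ ℓ 1 l nt)
    rw [norm_mul, norm_phase, one_mul] at h2
    simp only [Nat.cast_one, one_pow, inv_one, mul_one] at h1
    simp only [hv]
    linarith
  have hmain : 2 * (leadK m Δ * (m + 2)) ≤ ∑ l ∈ Finset.Icc (-(m : ℤ) + 1) m,
      ∑ nt ∈ (Finset.Icc (-1 : ℤ) m).filter (fun nt => 4 * (m : ℤ) * nt - l ^ 2 < 0),
        ((phase ℓ * polarT m Δ ℓ 1 l nt).re + v l nt) := by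
    have hmem1 : (m : ℤ) ∈ Finset.Icc (-(m : ℤ) + 1) m := by rw [Finset.mem_Icc]; omega
    have hmem2 : (-1 : ℤ) ∈
        (Finset.Icc (-1 : ℤ) m).filter (fun nt => 4 * (m : ℤ) * nt - (m : ℤ) ^ 2 < 0) := by
      rw [Finset.mem_filter, Finset.mem_Icc]
      exact ⟨by omega, by nlinarith [(by omega : (3 : ℤ) ≤ m)]⟩
    refine le_trans ?_ (Finset.single_le_sum (f := fun l : ℤ =>
      ∑ nt ∈ (Finset.Icc (-1 : ℤ) m).filter (fun nt => 4 * (m : ℤ) * nt - l ^ 2 < 0),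
        ((phase ℓ * polarT m Δ ℓ 1 l nt).re + v l nt))
      (fun l hl => Finset.sum_nonneg (hpos l hl)) hmem1)
    refine le_trans ?_ (Finset.single_le_sum (hpos m hmem1) hmem2)
    have hc : ((m : ℝ) + 2) ≤ polarCoef m (-1) |(m : ℤ)| := by
      rw [Nat.abs_cast]
      exact_mod_cast polarCoef_main_ge (m := (m : ℤ)) (by exact_mod_cast hm)
    have hX : wX m (((m : ℤ) ^ 2 - 4 * m * (-1) : ℤ) : ℝ) = 1 := by
      rw [show (((m : ℤ) ^ 2 - 4 * m * (-1) : ℤ) : ℝ) = m ^ 2 + 4 * m by push_cast; ring]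
      exact wX_top (by omega)
    simp only [hv]
    rw [phase_mul_polarT_main hm ℓ hΔ0, hX]
    nlinarith [mul_le_mul_of_nonneg_left hc hK.le]
  have hsum : ∑ l ∈ Finset.Icc (-(m : ℤ) + 1) m,
      ∑ nt ∈ (Finset.Icc (-1 : ℤ) m).filter (fun nt => 4 * (m : ℤ) * nt - l ^ 2 < 0), v l nt
      ≤ leadK m Δ * (70 / 69 * (∑ k ∈ Finset.range m, rowTerm m k +
          ∑ k ∈ Finset.range m, rowTerm m (k + 1)) + 8 * m ^ 3 * (m + 2) * epsE m) := by
    simp only [hv, ← Finset.mul_sum]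
    exact mul_le_mul_of_nonneg_left (polar_sum_le hm) hK.le
  have hrest := norm_nonpolar_le hm one_pos ℓ hΔ
  have hrest' := neg_norm_le_re (phase ℓ * (-middleT m Δ ℓ 1 +
    (((2 * π)⁻¹ * (dcoef m : ℝ) : ℝ) : ℂ) *
        ∑ l ∈ Finset.Icc (-(m : ℤ) + 1) m, integralT m Δ ℓ 1 l))
  rw [norm_mul, norm_phase, one_mul] at hrest'
  simp only [Nat.cast_one, one_pow, inv_one, mul_one] at hrest
  rw [Sgamma_eq m (by omega), ← hΔdef]
  generalize -middleT m Δ ℓ 1 + (((2 * π)⁻¹ * (dcoef m : ℝ) : ℝ) : ℂ) *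
        ∑ l ∈ Finset.Icc (-(m : ℤ) + 1) m, integralT m Δ ℓ 1 l = R at *
  rw [mul_add (phase ℓ), Complex.add_re]
  simp only [Finset.mul_sum, Complex.re_sum]
  simp only [Finset.sum_add_distrib] at hmain
  unfold totalB
  linarith

lemma three_mul_sq_le_disc {m : ℕ} {n ℓ : ℤ} (hn : (m : ℤ) ≤ n) (hℓ0 : 0 ≤ ℓ)
    (hℓm : ℓ ≤ (m : ℤ)) : 3 * (m : ℝ) ^ 2 ≤ ((4 * m * n - ℓ ^ 2 : ℤ) : ℝ) := by
  have h : 3 * (m : ℤ) ^ 2 ≤ 4 * m * n - ℓ ^ 2 := by nlinarith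
  exact_mod_cast h

lemma inv_pow_eleven_le {N : ℕ} (hN : 1 ≤ N) :
    (((N + 1 : ℕ) : ℝ) ^ 11)⁻¹ ≤ 1 / 512 * (1 / (N : ℝ) - 1 / ((N + 1 : ℕ) : ℝ)) := by
  have hN' : (1 : ℝ) ≤ N := by exact_mod_cast hN
  push_cast
  have h1 : 1 / (N : ℝ) - 1 / ((N : ℝ) + 1) = 1 / (N * (N + 1)) := by field_simp; ring
  rw [h1, ← one_div, div_mul_div_comm, one_mul]
  apply one_div_le_one_div_of_le (by positivity)
  have h2 : (512 : ℝ) ≤ (N + 1) ^ 9 := by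
    calc (512 : ℝ) = (1 + 1) ^ 9 := by norm_num
      _ ≤ _ := by gcongr
  calc 512 * ((N : ℝ) * (N + 1)) ≤ (N + 1) ^ 9 * ((N + 1) * (N + 1)) := by gcongr; linarith
    _ = _ := by ring

/-- A series dominated by `K γ⁻¹¹` converges, and its real part is controlled by the first term. -/
lemma exists_limit_re_pos {f : ℕ → ℂ} {K c : ℝ} (hK : 0 ≤ K)
    (hf : ∀ γ : ℕ, 0 < γ → ‖f γ‖ ≤ K * ((γ : ℝ) ^ 11)⁻¹) (h1 : c ≤ (f 1).re) (hc : K / 512 < c) :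
    ∃ L : ℂ, Filter.Tendsto (fun N : ℕ => ∑ γ ∈ Finset.Icc 1 N, f γ) Filter.atTop (nhds L) ∧
      0 < L.re := by
  have hs : Summable fun γ : ℕ => f (γ + 1) := by
    have h2 : Summable fun γ : ℕ => K * (((γ : ℕ) : ℝ) ^ 11)⁻¹ :=
      (Real.summable_nat_pow_inv.2 (by norm_num)).mul_left K
    exact Summable.of_norm_bounded ((summable_nat_add_iff 1).2 h2) fun γ => hf (γ + 1) γ.succ_pos
  have hpart : ∀ N : ℕ, ∑ γ ∈ Finset.Icc 1 N, f γ = ∑ γ ∈ Finset.range N, f (γ + 1) := by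
    intro N
    induction N with
    | zero => simp
    | succ N ih => rw [Finset.sum_Icc_succ_top (by omega), ih, Finset.sum_range_succ]
  have ht : Filter.Tendsto (fun N : ℕ => ∑ γ ∈ Finset.Icc 1 N, f γ) Filter.atTop
      (nhds (∑' γ : ℕ, f (γ + 1))) := by
    simp only [hpart]
    exact hs.hasSum.tendsto_sum_nat
  refine ⟨_, ht, ?_⟩
  have hlow : ∀ N : ℕ, 1 ≤ N →
      c - K / 512 * (1 - 1 / (N : ℝ)) ≤ (∑ γ ∈ Finset.Icc 1 N, f γ).re := by
    intro N hN
    induction N, hN using Nat.le_induction with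
    | base => simpa using h1
    | succ N hN ih =>
      rw [Finset.sum_Icc_succ_top (by omega), Complex.add_re]
      have h3 := hf (N + 1) N.succ_pos
      have h4 := mul_le_mul_of_nonneg_left (inv_pow_eleven_le hN) hK
      have h5 := neg_norm_le_re (f (N + 1))
      linarith
  have hre := (Complex.continuous_re.tendsto _).comp ht
  have hge : c - K / 512 ≤ (∑' γ : ℕ, f (γ + 1)).re := by
    refine ge_of_tendsto hre ?_
    filter_upwards [Filter.eventually_ge_atTop 1] with N hN
    refine le_trans ?_ (hlow N hN)
    have h6 : 0 ≤ K / 512 * (1 / (N : ℝ)) := by positivity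
    linarith
  linarith

/-- Positivity of the immortal dyon index `(−1)^{ℓ+1} c_m^F(n, ℓ)` in its
Rademacher-expansion form: the series `(−1)^ℓ e^{iπ/4} Σ_{γ≥1} S(γ)` converges and the
real part of its sum is strictly positive. -/
theorem stmt19 (m : ℕ) (hm : 3 ≤ m) (n ℓ : ℤ) (hn : (m : ℤ) ≤ n)
    (hℓ0 : 0 ≤ ℓ) (hℓm : ℓ ≤ (m : ℤ)) :
    ∃ L : ℂ,
      Filter.Tendsto
        (fun N : ℕ => ∑ γ ∈ Finset.Icc 1 N,
          (-1 : ℂ) ^ ℓ * Complex.exp ((Real.pi : ℂ) * Complex.I / 4) * Sgamma m n ℓ γ)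
        Filter.atTop (nhds L) ∧ 0 < L.re := by
  have hΔ := three_mul_sq_le_disc hn hℓ0 hℓm
  have hK := leadK_pos (m := m) (by omega) (le_trans (by positivity) hΔ)
  have hB := totalB_le hm
  have hB0 : 0 ≤ totalB m := by
    have h := (norm_nonneg _).trans (norm_Sgamma_le hm one_pos n ℓ hΔ)
    simp only [Nat.cast_one, one_pow, inv_one, mul_one] at h
    exact nonneg_of_mul_nonneg_right h hK
  refine exists_limit_re_pos (f := fun γ => phase ℓ * Sgamma m n ℓ γ)
    (mul_nonneg hK.le hB0) (fun γ hγ => ?_) (re_phase_mul_Sgamma_one_ge hm n ℓ hΔ) ?_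
  · rw [norm_mul, norm_phase, one_mul]
    exact (norm_Sgamma_le hm hγ n ℓ hΔ).trans_eq (by ring)
  · rw [mul_div_assoc]
    apply mul_lt_mul_of_pos_left _ hK
    have : (0 : ℝ) ≤ m := m.cast_nonneg
    linarith
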